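/- Let k be a p-adic field with Galois closure k_G over ℚ_p, d_G = [k_G:ℚ_p], and e_G the ramification index of k_G/k. For every uniformizer π of k, there exist a finite unramified extension k'/k_G and a uniformizer π' of k' such that: (i) Nr_{k'/k}(π') = π^{f_{k'/k}} where f_{k'/k} is the residual degree; (ii) the Lubin-Tate extension k_π is contained in the Lubin-Tate extension k'_{π'}; (iii) k'/ℚ_p is Galois; and (iv) [k':ℚ_p] = s·d_G for some integer 1 ≤ s ≤ e_G. -/

import Mathlib

noncomputable def resCard (p : ℕ) [Fact p.Prime] (k : Type*) [Field k] [Algebra ℤ_[p] k] : ℕ :=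
  Nat.card ((integralClosure ℤ_[p] k) ⧸ ((⊥ : Ideal (integralClosure ℤ_[p] k)).jacobson))

def IsUniformizer (p : ℕ) [Fact p.Prime] (k : Type*) [Field k] [Algebra ℤ_[p] k] (π : k) :
    Prop :=
  ∃ h : π ∈ integralClosure ℤ_[p] k, Irreducible (⟨π, h⟩ : integralClosure ℤ_[p] k)

/-- Lubin-Tate extension of `k` associated with a uniformizer `π`, inside `Ω`
(see stmt_7): union of the finite abelian extensions of `k` from which `π` is a norm. -/
noncomputable def lubinTateExt (k Ω : Type*) [Field k] [Field Ω] [Algebra k Ω] (π : k) :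
    IntermediateField k Ω :=
  ⨆ L ∈ {L : IntermediateField k Ω | FiniteDimensional k L ∧ IsGalois k L ∧
      (∀ σ τ : L ≃ₐ[k] L, σ * τ = τ * σ) ∧ ∃ x : L, Algebra.norm k x = π}, L

section Part1
open Module

set_option linter.unusedSectionVars false
set_option linter.unusedVariables false
section basics
variable (p : ℕ) [Fact p.Prime] {E F : Type*} [Field E] [Algebra ℚ_[p] E] [FiniteDimensional ℚ_[p] E]
  [Field F] [Algebra ℚ_[p] F] [FiniteDimensional ℚ_[p] F]

/-- The (un-normalised) valuation. -/
noncomputable def wv (x : E) : ℤ := (Algebra.norm ℚ_[p] x).valuation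

lemma wv_mul {x y : E} (hx : x ≠ 0) (hy : y ≠ 0) : wv p (x * y) = wv p x + wv p y := by
  rw [wv, map_mul, Padic.valuation_mul (Algebra.norm_ne_zero_iff.2 hx) (Algebra.norm_ne_zero_iff.2 hy)]
  rfl

lemma wv_one : wv p (1 : E) = 0 := by simp [wv]

lemma wv_inv (x : E) : wv p x⁻¹ = - wv p x := by
  rw [wv, Algebra.norm_inv, Padic.valuation_inv]; rfl

lemma wv_pow (x : E) (n : ℕ) : wv p (x ^ n) = n * wv p x := by
  rw [wv, map_pow, Padic.valuation_pow]; rfl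

lemma wv_p : wv p (p : E) = finrank ℚ_[p] E := by
  have : (p : E) = algebraMap ℚ_[p] E p := by simp
  rw [wv, this, Algebra.norm_algebraMap, Padic.valuation_pow, Padic.valuation_p, mul_one]

lemma wv_norm [Algebra E F] [IsScalarTower ℚ_[p] E F] (x : F) :
    wv p (Algebra.norm E x) = wv p x := by
  have : FiniteDimensional E F := FiniteDimensional.right ℚ_[p] E F
  rw [wv, Algebra.norm_norm]; rfl

lemma wv_algebraMap [Algebra E F] [IsScalarTower ℚ_[p] E F] (x : E) :
    wv p (algebraMap E F x) = finrank E F * wv p x := by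
  have : FiniteDimensional E F := FiniteDimensional.right ℚ_[p] E F
  rw [← wv_norm p (E := E), Algebra.norm_algebraMap, wv_pow]

lemma wv_algEquiv (σ : E ≃ₐ[ℚ_[p]] F) (x : E) : wv p (σ x) = wv p x := by
  rw [wv, wv, Algebra.norm_eq_of_algEquiv σ]

lemma sn_norm (x : E) : ‖Algebra.norm ℚ_[p] x‖ = spectralNorm ℚ_[p] E x ^ finrank ℚ_[p] E := by
  have h := Algebra.norm_eq_prod_embeddings ℚ_[p] (AlgebraicClosure ℚ_[p]) x
  have h2 := congrArg (spectralMulAlgNorm ℚ_[p] (AlgebraicClosure ℚ_[p])) h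
  rw [map_prod, spectralMulAlgNorm_def, spectralNorm_extends] at h2
  rw [h2]
  have : ∀ σ : E →ₐ[ℚ_[p]] AlgebraicClosure ℚ_[p],
      spectralMulAlgNorm ℚ_[p] (AlgebraicClosure ℚ_[p]) (σ x) = spectralNorm ℚ_[p] E x := by
    intro σ
    rw [spectralMulAlgNorm_def, spectralNorm, spectralNorm, minpoly.algHom_eq σ σ.injective]
  rw [Finset.prod_congr rfl (fun σ _ => this σ), Finset.prod_const, Finset.card_univ,
    AlgHom.card]

lemma sn_le_one_iff {x : E} (hx : x ≠ 0) : spectralNorm ℚ_[p] E x ≤ 1 ↔ 0 ≤ wv p x := by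
  rw [wv, ← Padic.norm_le_one_iff_val_nonneg, sn_norm,
    pow_le_one_iff_of_nonneg (spectralNorm_nonneg x) finrank_pos.ne']

variable [Algebra ℤ_[p] E] [IsScalarTower ℤ_[p] ℚ_[p] E]

lemma isIntegral_iff_sn (x : E) : IsIntegral ℤ_[p] x ↔ spectralNorm ℚ_[p] E x ≤ 1 := by
  have hx : IsIntegral ℚ_[p] x := Algebra.IsIntegral.isIntegral x
  rw [spectralNorm, spectralValue_le_one_iff (minpoly.monic hx)]
  constructor
  · intro h n
    rw [minpoly.isIntegrallyClosed_eq_field_fractions' ℚ_[p] h, Polynomial.coeff_map]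
    exact (PadicInt.norm_le_one _)
  · intro h
    have hl : minpoly ℚ_[p] x ∈ Polynomial.lifts (algebraMap ℤ_[p] ℚ_[p]) := by
      rw [Polynomial.lifts_iff_coeff_lifts]
      intro n
      exact ⟨⟨_, h n⟩, rfl⟩
    obtain ⟨q, hq, -, hm⟩ := Polynomial.lifts_and_natDegree_eq_and_monic hl (minpoly.monic hx)
    refine ⟨q, hm, ?_⟩
    rw [IsScalarTower.algebraMap_eq ℤ_[p] ℚ_[p] E, ← Polynomial.eval₂_map, hq]
    exact minpoly.aeval _ _

lemma isIntegral_iff_wv {x : E} (hx : x ≠ 0) : IsIntegral ℤ_[p] x ↔ 0 ≤ wv p x := by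
  rw [isIntegral_iff_sn, sn_le_one_iff p hx]

instance instCharZeroE : FaithfulSMul ℤ_[p] E := by
  rw [faithfulSMul_iff_algebraMap_injective, IsScalarTower.algebraMap_eq ℤ_[p] ℚ_[p] E]
  exact (algebraMap ℚ_[p] E).injective.comp (IsFractionRing.injective ℤ_[p] ℚ_[p])

variable (E) in
noncomputable abbrev OO := integralClosure ℤ_[p] E

lemma OO_isUnit_iff (x : OO p E) : IsUnit x ↔ ((x : E) ≠ 0 ∧ wv p (x : E) = 0) := by
  constructor
  · rintro ⟨u, rfl⟩
    have hu : ((u : OO p E) : E) ≠ 0 := by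
      simp
    have h1 := (isIntegral_iff_wv p hu).1 (u : OO p E).2
    have h2 : ((u⁻¹ : (OO p E)ˣ) : OO p E).1 = ((u : OO p E) : E)⁻¹ := by
      refine eq_inv_of_mul_eq_one_left ?_
      exact congrArg Subtype.val (Units.inv_mul u)
    have h3 := (isIntegral_iff_wv p (inv_ne_zero hu)).1 (h2 ▸ (↑u⁻¹ : OO p E).2)
    rw [wv_inv] at h3
    exact ⟨hu, by omega⟩
  · rintro ⟨h0, h1⟩
    have : IsIntegral ℤ_[p] (x : E)⁻¹ := (isIntegral_iff_wv p (inv_ne_zero h0)).2 (by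
      rw [wv_inv, h1]; simp)
    exact IsUnit.of_mul_eq_one ⟨_, this⟩ (Subtype.ext (mul_inv_cancel₀ h0))

lemma OO_isUnit_iff_sn (x : OO p E) : IsUnit x ↔ spectralNorm ℚ_[p] E x = 1 := by
  have h := (isIntegral_iff_sn p (x : E)).1 x.2
  rw [OO_isUnit_iff]
  constructor
  · rintro ⟨h0, h1⟩
    have h2 : spectralNorm ℚ_[p] E (x : E)⁻¹ ≤ 1 := (sn_le_one_iff p (inv_ne_zero h0)).2 (by
      rw [wv_inv, h1]; simp)
    have h3 : spectralNorm ℚ_[p] E (x : E)⁻¹ = (spectralNorm ℚ_[p] E (x : E))⁻¹ :=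
      map_inv₀ (spectralMulAlgNorm ℚ_[p] E) (x : E)
    rw [h3] at h2
    have : 0 < spectralNorm ℚ_[p] E (x : E) := spectralNorm_zero_lt h0 (Algebra.IsAlgebraic.isAlgebraic _)
    have := (inv_le_one₀ this).1 h2
    linarith
  · intro h1
    have h0 : (x : E) ≠ 0 := by
      intro h0; rw [h0, spectralNorm_zero] at h1; norm_num at h1
    refine ⟨h0, ?_⟩
    have h3 := (sn_le_one_iff p h0).1 h
    have h2 : 0 ≤ wv p (x : E)⁻¹ := (sn_le_one_iff p (inv_ne_zero h0)).1 (by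
      rw [show spectralNorm ℚ_[p] E (x : E)⁻¹ = (spectralNorm ℚ_[p] E (x : E))⁻¹ from
        map_inv₀ (spectralMulAlgNorm ℚ_[p] E) (x : E), h1]; simp)
    rw [wv_inv] at h2
    omega

instance OO_local : IsLocalRing (OO p E) := by
  refine IsLocalRing.of_nonunits_add ?_
  intro a b ha hb
  rw [mem_nonunits_iff, OO_isUnit_iff_sn] at *
  have h1 := lt_of_le_of_ne ((isIntegral_iff_sn p (a : E)).1 a.2) ha
  have h2 := lt_of_le_of_ne ((isIntegral_iff_sn p (b : E)).1 b.2) hb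
  have := isNonarchimedean_spectralNorm (K := ℚ_[p]) (a : E) (b : E)
  exact (lt_of_le_of_lt this (max_lt h1 h2)).ne

instance OO_dedekind : IsDedekindDomain (OO p E) :=
  integralClosure.isDedekindDomain ℤ_[p] ℚ_[p] E

instance OO_finite : Module.Finite ℤ_[p] (OO p E) :=
  IsIntegralClosure.finite ℤ_[p] ℚ_[p] E (OO p E)

instance OO_frac : IsFractionRing (OO p E) E :=
  integralClosure.isFractionRing_of_finite_extension ℚ_[p] E

end basics
end Part1

section Part2
open Module
set_option linter.unusedSectionVars false
set_option linter.unusedVariables false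

lemma card_aux {A B : Type*} [CommRing A] [CommRing B] [Algebra A B] (m : Ideal A) [m.IsMaximal]
    (P : Ideal B) [P.LiesOver m] [Module.Finite A B] :
    Nat.card (B ⧸ P) = Nat.card (A ⧸ m) ^ finrank (A ⧸ m) (B ⧸ P) := by
  have h3 : Module.Finite (A ⧸ m) (B ⧸ P) := inferInstance
  letI : Field (A ⧸ m) := Ideal.Quotient.field m
  exact Module.natCard_eq_pow_finrank (K := A ⧸ m) (V := B ⧸ P)

section resid
variable (p : ℕ) [Fact p.Prime] {E F : Type*} [Field E] [Algebra ℚ_[p] E] [FiniteDimensional ℚ_[p] E]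
variable [Algebra ℤ_[p] E] [IsScalarTower ℤ_[p] ℚ_[p] E]

lemma OO_not_field : ¬ IsField (OO p E) := by
  intro h
  have h0 : ((p : OO p E) : E) ≠ 0 := by
    have : CharZero E := charZero_of_injective_algebraMap (algebraMap ℚ_[p] E).injective
    simpa using (Fact.out : p.Prime).ne_zero
  have h1 : (p : OO p E) ≠ 0 := fun h => h0 (by rw [h]; rfl)
  have h2 : IsUnit (p : OO p E) := by
    obtain ⟨b, hb⟩ := h.mul_inv_cancel h1
    exact IsUnit.of_mul_eq_one b hb
  have h3 := ((OO_isUnit_iff p _).1 h2).2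
  have h4 : wv p ((p : OO p E) : E) = finrank ℚ_[p] E := by simpa using wv_p p (E := E)
  have := finrank_pos (R := ℚ_[p]) (M := E)
  omega

instance OO_dvr : IsDiscreteValuationRing (OO p E) := by
  have := OO_not_field p (E := E)
  exact ((IsDiscreteValuationRing.TFAE (OO p E) this).out 0 2 rfl rfl).2 (OO_dedekind p)

lemma resCard_eq : resCard p E = Nat.card (IsLocalRing.ResidueField (OO p E)) := by
  rw [resCard, IsLocalRing.jacobson_eq_maximalIdeal _ bot_ne_top]; rfl

instance : (IsLocalRing.maximalIdeal (OO p E)).LiesOver (IsLocalRing.maximalIdeal ℤ_[p]) := by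
  constructor
  exact (IsLocalRing.eq_maximalIdeal (Ideal.isMaximal_comap_of_isIntegral_of_isMaximal _)).symm

lemma exists_fdeg : ∃ f : ℕ, 0 < f ∧ resCard p E = p ^ f ∧
    ∀ ϖ : OO p E, Irreducible ϖ → wv p (ϖ : E) = f := by
  set P := IsLocalRing.maximalIdeal (OO p E) with hP
  set m := IsLocalRing.maximalIdeal ℤ_[p] with hm
  have h := Ideal.relNorm_eq_pow_of_isMaximal P m
  refine ⟨P.inertiaDeg ℤ_[p], Ideal.inertiaDeg_pos P _, ?_, ?_⟩
  · rw [Ideal.inertiaDeg_eq_of_isMaximal m P, resCard_eq]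
    have hcard : Nat.card (ℤ_[p] ⧸ m) = p :=
      (Nat.card_congr (PadicInt.residueField (p := p)).toEquiv).trans (Nat.card_zmod p)
    have h1 : _root_.Finite (ℤ_[p] ⧸ m) := Nat.finite_of_card_ne_zero (by
      rw [hcard]; exact (Fact.out : p.Prime).ne_zero)
    exact (card_aux m P).trans (congrArg (· ^ _) hcard)
  · intro ϖ hϖ
    have h2 : P = Ideal.span {ϖ} := hϖ.maximalIdeal_eq
    have h3 : m = Ideal.span {(p : ℤ_[p])} := PadicInt.maximalIdeal_eq_span_p
    rw [h2, Ideal.relNorm_singleton, ← h2, h3, Ideal.span_singleton_pow,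
      Ideal.span_singleton_eq_span_singleton] at h
    obtain ⟨u, hu⟩ := h
    have h5 := Algebra.algebraMap_intNorm (A := ℤ_[p]) (K := ℚ_[p]) (L := E) (B := OO p E) ϖ
    have h6 := congrArg (algebraMap ℤ_[p] ℚ_[p]) hu
    rw [map_mul, h5] at h6
    have h7 : (Algebra.norm ℚ_[p] (ϖ : E)) ≠ 0 := by
      rw [Algebra.norm_ne_zero_iff]; exact fun h => hϖ.ne_zero (Subtype.ext h)
    have h8 := congrArg Padic.valuation h6
    have h9 : (algebraMap ℤ_[p] ℚ_[p] u) ≠ 0 := by simp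
    have h10 : Padic.valuation (algebraMap ℤ_[p] ℚ_[p] u) = 0 := by
      have : ‖(u : ℤ_[p])‖ = 1 := PadicInt.norm_units u
      have h11 : ‖algebraMap ℤ_[p] ℚ_[p] u‖ = 1 := this
      rw [Padic.norm_eq_zpow_neg_valuation h9] at h11
      have hp1 : (1:ℝ) < p := by exact_mod_cast (Fact.out : p.Prime).one_lt
      have := (zpow_eq_one_iff_right₀ (by linarith) hp1.ne').1 h11
      omega
    rw [show algebraMap (OO p E) E ϖ = (ϖ : E) from rfl, Padic.valuation_mul h7 h9, h10] at h8
    simp only [map_pow, map_natCast, Padic.valuation_pow, Padic.valuation_p] at h8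
    rw [wv]; simpa using h8

variable (E) in
/-- absolute residue degree -/
noncomputable def fdeg : ℕ := (exists_fdeg p (E := E)).choose

lemma fdeg_pos : 0 < fdeg p E := (exists_fdeg p (E := E)).choose_spec.1
lemma resCard_eq_pow : resCard p E = p ^ fdeg p E := (exists_fdeg p (E := E)).choose_spec.2.1
lemma wv_irred (ϖ : OO p E) (h : Irreducible ϖ) : wv p (ϖ : E) = fdeg p E :=
  (exists_fdeg p (E := E)).choose_spec.2.2 ϖ h

lemma fdeg_dvd {x : E} (hx : x ≠ 0) : (fdeg p E : ℤ) ∣ wv p x := by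
  obtain ⟨ϖ, hϖ⟩ := IsDiscreteValuationRing.exists_irreducible (OO p E)
  have key : ∀ y : OO p E, y ≠ 0 → (fdeg p E : ℤ) ∣ wv p (y : E) := by
    intro y hy
    obtain ⟨n, u, hu⟩ := IsDiscreteValuationRing.eq_unit_mul_pow_irreducible hy hϖ
    have h1 := (OO_isUnit_iff p (u : OO p E)).1 u.isUnit
    have h2 : (y : E) = (u : OO p E) * (ϖ : E) ^ n := by rw [hu]; rfl
    have h3 : (ϖ : E) ≠ 0 := fun h => hϖ.ne_zero (Subtype.ext h)
    rw [h2, wv_mul p h1.1 (pow_ne_zero _ h3), h1.2, wv_pow, wv_irred p ϖ hϖ]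
    simp
  obtain ⟨a, b, hb, rfl⟩ := IsFractionRing.div_surjective (A := OO p E) x
  have hb0 : b ≠ 0 := nonZeroDivisors.ne_zero hb
  have ha0 : a ≠ 0 := by rintro rfl; simp at hx
  have e1 : algebraMap (OO p E) E a = a := rfl
  have e2 : algebraMap (OO p E) E b = b := rfl
  have hb1 : (b : E) ≠ 0 := fun h => hb0 (Subtype.ext h)
  have ha1 : (a : E) ≠ 0 := fun h => ha0 (Subtype.ext h)
  rw [e1, e2, div_eq_mul_inv, wv_mul p ha1 (inv_ne_zero hb1), wv_inv]
  exact dvd_add (key a ha0) ((key b hb0).neg_right)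

lemma exists_unif : ∃ x : E, x ≠ 0 ∧ wv p x = fdeg p E := by
  obtain ⟨ϖ, hϖ⟩ := IsDiscreteValuationRing.exists_irreducible (OO p E)
  exact ⟨ϖ, fun h => hϖ.ne_zero (Subtype.ext h), wv_irred p ϖ hϖ⟩

lemma isUniformizer_iff (x : E) : IsUniformizer p E x ↔ x ≠ 0 ∧ wv p x = fdeg p E := by
  constructor
  · rintro ⟨h, hi⟩
    exact ⟨fun h => hi.ne_zero (Subtype.ext h), wv_irred p ⟨x, h⟩ hi⟩
  · rintro ⟨h0, h1⟩
    have hIntg : x ∈ integralClosure ℤ_[p] E := (isIntegral_iff_wv p h0).2 (by omega)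
    have hf := fdeg_pos p (E := E)
    refine ⟨hIntg, ?_, ?_⟩
    · intro hu
      have := ((OO_isUnit_iff p _).1 hu).2
      simp only at this
      omega
    · intro a b hab
      have hab' : x = (a : E) * b := congrArg Subtype.val hab
      have ha : (a : E) ≠ 0 := by rintro h; simp [h] at hab'; exact h0 hab'
      have hb : (b : E) ≠ 0 := by rintro h; simp [h] at hab'; exact h0 hab'
      rw [hab', wv_mul p ha hb] at h1
      have ha1 := (isIntegral_iff_wv p ha).1 a.2
      have hb1 := (isIntegral_iff_wv p hb).1 b.2
      obtain ⟨c, hc⟩ := fdeg_dvd p ha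
      obtain ⟨d, hd⟩ := fdeg_dvd p hb
      rw [OO_isUnit_iff, OO_isUnit_iff]
      rw [hc, hd] at h1
      have hf' : (0:ℤ) < fdeg p E := by exact_mod_cast hf
      have h2 : c + d = 1 := by
        have : (fdeg p E : ℤ) * (c + d) = fdeg p E * 1 := by linarith
        exact mul_left_cancel₀ hf'.ne' this
      have hc0 : 0 ≤ c := by
        by_contra hcon
        rw [hc] at ha1; nlinarith
      have hd0 : 0 ≤ d := by
        by_contra hcon
        rw [hd] at hb1; nlinarith
      have : c = 0 ∨ d = 0 := by omega
      rcases this with h | h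
      · left; exact ⟨ha, by rw [hc, h]; simp⟩
      · right; exact ⟨hb, by rw [hd, h]; simp⟩

variable [Field F] [Algebra ℚ_[p] F] [FiniteDimensional ℚ_[p] F]
variable [Algebra ℤ_[p] F] [IsScalarTower ℤ_[p] ℚ_[p] F] [Algebra E F] [IsScalarTower ℚ_[p] E F]

variable (E F) in
lemma fdeg_dvd_fdeg : fdeg p E ∣ fdeg p F := by
  have : FiniteDimensional E F := FiniteDimensional.right ℚ_[p] E F
  obtain ⟨x, hx, h⟩ := exists_unif p (E := F)
  have := fdeg_dvd p (E := E) (Algebra.norm_ne_zero_iff.2 hx)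
  rw [wv_norm, h] at this
  exact_mod_cast this

variable (E F) in
lemma fdeg_dvd_mul : fdeg p F ∣ finrank E F * fdeg p E := by
  obtain ⟨x, hx, h⟩ := exists_unif p (E := E)
  have := fdeg_dvd p (E := F) (x := algebraMap E F x) (by simpa using hx)
  rw [wv_algebraMap, h] at this
  exact_mod_cast this

lemma resCard_pow_iff (n : ℕ) : resCard p F = resCard p E ^ n ↔ fdeg p F = fdeg p E * n := by
  rw [resCard_eq_pow, resCard_eq_pow, ← pow_mul]
  exact Nat.pow_right_inj (Fact.out : p.Prime).two_le

end resid
end Part2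

section Part3
open Module
set_option linter.unusedSectionVars false
set_option linter.unusedVariables false

section topo
variable (p : ℕ) [Fact p.Prime] {k L : Type*} [NormedField L] [NormedAlgebra ℚ_[p] L]
  [FiniteDimensional ℚ_[p] L] [Field k] [Algebra ℚ_[p] k] [Algebra k L] [IsScalarTower ℚ_[p] k L]
  [FiniteDimensional k L] [IsGalois k L]

lemma norm_p_lt : ‖(p : L)‖ < 1 := by
  have : (p : L) = algebraMap ℚ_[p] L p := by simp
  rw [this, norm_algebraMap', Padic.norm_p]
  exact inv_lt_one_of_one_lt₀ (by exact_mod_cast (Fact.out : p.Prime).one_lt)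

lemma tp_ne : (p : L) ≠ 0 := by
  have : (p : L) = algebraMap ℚ_[p] L p := by simp
  rw [this]; exact (map_ne_zero _).2 (by exact_mod_cast (Fact.out : p.Prime).ne_zero)

lemma tp_closed (A : AddSubgroup L) (hop : ∃ c : ℕ, ∀ x : L, ‖x‖ ≤ 1 → (p : L) ^ c * x ∈ A) :
    IsClosed (A : Set L) := by
  refine AddSubgroup.isClosed_of_isOpen A (AddSubgroup.isOpen_of_mem_nhds A (g := 0) ?_)
  obtain ⟨c, hc⟩ := hop
  have h0 := tp_ne p (L := L)
  rw [Metric.mem_nhds_iff]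
  refine ⟨‖(p : L) ^ c‖, norm_pos_iff.2 (pow_ne_zero c h0), fun x hx => ?_⟩
  have h1 : (p : L) ^ c * (((p : L) ^ c)⁻¹ * x) = x := by field_simp
  rw [← h1]
  refine hc _ ?_
  rw [norm_mul, norm_inv, inv_mul_le_iff₀ (norm_pos_iff.2 (pow_ne_zero c h0)), mul_one]
  exact (mem_ball_zero_iff.1 hx).le

lemma tp_inv (A : AddSubgroup L) (hop : ∃ c : ℕ, ∀ x : L, ‖x‖ ≤ 1 → (p : L) ^ c * x ∈ A)
    (hA2 : ∀ a ∈ A, ∀ b ∈ A, ∃ c ∈ A, a * b = p * c) (hbd : ∀ a ∈ A, ‖a‖ ≤ 1)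
    (hpA : ∀ a ∈ A, (p : L) * a ∈ A) (a : L) (ha : a ∈ A) :
    (1 + a) ≠ 0 ∧ (1 + a)⁻¹ - 1 ∈ A := by
  have hlt : ‖a‖ < 1 := by
    obtain ⟨c, hc, h⟩ := hA2 a ha a ha
    have h1 : ‖a‖ * ‖a‖ < 1 := by
      rw [← norm_mul, h, norm_mul]
      have := norm_p_lt p (L := L)
      have := hbd c hc
      have := norm_nonneg c
      have := norm_nonneg (p : L)
      nlinarith
    by_contra hcon
    nlinarith
  have hne : (1 + a) ≠ 0 := by
    intro h
    have : a = -1 := by linear_combination h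
    rw [this] at hlt; simp at hlt
  refine ⟨hne, ?_⟩
  have h := hasSum_geometric_of_norm_lt_one (ξ := -a) (by simpa using hlt)
  have h2 := h.tendsto_sum_nat
  have h3 := (Filter.tendsto_add_atTop_iff_nat 1).2 h2
  have h4 := h3.sub_const 1
  rw [sub_neg_eq_add] at h4
  refine (tp_closed p A hop).mem_of_tendsto h4 (Filter.Eventually.of_forall fun n => ?_)
  have hpow : ∀ i : ℕ, (-a) ^ (i + 1) ∈ A := by
    intro i
    induction i with
    | zero => simpa using ha
    | succ i ih =>
      obtain ⟨c, hc, h⟩ := hA2 _ ih _ (A.neg_mem ha)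
      rw [pow_succ, h]; exact hpA c hc
  rw [Finset.sum_range_succ']
  simp only [pow_zero, add_sub_cancel_right]
  exact AddSubgroup.sum_mem _ fun i _ => hpow i

lemma tp_prod {ι : Type*} (A : AddSubgroup L)
    (hA2 : ∀ a ∈ A, ∀ b ∈ A, ∃ c ∈ A, a * b = p * c)
    (hpA : ∀ a ∈ A, (p : L) * a ∈ A) (i : ℕ) (s : Finset ι) (x : ι → L) (hx : ∀ t, x t ∈ A) :
    ∃ c ∈ A, ∏ t ∈ s, (1 + (p : L) ^ i * x t) = 1 + (p : L) ^ i * ∑ t ∈ s, x t + p ^ (i+1) * c := by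
  classical
  have hpi : ∀ i : ℕ, ∀ a ∈ A, (p : L) ^ i * a ∈ A := by
    intro i a ha
    induction i with
    | zero => simpa using ha
    | succ i ih => rw [pow_succ', mul_assoc]; exact hpA _ ih
  induction s using Finset.induction_on with
  | empty => exact ⟨0, A.zero_mem, by simp⟩
  | insert t s ht ih =>
    obtain ⟨c, hc, h⟩ := ih
    rw [Finset.prod_insert ht, h, Finset.sum_insert ht]
    obtain ⟨d, hd, h1⟩ := hA2 _ (hx t) _ (AddSubgroup.sum_mem A (t := s) fun t _ => hx t)
    obtain ⟨e, he, h2⟩ := hA2 _ (hx t) _ hc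
    refine ⟨c + p ^ i * d + p ^ i * (p * e), A.add_mem (A.add_mem hc (hpi _ _ hd)) (hpi _ _ (hpA _ he)), ?_⟩
    linear_combination (p : L) ^ (2 * i) * h1 + (p : L) ^ (2 * i + 1) * h2

lemma tp_norm (A : AddSubgroup L) (hop : ∃ c : ℕ, ∀ x : L, ‖x‖ ≤ 1 → (p : L) ^ c * x ∈ A)
    (hA2 : ∀ a ∈ A, ∀ b ∈ A, ∃ c ∈ A, a * b = p * c) (hbd : ∀ a ∈ A, ‖a‖ ≤ 1)
    (hpA : ∀ a ∈ A, (p : L) * a ∈ A)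
    (hst : ∀ τ : L ≃ₐ[k] L, ∀ a ∈ A, τ a ∈ A)
    (htr : ∀ a ∈ A, (∀ τ : L ≃ₐ[k] L, τ a = a) → ∃ b ∈ A, a = ∑ τ : L ≃ₐ[k] L, τ b)
    (a : L) (ha : a ∈ A) (hfix : ∀ τ : L ≃ₐ[k] L, τ a = a) :
    ∃ b ∈ A, 1 + a = ∏ τ : L ≃ₐ[k] L, τ (1 + b) := by
  have hp0 := tp_ne p (L := L)
  have hinv := tp_inv p A hop hA2 hbd hpA
  have hcl := tp_closed p A hop
  have hpr : ProperSpace L := FiniteDimensional.proper ℚ_[p] L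
  have hmulA : ∀ a ∈ A, ∀ b ∈ A, a * b ∈ A := by
    intro a ha b hb
    obtain ⟨c, hc, h⟩ := hA2 a ha b hb
    rw [h]; exact hpA c hc
  have hprodV : ∀ b ∈ A, ∃ c ∈ A, ∏ τ : L ≃ₐ[k] L, τ (1 + b) = 1 + c := by
    intro b hb
    obtain ⟨c, hc, h⟩ := tp_prod p A hA2 hpA 0 Finset.univ (fun τ : L ≃ₐ[k] L => τ b)
      (fun τ => hst τ b hb)
    refine ⟨∑ τ : L ≃ₐ[k] L, τ b + p * c, A.add_mem (AddSubgroup.sum_mem _ fun τ _ => hst τ b hb)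
      (hpA c hc), ?_⟩
    simp only [pow_zero, one_mul, zero_add, pow_one] at h
    simp only [map_add, map_one]
    rw [h]; ring
  -- successive approximation
  have key : ∀ i : ℕ, ∃ b ∈ A, ∃ c ∈ A, (∀ τ : L ≃ₐ[k] L, τ c = c) ∧
      1 + a = (∏ τ : L ≃ₐ[k] L, τ (1 + b)) * (1 + p ^ i * c) := by
    intro i
    induction i with
    | zero => exact ⟨0, A.zero_mem, a, ha, hfix, by simp⟩
    | succ i ih =>
      obtain ⟨b, hb, c, hc, hcf, h⟩ := ih
      obtain ⟨d, hd, hcd⟩ := htr c hc hcf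
      have hpi : ∀ i : ℕ, ∀ a ∈ A, (p : L) ^ i * a ∈ A := by
        intro i a ha
        induction i with
        | zero => simpa using ha
        | succ i ih => rw [pow_succ', mul_assoc]; exact hpA _ ih
      have hpd := hpi i d hd
      obtain ⟨e, he, h1⟩ := tp_prod p A hA2 hpA i Finset.univ (fun τ : L ≃ₐ[k] L => τ d)
        (fun τ => hst τ d hd)
      have h2 : ∏ τ : L ≃ₐ[k] L, τ (1 + p ^ i * d) = 1 + p ^ i * c + p ^ (i+1) * e := by
        rw [hcd, ← h1]; simp
      obtain ⟨n, hn, h3⟩ := hprodV _ hpd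
      obtain ⟨hn0, hn1⟩ := hinv n hn
      set M := (1 + n)⁻¹ - 1 with hM
      have hM2 : (1 + n) * (1 + M) = 1 := by rw [hM]; field_simp; ring
      have hMM : (1 + n)⁻¹ = 1 + M := by rw [hM]; ring
      refine ⟨b + p ^ i * d + b * (p ^ i * d), A.add_mem (A.add_mem hb hpd) (hmulA _ hb _ hpd),
        -(e * (1 + n)⁻¹), ?_, ?_, ?_⟩
      · rw [hMM, mul_add, mul_one]
        exact A.neg_mem (A.add_mem he (hmulA _ he _ hn1))
      · have hfn : ∀ τ : L ≃ₐ[k] L, τ (1 + n) = 1 + n := by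
          intro τ
          rw [← h3, ← Algebra.norm_eq_prod_automorphisms, AlgEquiv.commutes]
        have hfe : ∀ τ : L ≃ₐ[k] L, τ e = e := by
          intro τ
          have h5 : (p : L) ^ (i+1) * e = (1 + n) - 1 - p ^ i * c := by
            rw [← h3, h2]; ring
          have h6 := congrArg τ h5
          rw [map_sub, map_sub, hfn, map_mul, map_mul, map_pow, map_pow, map_natCast, hcf, map_one,
            ← h5] at h6
          exact mul_left_cancel₀ (pow_ne_zero _ hp0) h6
        intro τ
        rw [map_neg, map_mul, map_inv₀, hfn, hfe]
      · have h7 : ∀ τ : L ≃ₐ[k] L, τ (1 + (b + p ^ i * d + b * (p ^ i * d))) =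
            τ (1 + b) * τ (1 + p ^ i * d) := by
          intro τ; rw [← map_mul]; congr 1; ring
        rw [Finset.prod_congr rfl fun τ _ => h7 τ, Finset.prod_mul_distrib, h3, h, mul_assoc]
        congr 1
        rw [hMM]
        rw [h3] at h2
        linear_combination - h2 + (p : L) ^ (i+1) * e * hM2
  -- compactness
  have hcomp : IsCompact (A : Set L) :=
    Metric.isCompact_of_isClosed_isBounded hcl
      ((Metric.isBounded_closedBall (x := (0 : L)) (r := 1)).subset fun a ha => by
        simpa using hbd a ha)
  have hcont : Continuous (fun b : L => ∏ τ : L ≃ₐ[k] L, τ (1 + b)) := by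
    refine continuous_finsetProd _ fun τ _ => ?_
    have : Continuous τ :=
      LinearMap.continuous_of_finiteDimensional (τ.restrictScalars ℚ_[p]).toLinearMap
    exact this.comp (continuous_const.add continuous_id)
  have him := (hcomp.image hcont).isClosed
  choose b hb c hc hcf h using key
  have hlim : Filter.Tendsto (fun i => ∏ τ : L ≃ₐ[k] L, τ (1 + b i)) Filter.atTop (nhds (1 + a)) := by
    rw [tendsto_iff_norm_sub_tendsto_zero]
    have hle : ∀ i, ‖∏ τ : L ≃ₐ[k] L, τ (1 + b i) - (1 + a)‖ ≤ 2 * ‖(p : L)‖ ^ i := by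
      intro i
      obtain ⟨n, hn, h3⟩ := hprodV _ (hb i)
      rw [h i, h3]
      have : (1 + n) - (1 + n) * (1 + p ^ i * c i) = - ((1 + n) * (p ^ i * c i)) := by ring
      rw [this, norm_neg, norm_mul, norm_mul, norm_pow]
      have h1 : ‖1 + n‖ ≤ 2 := (norm_add_le _ _).trans (by
        have := hbd n hn
        rw [norm_one]; linarith)
      have h2 := hbd _ (hc i)
      gcongr
      exact mul_le_of_le_one_right (by positivity) h2
    refine squeeze_zero (fun _ => norm_nonneg _) hle ?_
    have := (tendsto_pow_atTop_nhds_zero_of_lt_one (norm_nonneg _) (norm_p_lt p (L := L))).const_mul 2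
    simpa using this
  have := him.mem_of_tendsto hlim (Filter.Eventually.of_forall fun i => ⟨b i, hb i, rfl⟩)
  obtain ⟨b, hb, h⟩ := this
  exact ⟨b, hb, h.symm⟩
end topo
end Part3

section Part4
open Module
set_option linter.unusedSectionVars false
set_option linter.unusedVariables false

section lat
variable (p : ℕ) [Fact p.Prime] {k L : Type*} [Field L] [Algebra ℚ_[p] L]
  [FiniteDimensional ℚ_[p] L] [Field k] [Algebra ℚ_[p] k] [Algebra k L] [IsScalarTower ℚ_[p] k L]
  [FiniteDimensional ℚ_[p] k]
  [Algebra ℤ_[p] k] [IsScalarTower ℤ_[p] ℚ_[p] k]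
  [Algebra ℤ_[p] L] [IsScalarTower ℤ_[p] ℚ_[p] L]

lemma fp_ne : (p : k) ≠ 0 := by
  have : (p : k) = algebraMap ℚ_[p] k p := by simp
  rw [this]; exact (map_ne_zero _).2 (by exact_mod_cast (Fact.out : p.Prime).ne_zero)

lemma int_natp : IsIntegral ℤ_[p] (p : k) := by
  have := isIntegral_algebraMap (R := ℤ_[p]) (A := k) (x := (p : ℤ_[p]))
  simpa using this

lemma scal1 (c : k) : ∃ M : ℕ, ∀ m ≥ M, IsIntegral ℤ_[p] ((p : k) ^ m * c) := by
  by_cases hc : c = 0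
  · exact ⟨0, fun m _ => by rw [hc, mul_zero]; exact isIntegral_zero⟩
  refine ⟨(wv p c).natAbs, fun m hm => ?_⟩
  have hp := fp_ne p (k := k)
  rw [isIntegral_iff_wv p (mul_ne_zero (pow_ne_zero _ hp) hc), wv_mul p (pow_ne_zero _ hp) hc, wv_pow, wv_p]
  have : (1:ℤ) ≤ finrank ℚ_[p] k := by exact_mod_cast finrank_pos (R := ℚ_[p]) (M := k)
  have h2 : ((wv p c).natAbs : ℤ) ≤ m := by exact_mod_cast hm
  have h3 : -wv p c ≤ (wv p c).natAbs := by omega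
  nlinarith

lemma scal {ι : Type*} [_root_.Finite ι] (c : ι → k) :
    ∃ M : ℕ, ∀ m ≥ M, ∀ i, IsIntegral ℤ_[p] ((p : k) ^ m * c i) := by
  choose M hM using fun i => scal1 p (c i)
  obtain ⟨B, hB⟩ := (Set.finite_range M).bddAbove
  exact ⟨B, fun m hm i => hM i m ((hB ⟨i, rfl⟩).trans hm)⟩

lemma tower_zp : IsScalarTower ℤ_[p] k L := by
  refine IsScalarTower.of_algebraMap_eq fun x => ?_
  rw [IsScalarTower.algebraMap_apply ℤ_[p] ℚ_[p] L, IsScalarTower.algebraMap_apply ℤ_[p] ℚ_[p] k,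
    ← IsScalarTower.algebraMap_apply ℚ_[p] k L]

variable [FiniteDimensional k L] [IsGalois k L]
lemma repr_gal (σ τ : L ≃ₐ[k] L) (x : L) :
    (IsGalois.normalBasis k L).repr (σ x) τ = (IsGalois.normalBasis k L).repr x (σ⁻¹ * τ) := by
  set b := IsGalois.normalBasis k L with hb
  have : (b.coord τ) ∘ₗ σ.toLinearMap = b.coord (σ⁻¹ * τ) := by
    refine b.ext fun ρ => ?_
    have h1 : σ (b ρ) = b (σ * ρ) := by
      rw [hb, IsGalois.normalBasis_apply ρ, IsGalois.normalBasis_apply (σ * ρ)]; rfl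
    simp only [LinearMap.comp_apply, AlgEquiv.toLinearMap_apply, h1, Basis.coord_apply,
      Basis.repr_self]
    classical
    rw [Finsupp.single_apply, Finsupp.single_apply]
    congr 1
    rw [eq_inv_mul_iff_mul_eq]
  exact LinearMap.congr_fun this x

set_option maxHeartbeats 1000000 in
variable (k L) in
lemma exists_lattice : ∃ A : AddSubgroup L,
    (∃ c : ℕ, ∀ x : L, IsIntegral ℤ_[p] x → (p : L) ^ c * x ∈ A) ∧
    (∀ a ∈ A, ∀ b ∈ A, ∃ c ∈ A, a * b = p * c) ∧ (∀ a ∈ A, IsIntegral ℤ_[p] a) ∧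
    (∀ a ∈ A, (p : L) * a ∈ A) ∧
    (∀ τ : L ≃ₐ[k] L, ∀ a ∈ A, τ a ∈ A) ∧
    (∀ a ∈ A, (∀ τ : L ≃ₐ[k] L, τ a = a) → ∃ b ∈ A, a = ∑ τ : L ≃ₐ[k] L, τ b) := by
  have := tower_zp p (k := k) (L := L)
  set b := IsGalois.normalBasis k L with hb
  have hp := fp_ne p (k := k)
  obtain ⟨N, hN⟩ := scal p (fun t : (L ≃ₐ[k] L) × (L ≃ₐ[k] L) × (L ≃ₐ[k] L) =>
    b.repr (b t.1 * b t.2.1) t.2.2)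
  obtain ⟨M, hM⟩ := scal p (fun t : L ≃ₐ[k] L => b t)
  set m := N + 1 + M with hm
  let A : AddSubgroup L :=
    { carrier := {x | ∀ τ, IsIntegral ℤ_[p] (((p : k) ^ m)⁻¹ * b.repr x τ)}
      zero_mem' := fun τ => by simpa using isIntegral_zero
      add_mem' := fun {x y} hx hy τ => by
        have := (hx τ).add (hy τ)
        rw [← mul_add] at this
        simpa using this
      neg_mem' := fun {x} hx τ => by
        have := (hx τ).neg
        simpa using this }
  have memA : ∀ x, x ∈ A ↔ ∀ τ, IsIntegral ℤ_[p] (((p : k) ^ m)⁻¹ * b.repr x τ) := fun x => Iff.rfl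
  have hsm : ∀ (c : k) (hc : IsIntegral ℤ_[p] c), ∀ a ∈ A, c • a ∈ A := by
    intro c hc a ha
    rw [memA] at *
    intro τ
    have := hc.mul (ha τ)
    rw [map_smul, Finsupp.smul_apply, smul_eq_mul, mul_left_comm]
    exact this
  have hpsm : ∀ (i : ℕ) (x : L), (p : L) ^ i * x = ((p : k) ^ i) • x := by
    intro i x; rw [Algebra.smul_def]; simp
  have hpsm1 : ∀ (x : L), (p : L) * x = (p : k) • x := by
    intro x; rw [Algebra.smul_def]; simp
  refine ⟨A, ?_, ?_, ?_, ?_, ?_, ?_⟩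
  · obtain ⟨S, hS⟩ := (OO_finite p (E := L)).fg_top
    obtain ⟨c, hc⟩ := scal p (fun t : S × (L ≃ₐ[k] L) => ((p : k) ^ m)⁻¹ * b.repr ((t.1 : OO p L) : L) t.2)
    refine ⟨c, fun x hx => ?_⟩
    have h1 : (⟨x, hx⟩ : OO p L) ∈ Submodule.span ℤ_[p] (S : Set (OO p L)) := by rw [hS]; trivial
    have : ∀ y : OO p L, y ∈ Submodule.span ℤ_[p] (S : Set (OO p L)) → (p : L) ^ c * (y : L) ∈ A := by
      intro y hy
      induction hy using Submodule.span_induction with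
      | mem y hy =>
        rw [memA]; intro τ
        have := hc c le_rfl (⟨y, hy⟩, τ)
        rw [hpsm, map_smul, Finsupp.smul_apply, smul_eq_mul, mul_left_comm]
        exact this
      | zero => simpa using A.zero_mem
      | add y z _ _ h1 h2 =>
        have := A.add_mem h1 h2
        rw [← mul_add] at this; exact this
      | smul r y _ h =>
        have := hsm (algebraMap ℤ_[p] k r) isIntegral_algebraMap _ h
        have e1 : ((r • y : OO p L) : L) = algebraMap k L (algebraMap ℤ_[p] k r) * (y : L) := by
          rw [← IsScalarTower.algebraMap_apply ℤ_[p] k L, ← Algebra.smul_def]; rfl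
        rw [Algebra.smul_def] at this
        rw [e1, mul_left_comm]
        exact this
    exact this _ h1
  · intro x hx y hy
    have hpL := fp_ne p (k := L)
    refine ⟨(p : k)⁻¹ • (x * y), ?_, ?_⟩
    · rw [memA] at *
      intro τ
      have e : (p : k)⁻¹ • (x * y) = ∑ i, ∑ j, ((p : k)⁻¹ * (b.repr x i * b.repr y j)) • (b i * b j) := by
        conv_lhs => rw [← b.sum_repr x, ← b.sum_repr y]
        rw [Finset.sum_mul_sum, Finset.smul_sum]
        refine Finset.sum_congr rfl fun i _ => ?_
        rw [Finset.smul_sum]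
        refine Finset.sum_congr rfl fun j _ => ?_
        rw [smul_mul_smul_comm, smul_smul]
      rw [e]
      simp only [map_sum, map_smul, Finsupp.coe_finsetSum, Finset.sum_apply, Finsupp.smul_apply, smul_eq_mul, Finset.mul_sum]
      refine IsIntegral.sum _ fun i _ => IsIntegral.sum _ fun j _ => ?_
      have h1 := hN (N + M) (by omega) (i, j, τ)
      have := ((hx i).mul (hy j)).mul h1
      convert this using 1
      rw [hm]
      field_simp
      ring
    · rw [hpsm1, smul_smul, mul_inv_cancel₀ hp, one_smul]
  · intro x hx
    rw [memA] at hx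
    rw [← b.sum_repr x]
    refine IsIntegral.sum _ fun i _ => ?_
    have := (IsIntegral.algebraMap (B := L) (hx i)).mul (hM m (by omega) i)
    convert this using 1
    rw [Algebra.smul_def, map_mul, map_inv₀, map_pow, map_natCast]
    have hpL := fp_ne p (k := L)
    field_simp
  · intro a ha
    rw [hpsm1]
    exact hsm _ (int_natp p) a ha
  · intro σ a ha
    rw [memA] at *
    intro τ
    rw [repr_gal]; exact ha _
  · intro a ha hfix
    have h1 : ∀ τ, b.repr a τ = b.repr a 1 := by
      intro τ
      have := repr_gal τ τ a
      rw [hfix, inv_mul_cancel] at this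
      exact this
    refine ⟨b.repr a 1 • b 1, ?_, ?_⟩
    · rw [memA] at *
      intro τ
      classical
      rw [map_smul, Finsupp.smul_apply, b.repr_self, Finsupp.single_apply, smul_eq_mul]
      split_ifs with h
      · rw [mul_one]; exact ha 1
      · simpa using isIntegral_zero
    · conv_lhs => rw [← b.sum_repr a]
      refine Finset.sum_congr rfl fun τ _ => ?_
      rw [h1, map_smul, hb, IsGalois.normalBasis_apply τ]
end lat
end Part4

section Part5
open Module
set_option linter.unusedSectionVars false
set_option linter.unusedVariables false

section herb
variable {G : Type*} [CommGroup G]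

lemma index_split (f : G →* G) (B : Subgroup G) :
    B.index = (B.map f).relIndex f.range * (B ⊓ f.ker).relIndex f.ker := by
  rw [Subgroup.inf_relIndex_right, MonoidHom.range_eq_map, Subgroup.relIndex_map_map, top_sup_eq,
    Subgroup.relIndex_top_right, ← Subgroup.relIndex_sup_left f.ker B, mul_comm,
    Subgroup.relIndex_mul_index le_sup_left]

lemma herb (f g : G →* G) (B : Subgroup G) (hB : B.index ≠ 0) (hfB : B.map f ≤ B)
    (hgB : B.map g ≤ B) (hfg : f.range = g.ker) (hgf : g.range ≤ f.ker)
    (h0 : (B.map g).relIndex (B ⊓ f.ker) ≠ 0) :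
    g.range.relIndex f.ker ≠ 0 ∧ g.range.relIndex f.ker ≤ (B.map g).relIndex (B ⊓ f.ker) := by
  have h1 := index_split f B
  have h2 := index_split g B
  have hgle : B.map g ≤ g.range := by
    rw [MonoidHom.range_eq_map]; exact Subgroup.map_mono le_top
  have hfle : B.map f ≤ f.range := by
    rw [MonoidHom.range_eq_map]; exact Subgroup.map_mono le_top
  have h3 := Subgroup.relIndex_mul_relIndex _ _ _ hgle hgf
  have h4 := Subgroup.relIndex_mul_relIndex (B.map g) (B ⊓ f.ker) f.ker
    (le_inf hgB (hgle.trans hgf)) inf_le_right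
  have h5 := Subgroup.relIndex_mul_relIndex (B.map f) (B ⊓ g.ker) g.ker
    (le_inf hfB (hfg ▸ hfle)) inf_le_right
  rw [← hfg] at h5 h2
  set a := g.range.relIndex f.ker
  set b := (B.map g).relIndex g.range
  set c := (B.map g).relIndex (B ⊓ f.ker)
  set d := (B ⊓ f.ker).relIndex f.ker
  set e := (B.map f).relIndex (B ⊓ f.range)
  set i := (B ⊓ f.range).relIndex f.range
  set j := (B.map f).relIndex f.range
  have hj : j ≠ 0 := fun h => hB (by rw [h1, h, zero_mul])
  have hd : d ≠ 0 := fun h => hB (by rw [h1, h, mul_zero])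
  have hb : b ≠ 0 := fun h => hB (by rw [h2, h, zero_mul])
  have hi : i ≠ 0 := fun h => hB (by rw [h2, h, mul_zero])
  have he : e ≠ 0 := fun h => hj (by rw [← h5, h, zero_mul])
  have key : a * e = c := by
    have h6 : b * a * (e * i) = c * (b * i) := by
      rw [h3, ← h4, h5, ← h2, h1]; ring
    have : (a * e) * (b * i) = c * (b * i) := by rw [← h6]; ring
    exact Nat.eq_of_mul_eq_mul_right (Nat.pos_of_ne_zero (mul_ne_zero hb hi)) this
  refine ⟨fun h => h0 (by rw [← key, h, zero_mul]), ?_⟩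
  rw [← key]; exact Nat.le_mul_of_pos_right _ (Nat.pos_of_ne_zero he)

lemma relIndex_cyc (H K : Subgroup G) (c : G) (n : ℕ) (hn : 0 < n)
    (hcn : c ^ n ∈ H) (h : ∀ b ∈ K, ∃ i : ℤ, ∃ a ∈ H, b = c ^ i * a) :
    H.relIndex K ≠ 0 ∧ H.relIndex K ≤ n := by
  have hr : ∀ b ∈ K, ∃ i : Fin n, c ^ (-(i : ℤ)) * b ∈ H := by
    intro b hb
    obtain ⟨i, a, ha, rfl⟩ := h b hb
    have hn' : (0:ℤ) < n := by exact_mod_cast hn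
    have h1 := Int.emod_nonneg i hn'.ne'
    have h2 := Int.emod_lt_of_pos i hn'
    refine ⟨⟨(i % n).toNat, by omega⟩, ?_⟩
    have e : -(((i % n).toNat : ℕ) : ℤ) = -i + n * (i / n) := by
      rw [Int.toNat_of_nonneg h1]
      have := Int.emod_add_mul_ediv i n
      linarith
    simp only
    rw [e, zpow_add, zpow_mul, zpow_neg, zpow_natCast]
    have e2 : (c ^ i)⁻¹ * (c ^ n) ^ (i / (n:ℤ)) * (c ^ i * a) = (c ^ n) ^ (i / (n:ℤ)) * a := by
      rw [mul_comm ((c ^ i)⁻¹), mul_assoc]; simp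
    rw [e2]
    exact H.mul_mem (H.zpow_mem hcn _) ha
  choose r hr using hr
  let φ : K ⧸ H.subgroupOf K → Fin n := fun q => r (Quotient.out q).1 (Quotient.out q).2
  have hφ : Function.Injective φ := by
    intro x y hxy
    rw [← Quotient.out_eq x, ← Quotient.out_eq y]
    refine QuotientGroup.eq.2 ?_
    rw [Subgroup.mem_subgroupOf]
    have h1 := hr _ (Quotient.out x).2
    have h2 := hr _ (Quotient.out y).2
    have h3 : r (Quotient.out x).1 (Quotient.out x).2 = r (Quotient.out y).1 (Quotient.out y).2 := hxy
    rw [h3] at h1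
    have := H.mul_mem (H.inv_mem h1) h2
    convert this using 1
    push_cast
    group
  have hfin : _root_.Finite (K ⧸ H.subgroupOf K) := Finite.of_injective φ hφ
  constructor
  · exact Nat.card_pos.ne'
  · have := Nat.card_le_card_of_injective φ hφ
    rwa [Nat.card_fin] at this

lemma index_of_fun {T : Type*} [_root_.Finite T] (B : Subgroup G) (r : G → T)
    (h : ∀ x y, r x = r y → x⁻¹ * y ∈ B) : B.index ≠ 0 := by
  have : _root_.Finite (G ⧸ B) := by
    refine Finite.of_injective (fun q : G ⧸ B => r q.out) fun x y hxy => ?_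
    rw [← Quotient.out_eq x, ← Quotient.out_eq y]
    exact QuotientGroup.eq.2 (h _ _ hxy)
  exact Nat.card_pos.ne'
end herb

section ni
variable (p : ℕ) [Fact p.Prime] {k L : Type*} [Field L] [Algebra ℚ_[p] L]
  [FiniteDimensional ℚ_[p] L] [Field k] [Algebra ℚ_[p] k] [Algebra k L] [IsScalarTower ℚ_[p] k L]
  [FiniteDimensional ℚ_[p] k]
  [Algebra ℤ_[p] k] [IsScalarTower ℤ_[p] ℚ_[p] k]
  [Algebra ℤ_[p] L] [IsScalarTower ℤ_[p] ℚ_[p] L]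
  [FiniteDimensional k L] [IsGalois k L]

lemma finite_quot (c : ℕ) : _root_.Finite (OO p L ⧸ Ideal.span {(p : OO p L) ^ c}) := by
  have h0 : (p : OO p L) ^ c ≠ 0 := by
    refine pow_ne_zero _ fun h => fp_ne p (k := L) ?_
    have := congrArg (Subtype.val) h
    simpa using this
  obtain ⟨ϖ, hϖ⟩ := IsDiscreteValuationRing.exists_irreducible (OO p L)
  obtain ⟨n, hn⟩ := IsDiscreteValuationRing.ideal_eq_span_pow_irreducible
    (s := Ideal.span {(p : OO p L) ^ c}) (by simpa using h0) hϖ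
  rw [hn, ← Ideal.span_singleton_pow, ← hϖ.maximalIdeal_eq]
  have : _root_.Finite (OO p L ⧸ IsLocalRing.maximalIdeal (OO p L)) := by
    have h := resCard_eq_pow p (E := L)
    rw [resCard_eq] at h
    exact Nat.finite_of_card_ne_zero (h.trans_ne (pow_ne_zero _ (Fact.out : p.Prime).ne_zero))
  exact Ideal.finite_quotient_pow (IsNoetherian.noetherian _) n

/-- Norm-on-units transferred to the algebraic setting. -/
lemma units_lattice (A : AddSubgroup L) 
    (hop : ∃ c : ℕ, ∀ x : L, IsIntegral ℤ_[p] x → (p : L) ^ c * x ∈ A)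
    (hA2 : ∀ a ∈ A, ∀ b ∈ A, ∃ c ∈ A, a * b = p * c) (hbd : ∀ a ∈ A, IsIntegral ℤ_[p] a)
    (hpA : ∀ a ∈ A, (p : L) * a ∈ A)
    (hst : ∀ τ : L ≃ₐ[k] L, ∀ a ∈ A, τ a ∈ A)
    (htr : ∀ a ∈ A, (∀ τ : L ≃ₐ[k] L, τ a = a) → ∃ b ∈ A, a = ∑ τ : L ≃ₐ[k] L, τ b) :
    (∀ a ∈ A, (1 + a) ≠ 0 ∧ (1 + a)⁻¹ - 1 ∈ A) ∧
    (∀ a ∈ A, (∀ τ : L ≃ₐ[k] L, τ a = a) → ∃ b ∈ A, 1 + a = ∏ τ : L ≃ₐ[k] L, τ (1 + b)) := by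
  simp only [isIntegral_iff_sn] at hop hbd
  let i1 := spectralNorm.normedField ℚ_[p] L
  let i2 := spectralNorm.normedAlgebra ℚ_[p] L
  exact ⟨fun a ha => tp_inv p A hop hA2 hbd hpA a ha,
    fun a ha h => tp_norm p A hop hA2 hbd hpA hst htr a ha h⟩

lemma wv_zpow {E : Type*} [Field E] [Algebra ℚ_[p] E] [FiniteDimensional ℚ_[p] E] (x : E) (n : ℤ) :
    wv p (x ^ n) = n * wv p x := by
  cases n with
  | ofNat n => simpa using wv_pow p x n
  | negSucc n => rw [zpow_negSucc, wv_inv, wv_pow, Int.negSucc_eq]; push_cast; ring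

/-- p as a unit -/
noncomputable def pU : Lˣ := Units.mk0 (p : L) (fp_ne p)

lemma index_aux (V : Subgroup Lˣ) (c : ℕ)
    (hV : ∀ u : Lˣ, ∀ x : L, IsIntegral ℤ_[p] x → (u : L) - 1 = (p : L) ^ c * x → u ∈ V) :
    (Subgroup.zpowers (pU p (L := L)) ⊔ V).index ≠ 0 := by
  have hp := fp_ne p (k := L)
  have hd : (0:ℤ) < finrank ℚ_[p] L := by exact_mod_cast finrank_pos (R := ℚ_[p]) (M := L)
  set d : ℤ := ((finrank ℚ_[p] L : ℕ) : ℤ) with hdd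
  have hwv : ∀ x : L, x ≠ 0 → wv p ((p : L) ^ (-(wv p x / d)) * x) = wv p x % d := by
    intro x hx
    rw [wv_mul p (zpow_ne_zero _ hp) hx, wv_zpow, wv_p, ← hdd]
    have := Int.emod_add_mul_ediv (wv p x) d
    linarith
  have hIntg : ∀ x : Lˣ, IsIntegral ℤ_[p] ((p : L) ^ (-(wv p (x : L) / d)) * x) := by
    intro x
    rw [isIntegral_iff_wv p (mul_ne_zero (zpow_ne_zero _ hp) x.ne_zero), hwv _ x.ne_zero]
    exact Int.emod_nonneg _ hd.ne'
  have := finite_quot p (L := L) (c + 1)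
  refine index_of_fun (T := Set.Ico (0:ℤ) d × (OO p L ⧸ Ideal.span {(p : OO p L) ^ (c + 1)})) _
    (fun x => (⟨wv p (x : L) % d, Int.emod_nonneg _ hd.ne', Int.emod_lt_of_pos _ hd⟩,
      Ideal.Quotient.mk _ ⟨_, hIntg x⟩)) ?_
  intro x y hxy
  have hxy2 := congrArg Prod.snd hxy
  have h1 : wv p (x : L) % d = wv p (y : L) % d := congrArg (fun t => (Prod.fst t).1) hxy
  simp only at hxy2
  rw [Ideal.Quotient.eq, Ideal.mem_span_singleton] at hxy2
  obtain ⟨z, hz⟩ := hxy2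
  have hz' : (p : L) ^ (-(wv p (x : L) / d)) * x - (p : L) ^ (-(wv p (y : L) / d)) * y =
      (p : L) ^ (c + 1) * z := by
    have := congrArg Subtype.val hz
    simpa using this
  set x' := (p : L) ^ (-(wv p (x : L) / d)) * x with hx'
  set y' := (p : L) ^ (-(wv p (y : L) / d)) * y with hy'
  have hx0 : x' ≠ 0 := mul_ne_zero (zpow_ne_zero _ hp) x.ne_zero
  have hy0 : y' ≠ 0 := mul_ne_zero (zpow_ne_zero _ hp) y.ne_zero
  have hpx : IsIntegral ℤ_[p] ((p : L) * x'⁻¹) := by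
    rw [isIntegral_iff_wv p (mul_ne_zero hp (inv_ne_zero hx0)), wv_mul p hp (inv_ne_zero hx0), wv_inv,
      hwv _ x.ne_zero, wv_p]
    have := Int.emod_lt_of_pos (wv p (x : L)) hd
    linarith
  have hv : Units.mk0 (x'⁻¹ * y') (mul_ne_zero (inv_ne_zero hx0) hy0) ∈ V := by
    refine hV _ (-((p : L) * x'⁻¹ * z)) (hpx.mul z.2).neg ?_
    rw [Units.val_mk0]
    have : y' = x' - (p : L) ^ (c + 1) * z := by rw [← hz']; ring
    rw [this]
    field_simp
    ring
  have : x⁻¹ * y = pU p ^ (-(wv p (x : L) / d) - (-(wv p (y : L) / d))) *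
      Units.mk0 (x'⁻¹ * y') (mul_ne_zero (inv_ne_zero hx0) hy0) := by
    ext
    simp only [Units.val_mul, Units.val_mk0, Units.val_zpow_eq_zpow_val, pU, Units.val_inv_eq_inv_val]
    rw [hx', hy', zpow_sub₀ hp]
    have e1 := zpow_ne_zero (-(wv p (x : L) / d)) hp
    have e2 := zpow_ne_zero (-(wv p (y : L) / d)) hp
    have e3 := x.ne_zero
    field_simp
  rw [this]
  exact Subgroup.mul_mem_sup (Subgroup.zpow_mem _ (Subgroup.mem_zpowers _) _) hv

variable (k L) in
noncomputable abbrev nmU : Lˣ →* kˣ := Units.map (Algebra.norm k : L →* k)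

end ni

theorem norm_index (p : ℕ) [Fact p.Prime] {k L : Type} [Field L] [Algebra ℚ_[p] L]
    [FiniteDimensional ℚ_[p] L] [Field k] [Algebra ℚ_[p] k] [Algebra k L] [IsScalarTower ℚ_[p] k L]
    [FiniteDimensional ℚ_[p] k]
    [Algebra ℤ_[p] k] [IsScalarTower ℤ_[p] ℚ_[p] k]
    [Algebra ℤ_[p] L] [IsScalarTower ℤ_[p] ℚ_[p] L]
    [FiniteDimensional k L] [IsGalois k L] (σ : L ≃ₐ[k] L) (hσ : ∀ x, x ∈ Subgroup.zpowers σ) :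
    (nmU k L).range.index ≠ 0 ∧ (nmU k L).range.index ≤ finrank k L := by
  obtain ⟨A, hop, hA2, hbd, hpA, hst, htr⟩ := exists_lattice p k L
  obtain ⟨hinv, hnorm⟩ := units_lattice p A hop hA2 hbd hpA hst htr
  have hmulA : ∀ a ∈ A, ∀ b ∈ A, a * b ∈ A := by
    intro a ha b hb
    obtain ⟨c, hc, h⟩ := hA2 a ha b hb
    rw [h]; exact hpA c hc
  let V : Subgroup Lˣ :=
    { carrier := {u | (u : L) - 1 ∈ A}
      one_mem' := by simp
      mul_mem' := fun {u v} hu hv => by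
        have := A.add_mem (A.add_mem hu hv) (hmulA _ hu _ hv)
        simp only [Set.mem_ofPred_eq] at *
        convert this using 1; push_cast; ring
      inv_mem' := fun {u} hu => by
        have := (hinv _ hu).2
        simpa using this }
  have memV : ∀ u : Lˣ, u ∈ V ↔ (u : L) - 1 ∈ A := fun u => Iff.rfl
  let ι : kˣ →* Lˣ := Units.map (algebraMap k L : k →* L)
  have hι : Function.Injective ι := Units.map_injective (algebraMap k L).injective
  let f : Lˣ →* Lˣ := MonoidHom.id Lˣ / Units.map (σ : L →* L)
  let g : Lˣ →* Lˣ := ι.comp (nmU k L)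
  have hf : ∀ x : Lˣ, f x = x / Units.map (σ : L →* L) x := fun x => rfl
  have hgv : ∀ x : Lˣ, (g x : L) = ∏ τ : L ≃ₐ[k] L, τ x := fun x =>
    Algebra.norm_eq_prod_automorphisms k (x : L)
  have hfixσ : ∀ x : L, σ x = x → ∀ τ : L ≃ₐ[k] L, τ x = x := by
    intro x hx τ
    have : Subgroup.zpowers σ ≤ MulAction.stabilizer (L ≃ₐ[k] L) x := by
      rw [Subgroup.zpowers_le]; exact hx
    exact this (hσ τ)
  have hker : ∀ x : Lˣ, x ∈ f.ker ↔ σ (x : L) = x := by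
    intro x
    rw [MonoidHom.mem_ker, hf, div_eq_one, Units.ext_iff, eq_comm]; rfl
  have hkerι : f.ker = ι.range := by
    ext x
    rw [hker]
    constructor
    · intro h
      obtain ⟨y, hy⟩ := (IsGalois.mem_range_algebraMap_iff_fixed (F := k) (x : L)).2 (hfixσ _ h)
      have hy0 : y ≠ 0 := by rintro rfl; rw [map_zero] at hy; exact x.ne_zero hy.symm
      exact ⟨Units.mk0 y hy0, Units.ext hy⟩
    · rintro ⟨y, rfl⟩
      exact σ.commutes _
  have hgr : g.range = (nmU k L).range.map ι := by
    rw [MonoidHom.range_comp]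
  have hidx : g.range.relIndex f.ker = (nmU k L).range.index := by
    rw [hgr, hkerι, MonoidHom.range_eq_map, MonoidHom.range_eq_map ι,
      Subgroup.relIndex_map_map_of_injective _ _ hι, Subgroup.relIndex_top_right]
  rw [← hidx]
  set P := pU p (L := L) with hP
  have hPv : (P : L) = p := rfl
  set B := Subgroup.zpowers P ⊔ V with hB
  have hgP : g P = P ^ finrank k L := by
    ext
    rw [hgv, Units.val_pow_eq_pow_val, hPv]
    simp only [map_natCast, Finset.prod_const, Finset.card_univ]
    rw [Fintype.card_eq_nat_card, IsGalois.card_aut_eq_finrank]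
  have hσP : Units.map (σ : L →* L) P = P := by
    ext; exact map_natCast σ p
  have hBi : B.index ≠ 0 := by
    obtain ⟨c, hc⟩ := hop
    refine index_aux p V c fun u x hx h => ?_
    rw [memV, h]; exact hc x hx
  have hτV : ∀ τ : L ≃ₐ[k] L, ∀ v ∈ V, Units.map (τ : L →* L) v ∈ V := by
    intro τ v hv
    have := hst τ _ hv
    rw [map_sub, map_one] at this
    exact this
  have hgV : ∀ v ∈ V, g v ∈ V := by
    intro v hv
    have : g v = ∏ τ : L ≃ₐ[k] L, Units.map (τ : L →* L) v := by
      ext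
      rw [hgv, Units.coe_prod]; rfl
    rw [this]
    exact Subgroup.prod_mem _ fun τ _ => hτV τ v hv
  have hfB : B.map f ≤ B := by
    rw [hB, Subgroup.map_sup]
    refine sup_le ?_ ?_
    · rw [MonoidHom.map_zpowers, Subgroup.zpowers_le, hf, hσP, div_self']
      exact Subgroup.one_mem _
    · rintro _ ⟨v, hv, rfl⟩
      exact (le_sup_right : V ≤ _) (V.div_mem hv (hτV σ v hv))
  have hgB : B.map g ≤ B := by
    rw [hB, Subgroup.map_sup]
    refine sup_le ?_ ?_
    · rw [MonoidHom.map_zpowers, Subgroup.zpowers_le, hgP]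
      exact (le_sup_left : Subgroup.zpowers P ≤ _) (Subgroup.pow_mem _ (Subgroup.mem_zpowers _) _)
    · rintro _ ⟨v, hv, rfl⟩
      exact (le_sup_right : V ≤ _) (hgV v hv)
  have hcyc : IsCyclic (L ≃ₐ[k] L) := ⟨σ, hσ⟩
  have hfg : f.range = g.ker := by
    ext x
    constructor
    · rintro ⟨y, rfl⟩
      rw [MonoidHom.mem_ker, hf, map_div, div_eq_one]
      ext
      rw [hgv, hgv]
      exact (Fintype.prod_equiv (Equiv.mulRight σ) _ _ (fun τ => rfl)).symm
    · intro h
      have h1 : Algebra.norm k (x : L) = 1 := by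
        have h2 : ι (nmU k L x) = ι 1 := by rw [map_one]; exact h
        exact congrArg Units.val (hι h2)
      obtain ⟨y, hy⟩ := groupCohomology.exists_div_of_norm_eq_one hσ h1
      refine ⟨y, ?_⟩
      ext
      rw [← hy, hf, Units.val_div_eq_div_val]; rfl
  have hgf : g.range ≤ f.ker := by
    rw [hgr, hkerι, MonoidHom.range_eq_map ι]; exact Subgroup.map_mono le_top
  have hcy := relIndex_cyc (B.map g) (B ⊓ f.ker) P (finrank k L) finrank_pos
    ⟨P, (le_sup_left : Subgroup.zpowers P ≤ _) (Subgroup.mem_zpowers _), hgP⟩ ?_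
  · have := herb f g B hBi hfB hgB hfg hgf hcy.1
    exact ⟨this.1, this.2.trans hcy.2⟩
  · rintro b ⟨hb, hbf⟩
    obtain ⟨y, ⟨i, rfl⟩, v, hv, rfl⟩ := Subgroup.mem_sup.1 hb
    refine ⟨i, v, ?_, rfl⟩
    have hPf : P ∈ f.ker := by rw [hker]; exact map_natCast σ p
    have hvf : v ∈ f.ker := ((f.ker).mul_mem_cancel_left (f.ker.zpow_mem hPf i)).1 hbf
    rw [hker] at hvf
    have h1 := hfixσ _ hvf
    obtain ⟨b, hb, hb2⟩ := hnorm ((v : L) - 1) hv (fun τ => by rw [map_sub, map_one, h1])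
    refine ⟨Units.mk0 (1 + b) (hinv b hb).1, (le_sup_right : V ≤ _) ?_, ?_⟩
    · rw [memV]; simpa using hb
    · ext
      rw [hgv, Units.val_mk0, ← hb2]; ring
end Part5

section Part6
open Module
set_option linter.unusedSectionVars false
set_option linter.unusedVariables false

lemma sub_crit {G : Type*} [CommGroup G] (N W : Subgroup G) (n : ℕ) (h0 : N.index ≠ 0)
    (h1 : N.index ≤ n) (hNW : N ≤ W) (γ : G) (hγ : ∀ j : ℕ, γ ^ j ∈ W → n ∣ j) : W ≤ N := by
  have h2 := Subgroup.relIndex_mul_index hNW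
  have hW : W.index ≠ 0 := fun h => h0 (by rw [← h2, h, mul_zero])
  have h3 : γ ^ W.index ∈ W := Subgroup.pow_index_mem W γ
  have h4 : n ≤ W.index := Nat.le_of_dvd (Nat.pos_of_ne_zero hW) (hγ _ h3)
  have h5 : N.relIndex W * W.index ≤ 1 * W.index := by rw [h2, one_mul]; exact h1.trans h4
  have h6 : N.relIndex W ≤ 1 := Nat.le_of_mul_le_mul_right h5 (Nat.pos_of_ne_zero hW)
  have h7 : N.relIndex W ≠ 0 := fun h => h0 (by rw [← h2, h, zero_mul])
  exact Subgroup.relIndex_eq_one.1 (by omega)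

theorem unram_norm (p : ℕ) [Fact p.Prime] {k K : Type} [Field K] [Algebra ℚ_[p] K]
    [FiniteDimensional ℚ_[p] K] [Field k] [Algebra ℚ_[p] k] [Algebra k K] [IsScalarTower ℚ_[p] k K]
    [FiniteDimensional ℚ_[p] k]
    [Algebra ℤ_[p] k] [IsScalarTower ℤ_[p] ℚ_[p] k]
    [Algebra ℤ_[p] K] [IsScalarTower ℤ_[p] ℚ_[p] K]
    [FiniteDimensional k K] [IsGalois k K] (σ : K ≃ₐ[k] K) (hσ : ∀ x, x ∈ Subgroup.zpowers σ)
    (hf : fdeg p K = finrank k K * fdeg p k) (u : k) (hu : u ≠ 0) (hu0 : wv p u = 0) :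
    ∃ v : K, Algebra.norm k v = u := by
  obtain ⟨h0, h1⟩ := norm_index p σ hσ
  obtain ⟨ϖ, hϖ, hw⟩ := exists_unif p (E := k)
  let W : Subgroup kˣ :=
    { carrier := {x | (fdeg p K : ℤ) ∣ wv p (x : k)}
      one_mem' := by simp [wv_one]
      mul_mem' := fun {x y} hx hy => by
        have := dvd_add hx hy
        simp only [Set.mem_ofPred_eq] at *
        rwa [Units.val_mul, wv_mul p x.ne_zero y.ne_zero]
      inv_mem' := fun {x} hx => by
        simp only [Set.mem_ofPred_eq] at *
        rw [Units.val_inv_eq_inv_val, wv_inv]; exact hx.neg_right }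
  have hW : W ≤ (nmU k K).range := by
    refine sub_crit _ W (finrank k K) h0 h1 ?_ (Units.mk0 ϖ hϖ) ?_
    · rintro _ ⟨x, rfl⟩
      change (fdeg p K : ℤ) ∣ wv p (Algebra.norm k (x : K))
      rw [wv_norm]; exact fdeg_dvd p x.ne_zero
    · intro j hj
      change (fdeg p K : ℤ) ∣ wv p (ϖ ^ j) at hj
      rw [wv_pow, hw, hf] at hj
      have h2 : finrank k K * fdeg p k ∣ j * fdeg p k := by exact_mod_cast hj
      exact Nat.dvd_of_mul_dvd_mul_right (fdeg_pos p) h2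
  have : Units.mk0 u hu ∈ W := by
    change (fdeg p K : ℤ) ∣ wv p u
    rw [hu0]; exact dvd_zero _
  obtain ⟨v, hv⟩ := hW this
  exact ⟨v, congrArg Units.val hv⟩

lemma fin_aut {K L : Type*} [Field K] [Field L] [_root_.Finite K] [_root_.Finite L] (ι : K →+* L) (s : L →+* L)
    (hs : ∀ x, s (ι x) = ι x) :
    ∃ i r : ℕ, i < r ∧ Nat.card L = Nat.card K ^ r ∧ ∀ x, s x = x ^ (Nat.card K ^ i) := by
  let : Algebra K L := ι.toAlgebra
  have := Fintype.ofFinite K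
  have : FiniteDimensional K L := Module.Finite.of_finite
  let s' : L →ₐ[K] L := { s with commutes' := hs }
  obtain ⟨i, hi⟩ := (FiniteField.bijective_frobeniusAlgHom_pow K L).2 s'
  refine ⟨i, finrank K L, i.2, Module.natCard_eq_pow_finrank, fun x => ?_⟩
  have : s x = (FiniteField.frobeniusAlgHom K L ^ i.1) x := (DFunLike.congr_fun hi x).symm
  rw [this, AlgHom.coe_pow, FiniteField.coe_frobeniusAlgHom, pow_iterate, Fintype.card_eq_nat_card]

section U
variable (p : ℕ) [Fact p.Prime] {E M : Type*} [Field M] [Algebra ℚ_[p] M]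
    [FiniteDimensional ℚ_[p] M] [Field E] [Algebra ℚ_[p] E] [FiniteDimensional ℚ_[p] E]
    [Algebra ℤ_[p] E] [IsScalarTower ℤ_[p] ℚ_[p] E]
    [Algebra ℤ_[p] M] [IsScalarTower ℤ_[p] ℚ_[p] M]

instance res_finite : _root_.Finite (IsLocalRing.ResidueField (OO p M)) := by
  have h := resCard_eq_pow p (E := M)
  rw [resCard_eq] at h
  exact Nat.finite_of_card_ne_zero (h.trans_ne (pow_ne_zero _ (Fact.out : p.Prime).ne_zero))

lemma not_mem_max {N : ℕ} (hN : ¬ p ∣ N) : (N : OO p M) ∉ IsLocalRing.maximalIdeal (OO p M) := by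
  intro h
  have hp : (p : OO p M) ∈ IsLocalRing.maximalIdeal (OO p M) := by
    rw [IsLocalRing.mem_maximalIdeal, mem_nonunits_iff, OO_isUnit_iff]
    rintro ⟨-, h⟩
    have h4 : wv p ((p : OO p M) : M) = finrank ℚ_[p] M := by simpa using wv_p p (E := M)
    have := finrank_pos (R := ℚ_[p]) (M := M)
    omega
  have hc : IsCoprime (N : ℤ) (p : ℤ) :=
    Nat.isCoprime_iff_coprime.2 (((Fact.out : p.Prime).coprime_iff_not_dvd.2 hN).symm)
  obtain ⟨a, b, hab⟩ := hc
  have : (1 : OO p M) ∈ IsLocalRing.maximalIdeal (OO p M) := by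
    have e : (1 : OO p M) = (a : OO p M) * N + b * p := by
      have := congrArg (Int.cast : ℤ → OO p M) hab
      push_cast at this
      exact this.symm
    rw [e]
    exact Ideal.add_mem _ (Ideal.mul_mem_left _ _ h) (Ideal.mul_mem_left _ _ hp)
  exact (Ideal.ne_top_iff_one _).1 (IsLocalRing.maximalIdeal.isMaximal _).ne_top this

lemma res_inj {N : ℕ} (hN : ¬ p ∣ N) (x y : OO p M) (hx : x ^ N = 1) (hy : y ^ N = 1)
    (h : IsLocalRing.residue _ x = IsLocalRing.residue _ y) : x = y := by
  have hN0 : N ≠ 0 := by rintro rfl; simp at hN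
  by_contra hne
  have h1 : (x - y) * ∑ i ∈ Finset.range N, x ^ i * y ^ (N - 1 - i) = 0 := by
    rw [mul_comm, (Commute.all x y).geom_sum₂_mul, hx, hy, sub_self]
  have h2 := (mul_eq_zero.1 h1).resolve_left (sub_ne_zero.2 hne)
  have h3 := congrArg (IsLocalRing.residue (OO p M)) h2
  rw [map_sum, map_zero] at h3
  have h4 : ∀ i ∈ Finset.range N, IsLocalRing.residue (OO p M) (x ^ i * y ^ (N - 1 - i)) =
      IsLocalRing.residue (OO p M) y ^ (N - 1) := by
    intro i hi
    rw [map_mul, map_pow, map_pow, h, ← pow_add]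
    congr 1
    have := Finset.mem_range.1 hi
    omega
  rw [Finset.sum_congr rfl h4, Finset.sum_const, Finset.card_range, nsmul_eq_mul] at h3
  have hy0 : IsLocalRing.residue (OO p M) y ≠ 0 := by
    intro h0
    have := congrArg (IsLocalRing.residue (OO p M)) hy
    rw [map_pow, h0, zero_pow hN0, map_one] at this
    exact zero_ne_one this
  have h5 := (mul_eq_zero.1 h3).resolve_right (pow_ne_zero _ hy0)
  rw [← map_natCast (IsLocalRing.residue (OO p M)), IsLocalRing.residue_eq_zero_iff] at h5
  exact not_mem_max p hN h5

lemma rou_int {N : ℕ} (hN : ¬ p ∣ N) {ζ : M} (hζ : ζ ^ N = 1) : ζ ∈ OO p M := by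
  have hN0 : N ≠ 0 := by rintro rfl; simp at hN
  exact IsIntegral.of_pow (Nat.pos_of_ne_zero hN0) (by rw [hζ]; exact isIntegral_one)

/-- U4 -/
lemma U4 {N : ℕ} (hN : ¬ p ∣ N) {ζ : M} (hζ : ζ ^ N = 1) : ζ ^ resCard p M = ζ := by
  have hi := rou_int p hN hζ
  have h1 : (⟨ζ, hi⟩ : OO p M) ^ N = 1 := Subtype.ext hζ
  have := res_inj p hN (⟨ζ, hi⟩ ^ resCard p M) ⟨ζ, hi⟩ (by rw [← pow_mul, mul_comm, pow_mul, h1, one_pow]) h1 ?_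
  · exact congrArg Subtype.val this
  · rw [map_pow, resCard_eq]
    have := Fintype.ofFinite (IsLocalRing.ResidueField (OO p M))
    rw [Nat.card_eq_fintype_card, FiniteField.pow_card]

variable [Algebra E M] [IsScalarTower ℚ_[p] E M]

variable (E M) in
noncomputable def OOmap : OO p E →+* OO p M :=
  ((algebraMap E M).comp (OO p E).subtype).codRestrict (OO p M).toSubring fun x => by
    have : IsScalarTower ℤ_[p] E M := tower_zp p
    exact x.2.algebraMap

lemma OOmap_coe (x : OO p E) : ((OOmap p E M x : OO p M) : M) = algebraMap E M x := rfl

instance OOmap_local : IsLocalHom (OOmap p E M) := by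
  constructor
  intro x hx
  rw [OO_isUnit_iff, OOmap_coe, wv_algebraMap] at hx
  rw [OO_isUnit_iff]
  have : FiniteDimensional E M := FiniteDimensional.right ℚ_[p] E M
  have h := finrank_pos (R := E) (M := M)
  refine ⟨fun h => hx.1 (by rw [h, map_zero]), ?_⟩
  rcases mul_eq_zero.1 hx.2 with h1 | h1
  · exact absurd (by exact_mod_cast h1) h.ne'
  · exact h1

noncomputable def OOaut (σ : M ≃ₐ[E] M) : OO p M →+* OO p M :=
  ((σ : M →+* M).comp (OO p M).subtype).codRestrict (OO p M).toSubring fun x => by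
    have : IsScalarTower ℤ_[p] E M := tower_zp p
    have h : IsIntegral ℤ_[p] (x : M) := x.2
    exact h.map (σ.restrictScalars ℤ_[p])

lemma OOaut_coe (σ : M ≃ₐ[E] M) (x : OO p M) : ((OOaut p σ x : OO p M) : M) = σ x := rfl

instance OOaut_local (σ : M ≃ₐ[E] M) : IsLocalHom (OOaut p σ) := by
  constructor
  intro x hx
  rw [OO_isUnit_iff, OOaut_coe] at hx
  have := wv_algEquiv p (σ.restrictScalars ℚ_[p]) (x : M)
  rw [OO_isUnit_iff]
  refine ⟨fun h => hx.1 (by rw [h, map_zero]), ?_⟩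
  rw [← hx.2]; exact this.symm

lemma U1 (σ : M ≃ₐ[E] M) : ∃ i : ℕ, i * fdeg p E < fdeg p M ∧ ∀ N : ℕ, ¬ p ∣ N → ∀ ζ : M,
    ζ ^ N = 1 → σ ζ = ζ ^ (resCard p E ^ i) := by
  obtain ⟨i, r, hir, hc, h⟩ := fin_aut (IsLocalRing.ResidueField.map (OOmap p E M))
    (IsLocalRing.ResidueField.map (OOaut p σ)) (by
      intro x
      obtain ⟨x, rfl⟩ := IsLocalRing.residue_surjective x
      rw [IsLocalRing.ResidueField.map_residue, IsLocalRing.ResidueField.map_residue]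
      congr 1
      exact Subtype.ext (σ.commutes _))
  rw [← resCard_eq, ← resCard_eq, resCard_pow_iff] at hc
  refine ⟨i, ?_, ?_⟩
  · rw [hc, mul_comm]; exact Nat.mul_lt_mul_of_pos_left hir (fdeg_pos p)
  · intro N hN ζ hζ
    have hi := rou_int p hN hζ
    have h1 : (⟨ζ, hi⟩ : OO p M) ^ N = 1 := Subtype.ext hζ
    have := res_inj p hN (OOaut p σ ⟨ζ, hi⟩) (⟨ζ, hi⟩ ^ (resCard p E ^ i))
      (by rw [← map_pow, h1, map_one]) (by rw [← pow_mul, mul_comm, pow_mul, h1, one_pow]) ?_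
    · exact congrArg Subtype.val this
    · rw [map_pow, resCard_eq, ← h, IsLocalRing.ResidueField.map_residue]

lemma U2 [IsGalois E M] {N : ℕ} (hN : ¬ p ∣ N) {ζ : M} (hζ : ζ ^ N = 1)
    (h : ∀ σ : M ≃ₐ[E] M, σ ζ = ζ → σ = 1) : fdeg p M = finrank E M * fdeg p E := by
  have : FiniteDimensional E M := FiniteDimensional.right ℚ_[p] E M
  have hd := fdeg_dvd_fdeg p E M
  obtain ⟨r, hr⟩ := hd
  have hE := fdeg_pos p (E := E)
  choose i hi1 hi2 using U1 p (E := E) (M := M)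
  have hinj : Function.Injective (fun σ : M ≃ₐ[E] M => (⟨i σ, by
      have := hi1 σ
      rw [hr, mul_comm] at this
      exact Nat.lt_of_mul_lt_mul_left this⟩ : Fin r)) := by
    intro σ τ hst
    have hst' : i σ = i τ := congrArg Fin.val hst
    have h1 : σ ζ = τ ζ := by rw [hi2 σ N hN ζ hζ, hi2 τ N hN ζ hζ, hst']
    have h2 : (τ⁻¹ * σ) ζ = ζ := by
      rw [AlgEquiv.mul_apply, h1]; exact τ.symm_apply_apply ζ
    have := h _ h2
    rwa [inv_mul_eq_one, eq_comm] at this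
  have hle := Nat.card_le_card_of_injective _ hinj
  rw [Nat.card_fin, IsGalois.card_aut_eq_finrank] at hle
  have h3 := Nat.le_of_dvd (Nat.mul_pos finrank_pos hE) (fdeg_dvd_mul p E M)
  refine le_antisymm h3 ?_
  rw [hr, mul_comm]; exact Nat.mul_le_mul_left _ hle

lemma U3 [IsGalois E M] : ∃ φ : M ≃ₐ[E] M, ∀ N : ℕ, ¬ p ∣ N → ∀ ζ : M,
    ζ ^ N = 1 → φ ζ = ζ ^ (resCard p E) := by
  have : FiniteDimensional E M := FiniteDimensional.right ℚ_[p] E M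
  let : Algebra (OO p E) (OO p M) := (OOmap p E M).toAlgebra
  have : IsScalarTower ℤ_[p] E M := tower_zp p
  have : SMulCommClass (M ≃ₐ[E] M) ℤ_[p] M := ⟨fun g r x => by
    change g (r • x) = r • g x
    exact map_smul (g.restrictScalars ℤ_[p]) r x⟩
  have : SMulCommClass (M ≃ₐ[E] M) (OO p E) (OO p M) := ⟨fun g r x => by
    apply Subtype.ext
    rw [Algebra.smul_def, Algebra.smul_def]
    change g (algebraMap E M r * x) = algebraMap E M r * g x
    rw [map_mul, g.commutes]⟩
  have : Algebra.IsInvariant (OO p E) (OO p M) (M ≃ₐ[E] M) := ⟨fun b hb => by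
    obtain ⟨y, hy⟩ := (IsGalois.mem_range_algebraMap_iff_fixed (F := E) (b : M)).2
      (fun g => congrArg Subtype.val (hb g))
    have hyi : IsIntegral ℤ_[p] y := by
      rw [← isIntegral_algebraMap_iff (algebraMap E M).injective, hy]; exact b.2
    exact ⟨⟨y, hyi⟩, Subtype.ext hy⟩⟩
  have : _root_.Finite (OO p M ⧸ IsLocalRing.maximalIdeal (OO p M)) := res_finite p
  obtain ⟨φ, hφ⟩ := IsArithFrobAt.exists_of_isInvariant (OO p E) (M ≃ₐ[E] M)
    (IsLocalRing.maximalIdeal (OO p M))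
  refine ⟨φ, fun N hN ζ hζ => ?_⟩
  have hi := rou_int p hN hζ
  have h1 : (⟨ζ, hi⟩ : OO p M) ^ N = 1 := Subtype.ext hζ
  have h2 := hφ.apply_of_pow_eq_one h1 (not_mem_max p hN)
  have h3 : Nat.card (OO p E ⧸ (IsLocalRing.maximalIdeal (OO p M)).under (OO p E)) = resCard p E := by
    rw [resCard_eq]
    have : (IsLocalRing.maximalIdeal (OO p M)).under (OO p E) = IsLocalRing.maximalIdeal (OO p E) :=
      ((IsLocalRing.local_hom_TFAE (OOmap p E M)).out 0 4).1 (OOmap_local p)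
    rw [this]; rfl
  rw [h3] at h2
  exact congrArg Subtype.val h2

end U
end Part6

section Part7
open Module
set_option linter.unusedSectionVars false
set_option linter.unusedVariables false

lemma claim_abs {A : Type*} [AddCommGroup A] (s f : Module.End ℤ A) (hsf : Commute s f)
    (w : A →+ ℤ) (hws : ∀ x, w (s x) = w x) (hwf : ∀ x, w (f x) = w x) (n d a : ℕ) (D : ℤ)
    (h90 : ∀ x, (∑ j ∈ Finset.range n, s ^ j) x = 0 → ∃ z, x = z - s z)
    (hfix : ∀ x, s x = x → D ∣ w x) (x y : A) (hx : (s ^ a * f ^ d) x = x) (hy : f y = y)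
    (hxy : (∑ i ∈ Finset.range d, f ^ i) ((∑ j ∈ Finset.range n, s ^ j) x) =
      (∑ j ∈ Finset.range n, s ^ j) y) : D ∣ a * w x := by
  set Fd := ∑ i ∈ Finset.range d, f ^ i with hF
  set Ns := ∑ j ∈ Finset.range n, s ^ j with hN
  have hc1 : Commute Ns Fd := by
    refine Commute.sum_left _ _ _ fun j _ => Commute.sum_right _ _ _ fun i _ => ?_
    exact hsf.pow_pow _ _
  have h1 : Ns (Fd x - y) = 0 := by
    rw [map_sub, sub_eq_zero, ← hxy]
    exact DFunLike.congr_fun hc1.eq x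
  obtain ⟨z, hz⟩ := h90 _ h1
  have h2 : (f - 1) (Fd x) = (f ^ d) x - x := by
    have := DFunLike.congr_fun (mul_geom_sum f d) x
    exact this
  have h3 : (f - 1) (Fd x - y) = (f ^ d) x - x := by
    rw [map_sub, h2, LinearMap.sub_apply, hy, Module.End.one_apply, sub_self, sub_zero]
  set t := (f - 1) z with ht
  have h4 : (f ^ d) x - x = t - s t := by
    rw [← h3, hz, map_sub]
    have hc : Commute (f - 1) s := (hsf.symm).sub_left (Commute.one_left s)
    congr 1
    exact DFunLike.congr_fun hc.eq z
  have h5 : x - (s ^ a) x = (s ^ a) t - (s ^ a) (s t) := by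
    have := congrArg (s ^ a) h4
    rw [map_sub, map_sub] at this
    rw [← this]
    congr 1
    exact hx.symm
  have hw : ∀ j : ℕ, ∀ x, w ((s ^ j) x) = w x := by
    intro j
    induction j with
    | zero => simp
    | succ j ih => intro x; rw [pow_succ]; exact (ih (s x)).trans (hws x)
  have h6 : (s - 1) ((∑ j ∈ Finset.range a, s ^ j) x) = (s ^ a) x - x := by
    have := DFunLike.congr_fun (mul_geom_sum s a) x
    exact this
  have h7 : s ((∑ j ∈ Finset.range a, s ^ j) x - (s ^ a) t) =
      (∑ j ∈ Finset.range a, s ^ j) x - (s ^ a) t := by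
    have e1 : s ((s ^ a) t) = (s ^ a) (s t) :=
      DFunLike.congr_fun ((Commute.refl s).pow_right a).eq t
    have e2 : s ((∑ j ∈ Finset.range a, s ^ j) x) - (∑ j ∈ Finset.range a, s ^ j) x =
      (s ^ a) x - x := h6
    rw [map_sub, e1]
    rw [← sub_eq_zero] at e2 h5 ⊢
    have e3 : ∀ X Y a b c d : A, X - Y - (a - b) = 0 → b - a - (c - d) = 0 →
        X - d - (Y - c) = 0 := by
      intro X Y a b c d h1 h2
      have : X - d - (Y - c) = (X - Y - (a - b)) - (b - a - (c - d)) := by abel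
      rw [this, h1, h2, sub_zero]
    exact e3 _ _ _ _ _ _ e2 h5
  have h8 := hfix _ h7
  have h9 : w t = 0 := by
    rw [ht, LinearMap.sub_apply, map_sub, hwf, Module.End.one_apply, sub_self]
  rw [map_sub, hw, h9, sub_zero] at h8
  have h10 : w ((∑ j ∈ Finset.range a, s ^ j) x) = a * w x := by
    rw [LinearMap.sum_apply, map_sum, Finset.sum_congr rfl (fun j _ => hw j x)]
    simp
  rwa [h10] at h8

lemma nr {ι k S M : Type*} [Field k] [Field S] [Field M] [Algebra k S] [Algebra k M] [Algebra S M]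
    [IsScalarTower k S M] [FiniteDimensional k S] [CharZero k] [Fintype ι] (r : ι → M →ₐ[k] M)
    (hcard : Fintype.card ι = finrank k S)
    (hinj : ∀ i j, (∀ x : S, r i (algebraMap S M x) = r j (algebraMap S M x)) → i = j) (x : S) :
    algebraMap k M (Algebra.norm k x) = ∏ i, r i (algebraMap S M x) := by
  let Ω := AlgebraicClosure M
  let e : ι → (S →ₐ[k] Ω) := fun i =>
    ((IsScalarTower.toAlgHom k M Ω).comp (r i)).comp (IsScalarTower.toAlgHom k S M)
  have he : Function.Injective e := by
    intro i j hij
    refine hinj i j fun x => ?_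
    exact (algebraMap M Ω).injective (DFunLike.congr_fun hij x)
  have hb : Function.Bijective e := by
    rw [Fintype.bijective_iff_injective_and_card]
    refine ⟨he, ?_⟩
    rw [hcard, AlgHom.card]
  apply (algebraMap M Ω).injective
  rw [← IsScalarTower.algebraMap_apply, Algebra.norm_eq_prod_embeddings, map_prod]
  exact (Fintype.prod_equiv (Equiv.ofBijective e hb) _ _ (fun i => rfl)).symm

section h90
variable {k E : Type} [Field k] [Field E] [Algebra k E] [FiniteDimensional k E] [IsGalois k E]

lemma fixgen (σ : E ≃ₐ[k] E) :
    ∃ τ : E ≃ₐ[IntermediateField.fixedField (Subgroup.zpowers σ)] E, (∀ x, τ x = σ x) ∧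
      ∀ g, g ∈ Subgroup.zpowers τ := by
  let e := IntermediateField.subgroupEquivAlgEquiv (Subgroup.zpowers σ)
  refine ⟨e ⟨σ, Subgroup.mem_zpowers σ⟩, fun x => rfl, fun g => ?_⟩
  obtain ⟨⟨t, ht⟩, rfl⟩ := e.surjective g
  obtain ⟨i, hi⟩ := Subgroup.mem_zpowers_iff.1 ht
  rw [Subgroup.mem_zpowers_iff]
  refine ⟨i, ?_⟩
  rw [← map_zpow]
  congr 1
  exact Subtype.ext hi

lemma fix_finrank (σ : E ≃ₐ[k] E) :
    finrank (IntermediateField.fixedField (Subgroup.zpowers σ)) E = orderOf σ := by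
  rw [IntermediateField.finrank_fixedField_eq_card, Nat.card_zpowers]

lemma prod_gen (σ : E ≃ₐ[k] E) (hσ : ∀ g, g ∈ Subgroup.zpowers σ) (x : E) :
    algebraMap k E (Algebra.norm k x) = ∏ j ∈ Finset.range (finrank k E), (σ ^ j) x := by
  have ho : orderOf σ = finrank k E := by
    rw [← IsGalois.card_aut_eq_finrank, orderOf_eq_card_of_forall_mem_zpowers hσ]
  rw [Algebra.norm_eq_prod_automorphisms, ← ho, Finset.prod_range]
  refine (Fintype.prod_bijective (fun j : Fin (orderOf σ) => σ ^ (j : ℕ)) ?_ _ _ (fun j => rfl)).symm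
  rw [Fintype.bijective_iff_injective_and_card]
  constructor
  · intro i j hij
    exact Fin.ext (pow_injOn_Iio_orderOf i.2 j.2 hij)
  · rw [Fintype.card_fin, ho, Fintype.card_eq_nat_card, IsGalois.card_aut_eq_finrank]

lemma h90 (σ : E ≃ₐ[k] E) (x : E) (hx : ∏ j ∈ Finset.range (orderOf σ), (σ ^ j) x = 1) :
    ∃ z : Eˣ, x = z / σ z := by
  obtain ⟨τ, hτ, hgen⟩ := fixgen σ
  have hpow : ∀ (j : ℕ) x, (τ ^ j) x = (σ ^ j) x := by
    intro j
    induction j with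
    | zero => intro x; rfl
    | succ j ih => intro x; rw [pow_succ, pow_succ, AlgEquiv.mul_apply, AlgEquiv.mul_apply, ih, hτ]
  have h1 := prod_gen τ hgen x
  rw [fix_finrank, Finset.prod_congr rfl (fun j _ => hpow j x), hx] at h1
  have h2 : Algebra.norm (IntermediateField.fixedField (Subgroup.zpowers σ)) x = 1 :=
    (algebraMap _ E).injective (by rw [h1, map_one])
  have : IsCyclic (E ≃ₐ[IntermediateField.fixedField (Subgroup.zpowers σ)] E) := ⟨τ, hgen⟩
  obtain ⟨z, hz⟩ := groupCohomology.exists_div_of_norm_eq_one hgen h2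
  exact ⟨z, by rw [← hz, hτ]⟩
end h90
end Part7

section Part8
open Module
set_option linter.unusedSectionVars false
set_option linter.unusedVariables false

noncomputable def TT (k E : Type) [Field k] [Field E] [Algebra k E] :
    (E ≃ₐ[k] E) →* Module.End ℤ (Additive Eˣ) where
  toFun σ := (MonoidHom.toAdditive (Units.map (σ : E →* E))).toIntLinearMap
  map_one' := by ext; rfl
  map_mul' σ τ := by ext; rfl

lemma TT_val {k E : Type} [Field k] [Field E] [Algebra k E] (σ : E ≃ₐ[k] E) (a : Additive Eˣ) :
    ((TT k E σ a).toMul : E) = σ (a.toMul : E) := rfl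

lemma TT_sum {k E : Type} [Field k] [Field E] [Algebra k E] (σ : E ≃ₐ[k] E) (n : ℕ) (a : Additive Eˣ) :
    (((∑ j ∈ Finset.range n, (TT k E σ) ^ j) a).toMul : E) =
      ∏ j ∈ Finset.range n, (σ ^ j) (a.toMul : E) := by
  rw [LinearMap.sum_apply, toMul_sum, Units.coe_prod]
  refine Finset.prod_congr rfl fun j _ => ?_
  rw [← map_pow, TT_val]

lemma add_ext {E : Type} [Field E] {a b : Additive Eˣ} (h : (a.toMul : E) = b.toMul) : a = b :=
  Additive.toMul.injective (Units.ext h)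

lemma claim_E (p : ℕ) [Fact p.Prime] {k E : Type} [Field E] [Algebra ℚ_[p] E]
    [FiniteDimensional ℚ_[p] E] [Field k] [Algebra ℚ_[p] k] [Algebra k E] [IsScalarTower ℚ_[p] k E]
    [FiniteDimensional k E] [IsGalois k E] (σ φ : E ≃ₐ[k] E) (hc : σ * φ = φ * σ) (D : ℤ)
    (hfix : ∀ x : E, x ≠ 0 → σ x = x → D ∣ wv p x) (n a d : ℕ) (hn : orderOf σ = n)
    (x y : E) (hx0 : x ≠ 0) (hy0 : y ≠ 0) (hx : (σ ^ a * φ ^ d) x = x) (hy : φ y = y)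
    (hxy : ∏ i ∈ Finset.range d, (φ ^ i) (∏ j ∈ Finset.range n, (σ ^ j) x) =
      ∏ j ∈ Finset.range n, (σ ^ j) y) : D ∣ a * wv p x := by
  let w : Additive Eˣ →+ ℤ :=
    { toFun := fun u => wv p (u.toMul : E)
      map_zero' := by simp [wv_one]
      map_add' := fun u v => by
        rw [toMul_add, Units.val_mul, wv_mul p u.toMul.ne_zero v.toMul.ne_zero] }
  have hwv : ∀ (τ : E ≃ₐ[k] E) (u : Additive Eˣ), w (TT k E τ u) = w u := fun τ u =>
    wv_algEquiv p (τ.restrictScalars ℚ_[p]) (u.toMul : E)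
  refine claim_abs (TT k E σ) (TT k E φ) ?_ w (hwv σ) (hwv φ) n d a D ?_ ?_
    (Additive.ofMul (Units.mk0 x hx0)) (Additive.ofMul (Units.mk0 y hy0)) ?_ ?_ ?_
  · change _ * _ = _ * _
    rw [← map_mul, hc, map_mul]
  · intro u hu
    have h1 : ∏ j ∈ Finset.range (orderOf σ), (σ ^ j) (u.toMul : E) = 1 := by
      rw [hn, ← TT_sum, hu]; rfl
    obtain ⟨z, hz⟩ := h90 σ _ h1
    refine ⟨Additive.ofMul z, add_ext ?_⟩
    rw [hz, toMul_sub, Units.val_div_eq_div_val]; rfl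
  · intro u hu
    exact hfix _ u.toMul.ne_zero (congrArg (fun t => (t.toMul : E)) hu)
  · apply add_ext
    rw [← map_pow, ← map_pow, ← map_mul, TT_val]; exact hx
  · exact add_ext hy
  · apply add_ext
    rw [TT_sum, TT_sum, TT_sum]; exact hxy

section arith
/-- if a primitive `q^m-1`-th root lies in `E`, `q = p^f`, then `m f ≤ fdeg E` -/
lemma fdeg_ge (p : ℕ) [Fact p.Prime] {E : Type*} [Field E] [Algebra ℚ_[p] E]
    [FiniteDimensional ℚ_[p] E] [Algebra ℤ_[p] E] [IsScalarTower ℤ_[p] ℚ_[p] E] (f : ℕ) (hf : 0 < f)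
    {ζ : E} (hζ : IsPrimitiveRoot ζ (p ^ f - 1)) : f ≤ fdeg p E := by
  have hp := (Fact.out : p.Prime)
  have h1 : 1 < p ^ f := Nat.one_lt_pow hf.ne' hp.one_lt
  have hN : ¬ p ∣ p ^ f - 1 := by
    intro h
    have h2 : p ∣ p ^ f := dvd_pow_self p hf.ne'
    have h3 := (Nat.dvd_sub h2 h)
    rw [show p ^ f - (p ^ f - 1) = 1 by omega] at h3
    exact hp.one_lt.ne' (Nat.dvd_one.1 h3)
  have h4 := U4 p hN hζ.pow_eq_one
  rw [resCard_eq_pow] at h4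
  have h5 : 1 < p ^ fdeg p E := Nat.one_lt_pow (fdeg_pos p).ne' hp.one_lt
  have hz0 : ζ ≠ 0 := hζ.ne_zero (by omega)
  have h6 : ζ ^ (p ^ fdeg p E - 1) = 1 := by
    have : ζ ^ (p ^ fdeg p E - 1) * ζ = 1 * ζ := by
      rw [← pow_succ, one_mul, show p ^ fdeg p E - 1 + 1 = p ^ fdeg p E by omega, h4]
    exact mul_right_cancel₀ hz0 this
  have h7 := Nat.le_of_dvd (by omega) (hζ.dvd_of_pow_eq_one _ h6)
  exact (Nat.pow_le_pow_iff_right hp.one_lt).1 (by omega)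

lemma not_dvd_pow_sub (p : ℕ) [Fact p.Prime] {f : ℕ} (hf : 0 < f) : ¬ p ∣ p ^ f - 1 := by
  have hp := (Fact.out : p.Prime)
  have h1 : 1 < p ^ f := Nat.one_lt_pow hf.ne' hp.one_lt
  intro h
  have h2 : p ∣ p ^ f := dvd_pow_self p hf.ne'
  have h3 := (Nat.dvd_sub h2 h)
  rw [show p ^ f - (p ^ f - 1) = 1 by omega] at h3
  exact hp.one_lt.ne' (Nat.dvd_one.1 h3)

/-- `ζ^(q^i) = ζ^(q^j)` iff `i ≡ j mod m` -/
lemma qpow_inj {M : Type*} [Field M] {q m : ℕ} (hq : 1 < q) (hm : 0 < m) {ζ : M}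
    (hζ : IsPrimitiveRoot ζ (q ^ m - 1)) (i j : ℕ) (h : ζ ^ (q ^ i) = ζ ^ (q ^ j)) : i ≡ j [MOD m] := by
  have hqm : 1 < q ^ m := Nat.one_lt_pow hm.ne' hq
  have hper : ζ ^ (q ^ m) = ζ := by
    conv_lhs => rw [show q ^ m = (q ^ m - 1) + 1 by omega, pow_succ, hζ.pow_eq_one, one_mul]
  have hper2 : ∀ i c, ζ ^ (q ^ (i + m * c)) = ζ ^ (q ^ i) := by
    intro i c
    induction c with
    | zero => simp
    | succ c ih => rw [mul_add, mul_one, ← add_assoc, pow_add, mul_comm, pow_mul, hper, ih]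
  have hmod : ∀ i, ζ ^ (q ^ i) = ζ ^ (q ^ (i % m)) := fun i => by
    conv_lhs => rw [← Nat.mod_add_div i m]
    exact hper2 _ _
  rw [hmod i, hmod j] at h
  have hlt : ∀ i, q ^ (i % m) < q ^ m := fun i => Nat.pow_lt_pow_right hq (Nat.mod_lt _ hm)
  rcases Nat.eq_or_lt_of_le (show 1 ≤ m from hm) with h1 | h1
  · rw [← h1]; exact Nat.modEq_one
  have hlt2 : ∀ i, q ^ (i % m) < q ^ m - 1 := by
    intro i
    have h2 : q ^ (i % m) ≤ q ^ (m - 1) := Nat.pow_le_pow_right (by omega) (by have := Nat.mod_lt i hm; omega)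
    have h3 : q ^ m = q ^ (m - 1) * q := by rw [← pow_succ]; congr 1; omega
    have h4 : 1 < q ^ (m - 1) := Nat.one_lt_pow (by omega) hq
    have : q ^ (m - 1) * 2 ≤ q ^ (m - 1) * q := Nat.mul_le_mul_left _ hq
    omega
  have := hζ.pow_inj (hlt2 i) (hlt2 j) h
  exact Nat.pow_right_injective hq this

lemma qpow_per {M : Type*} [Field M] {q m : ℕ} (hq : 1 < q) (hm : 0 < m) {ζ : M}
    (hζ : ζ ^ (q ^ m - 1) = 1) (i : ℕ) (h : m ∣ i) : ζ ^ (q ^ i) = ζ := by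
  have hqm : 1 < q ^ m := Nat.one_lt_pow hm.ne' hq
  have hper : ζ ^ (q ^ m) = ζ := by
    conv_lhs => rw [show q ^ m = (q ^ m - 1) + 1 by omega, pow_succ, hζ, one_mul]
  obtain ⟨c, rfl⟩ := h
  induction c with
  | zero => simp
  | succ c ih => rw [mul_add, mul_one, pow_add, mul_comm, pow_mul, hper, ih]

lemma frob_pow {k M : Type*} [Field k] [Field M] [Algebra k M] (φ : M ≃ₐ[k] M) (ζ : M) (Q : ℕ)
    (h : φ ζ = ζ ^ Q) (i : ℕ) : (φ ^ i) ζ = ζ ^ (Q ^ i) := by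
  induction i with
  | zero => simp
  | succ i ih => rw [pow_succ, AlgEquiv.mul_apply, h, map_pow, ih, ← pow_mul, pow_succ]
end arith
end Part8

section Part9
open Module
set_option linter.unusedSectionVars false
set_option linter.unusedVariables false

section inst
variable (p : ℕ) [Fact p.Prime] {k E : Type*}
    [Field k] [Algebra ℚ_[p] k] [Algebra ℤ_[p] k] [IsScalarTower ℤ_[p] ℚ_[p] k]
    [Field E] [Algebra ℚ_[p] E] [Algebra ℤ_[p] E] [IsScalarTower ℤ_[p] ℚ_[p] E]
    [Algebra k E] [IsScalarTower ℚ_[p] k E] [IsScalarTower ℤ_[p] k E]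

lemma if_tower1 (K : IntermediateField k E) : IsScalarTower ℚ_[p] K E :=
  IsScalarTower.of_algebraMap_eq fun x => rfl
lemma if_tower2 (K : IntermediateField k E) : IsScalarTower ℤ_[p] ℚ_[p] K :=
  IsScalarTower.of_algebraMap_eq fun x => by
    apply Subtype.ext
    exact IsScalarTower.algebraMap_apply ℤ_[p] ℚ_[p] E x
lemma if_tower3 (K : IntermediateField k E) : IsScalarTower ℚ_[p] k K :=
  IsScalarTower.of_algebraMap_eq fun x => Subtype.ext (IsScalarTower.algebraMap_apply ℚ_[p] k E x)
end inst

lemma core1 (p : ℕ) [Fact p.Prime] {k L E : Type}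
    [Field k] [Algebra ℚ_[p] k] [FiniteDimensional ℚ_[p] k] [Algebra ℤ_[p] k] [IsScalarTower ℤ_[p] ℚ_[p] k]
    [Field L] [Algebra ℚ_[p] L] [FiniteDimensional ℚ_[p] L] [Algebra ℤ_[p] L] [IsScalarTower ℤ_[p] ℚ_[p] L]
    [Field E] [Algebra ℚ_[p] E] [FiniteDimensional ℚ_[p] E] [Algebra ℤ_[p] E] [IsScalarTower ℤ_[p] ℚ_[p] E]
    [Algebra k L] [Algebra k E] [Algebra L E] [IsScalarTower k L E]
    [IsScalarTower ℚ_[p] k L] [IsScalarTower ℚ_[p] k E] [IsScalarTower ℚ_[p] L E]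
    [FiniteDimensional k L] [FiniteDimensional k E] [IsGalois k L] [IsGalois k E]
    (n m : ℕ) (hn : finrank k L = n) (s0 : L ≃ₐ[k] L) (hs0 : ∀ g, g ∈ Subgroup.zpowers s0)
    (hfL : fdeg p L = fdeg p k) (hm : 0 < m) (ζ : E) (hζ : IsPrimitiveRoot ζ (resCard p k ^ m - 1))
    (hfE : fdeg p E ∣ m * fdeg p k)
    (hgenE : ∀ τ : E ≃ₐ[k] E, (∀ x : L, τ (algebraMap L E x) = algebraMap L E x) → τ ζ = ζ → τ = 1) :
    ∃ φ σ : E ≃ₐ[k] E, (∀ x : L, φ (algebraMap L E x) = algebraMap L E x) ∧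
      φ ζ = ζ ^ resCard p k ∧ σ ζ = ζ ∧ (∀ x : L, σ (algebraMap L E x) = algebraMap L E (s0 x)) ∧
      σ * φ = φ * σ ∧ orderOf σ = n ∧ finrank k E = n * m ∧
      (∀ x : E, x ≠ 0 → σ x = x → ((n * (m * fdeg p k) : ℕ) : ℤ) ∣ wv p x) := by
  have hfk := fdeg_pos p (E := k)
  have hq : resCard p k ^ m - 1 = p ^ (m * fdeg p k) - 1 := by
    rw [resCard_eq_pow, ← pow_mul, mul_comm]
  have hmf : 0 < m * fdeg p k := Nat.mul_pos hm hfk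
  have hζ' := hζ
  rw [hq] at hζ'
  have hN := not_dvd_pow_sub p hmf
  have hfE' : fdeg p E = m * fdeg p k :=
    le_antisymm (Nat.le_of_dvd hmf hfE) (fdeg_ge p _ hmf hζ')
  have hqL : resCard p L = resCard p k := by rw [resCard_eq_pow, resCard_eq_pow, hfL]
  have : IsGalois L E := IsGalois.tower_top_of_isGalois k L E
  have : FiniteDimensional L E := FiniteDimensional.right k L E
  have hEL : finrank L E = m := by
    have := U2 p (E := L) (M := E) hN hζ'.pow_eq_one (fun σ hσ => by
      have h := hgenE (σ.restrictScalars k) (fun x => σ.commutes x) hσ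
      ext x
      exact DFunLike.congr_fun h x)
    rw [hfE', hfL] at this
    exact (Nat.eq_of_mul_eq_mul_right hfk this).symm
  obtain ⟨φ', hφ'⟩ := U3 p (E := L) (M := E)
  let φ : E ≃ₐ[k] E := φ'.restrictScalars k
  have hφL : ∀ x : L, φ (algebraMap L E x) = algebraMap L E x := fun x => φ'.commutes x
  have hφζ : φ ζ = ζ ^ resCard p k := by rw [← hqL]; exact hφ' _ hN ζ hζ'.pow_eq_one
  clear_value φ
  obtain ⟨ψ, hψ⟩ := AlgEquiv.restrictNormalHom_surjective (F := k) (K₁ := L) E s0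
  have hψL : ∀ x : L, ψ (algebraMap L E x) = algebraMap L E (s0 x) := by
    intro x; rw [← hψ]; exact (AlgEquiv.restrictNormal_commutes ψ L x).symm
  obtain ⟨i, -, hi⟩ := U1 p (E := k) ψ
  have hi := hi _ hN ζ hζ'.pow_eq_one
  have hφi : ∀ (i : ℕ) (x : L), (φ ^ i) (algebraMap L E x) = algebraMap L E x := by
    intro i x
    induction i with
    | zero => rfl
    | succ i ih => rw [pow_succ, AlgEquiv.mul_apply, hφL, ih]
  let σ : E ≃ₐ[k] E := (φ ^ i)⁻¹ * ψ
  have hσζ : σ ζ = ζ := by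
    change (φ ^ i).symm (ψ ζ) = ζ
    rw [hi, AlgEquiv.symm_apply_eq, frob_pow φ ζ _ hφζ]
  have hσL : ∀ x : L, σ (algebraMap L E x) = algebraMap L E (s0 x) := by
    intro x
    change (φ ^ i).symm (ψ _) = _
    rw [hψL, AlgEquiv.symm_apply_eq, hφi]
  clear_value σ
  have hext : ∀ τ τ' : E ≃ₐ[k] E, (∀ x : L, τ (algebraMap L E x) = τ' (algebraMap L E x)) →
      τ ζ = τ' ζ → τ = τ' := by
    intro τ τ' h1 h2
    have := hgenE (τ'⁻¹ * τ) (fun x => by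
      rw [AlgEquiv.mul_apply, h1]; exact τ'.symm_apply_apply _) (by
      rw [AlgEquiv.mul_apply, h2]; exact τ'.symm_apply_apply _)
    rwa [inv_mul_eq_one, eq_comm] at this
  have hσpL : ∀ (j : ℕ) (x : L), (σ ^ j) (algebraMap L E x) = algebraMap L E ((s0 ^ j) x) := by
    intro j
    induction j with
    | zero => intro x; rfl
    | succ j ih => intro x; rw [pow_succ, AlgEquiv.mul_apply, hσL, ih, pow_succ, AlgEquiv.mul_apply]
  have hσpζ : ∀ j : ℕ, (σ ^ j) ζ = ζ := by
    intro j
    have := frob_pow σ ζ 1 (by rw [hσζ, pow_one]) j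
    simpa using this
  have ho0 : orderOf s0 = n := by
    rw [← hn, ← IsGalois.card_aut_eq_finrank, orderOf_eq_card_of_forall_mem_zpowers hs0]
  have ho : orderOf σ = n := by
    rw [← ho0]
    refine dvd_antisymm (orderOf_dvd_of_pow_eq_one ?_) (orderOf_dvd_of_pow_eq_one ?_)
    · refine hgenE _ (fun x => ?_) (hσpζ _)
      rw [hσpL, pow_orderOf_eq_one]; rfl
    · ext x
      apply (algebraMap L E).injective
      rw [← hσpL, pow_orderOf_eq_one]; rfl
  refine ⟨φ, σ, hφL, hφζ, hσζ, hσL, ?_, ho, ?_, ?_⟩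
  · refine hext _ _ (fun x => ?_) ?_
    · rw [AlgEquiv.mul_apply, AlgEquiv.mul_apply, hφL, hσL, hφL]
    · rw [AlgEquiv.mul_apply, AlgEquiv.mul_apply, hφζ, hσζ, map_pow, hσζ, hφζ]
  · rw [← finrank_mul_finrank k L E, hn, hEL]
  · intro x hx hσx
    have : IsScalarTower ℤ_[p] k E := tower_zp p
    let K := IntermediateField.fixedField (Subgroup.zpowers σ)
    have hmem : ∀ y : E, σ y = y → y ∈ K := by
      intro y hy
      rw [IntermediateField.mem_fixedField_iff]
      intro τ hτ
      have : Subgroup.zpowers σ ≤ MulAction.stabilizer (E ≃ₐ[k] E) y := by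
        rw [Subgroup.zpowers_le]; exact hy
      exact this hτ
    have := if_tower1 p K
    have := if_tower2 p K
    have : FiniteDimensional ℚ_[p] K := FiniteDimensional.left ℚ_[p] K E
    have hζK : IsPrimitiveRoot (⟨ζ, hmem ζ hσζ⟩ : K) (p ^ (m * fdeg p k) - 1) :=
      IsPrimitiveRoot.of_map_of_injective (f := algebraMap K E) hζ' (algebraMap K E).injective
    have h1 := fdeg_ge p _ hmf hζK
    have h2 : fdeg p K = m * fdeg p k := by
      refine le_antisymm ?_ h1
      rw [← hfE']
      exact Nat.le_of_dvd (fdeg_pos p) (fdeg_dvd_fdeg p K E)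
    have h3 := wv_algebraMap p (E := K) (F := E) ⟨x, hmem x hσx⟩
    have h4 : algebraMap K E ⟨x, hmem x hσx⟩ = x := rfl
    rw [h4, fix_finrank, ho] at h3
    rw [h3]
    push_cast
    refine mul_dvd_mul_left _ ?_
    have h5 := fdeg_dvd p (E := K) (x := ⟨x, hmem x hσx⟩) (fun h => hx (congrArg Subtype.val h))
    rw [h2] at h5
    exact_mod_cast h5
end Part9

section Part10
open Module
set_option linter.unusedSectionVars false
set_option linter.unusedVariables false

lemma core2 (p : ℕ) [Fact p.Prime] {k E M : Type}
    [Field k] [Algebra ℚ_[p] k] [FiniteDimensional ℚ_[p] k]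
    [Field E] [Algebra ℚ_[p] E] [FiniteDimensional ℚ_[p] E]
    [Field M] [Algebra ℚ_[p] M] [FiniteDimensional ℚ_[p] M]
    [Algebra k E] [Algebra k M] [Algebra E M] [IsScalarTower k E M]
    [IsScalarTower ℚ_[p] k E] [IsScalarTower ℚ_[p] k M] [IsScalarTower ℚ_[p] E M]
    [FiniteDimensional k E] [FiniteDimensional k M] [IsGalois k E] [IsGalois k M]
    (n m d : ℕ) (hE : finrank k E = n * m) (g : M ≃ₐ[k] M) (ho : orderOf g * d = m) (φ σ : E ≃ₐ[k] E)
    (hdist : ∀ i i' j j' t : ℕ, i < d → i' < d → j < n → j' < n →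
      φ ^ i * σ ^ j = φ ^ i' * σ ^ j' * (g.restrictNormal E) ^ t → i = i' ∧ j = j' ∧ g ^ t = 1)
    (ϖ : IntermediateField.fixedField (Subgroup.zpowers g)) (hϖ : ϖ ≠ 0) :
    ∃ x0 : E, x0 ≠ 0 ∧ wv p x0 = wv p (ϖ : M) ∧ g.restrictNormal E x0 = x0 ∧
      algebraMap k E (Algebra.norm k ϖ) =
        ∏ i ∈ Finset.range d, (φ ^ i) (∏ j ∈ Finset.range n, (σ ^ j) x0) := by
  classical
  have : FiniteDimensional E M := FiniteDimensional.right k E M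
  have : CharZero k := charZero_of_injective_algebraMap (algebraMap ℚ_[p] k).injective
  have : IsGalois E M := IsGalois.tower_top_of_isGalois k E M
  let R : (M ≃ₐ[k] M) →* (E ≃ₐ[k] E) := AlgEquiv.restrictNormalHom E
  have hR : ∀ (τ : M ≃ₐ[k] M) (x : E), algebraMap E M (R τ x) = τ (algebraMap E M x) :=
    fun τ x => AlgEquiv.restrictNormal_commutes τ E x
  have hRg : R g = g.restrictNormal E := rfl
  have hsurj : Function.Surjective R := AlgEquiv.restrictNormalHom_surjective M
  obtain ⟨φ', hφ'⟩ := hsurj φ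
  obtain ⟨σ', hσ'⟩ := hsurj σ
  set H := R.ker with hH
  have hϖ0 : (ϖ : M) ≠ 0 := fun h => hϖ (Subtype.ext h)
  have hcardH : Fintype.card H = finrank E M := by
    have h1 := Subgroup.card_mul_index H
    rw [hH, Subgroup.index_ker, MonoidHom.range_eq_top.2 hsurj, Subgroup.card_top,
      IsGalois.card_aut_eq_finrank, IsGalois.card_aut_eq_finrank, ← finrank_mul_finrank k E M] at h1
    rw [Fintype.card_eq_nat_card]
    exact Nat.eq_of_mul_eq_mul_right (finrank_pos (R := k) (M := E)) (h1.trans (mul_comm _ _))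
  set X : M := ∏ s : H, (s : M ≃ₐ[k] M) (ϖ : M) with hX
  obtain ⟨x0, hx0⟩ : ∃ x0 : E, algebraMap E M x0 = X := by
    refine (IsGalois.mem_range_algebraMap_iff_fixed (F := E) X).2 fun τ => ?_
    have hτ : τ.restrictScalars k ∈ H := by
      rw [hH, MonoidHom.mem_ker]
      ext x
      apply (algebraMap E M).injective
      rw [hR]; exact τ.commutes x
    rw [hX, map_prod]
    exact Fintype.prod_equiv (Equiv.mulLeft (⟨_, hτ⟩ : H)) _ _ (fun s => rfl)
  have hX0 : X ≠ 0 := Finset.prod_ne_zero_iff.2 fun s _ => by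
    rw [map_ne_zero_iff _ (AlgEquiv.injective _)]; exact hϖ0
  refine ⟨x0, fun h => hX0 (by rw [← hx0, h, map_zero]), ?_, ?_, ?_⟩
  · have h1 := wv_algebraMap p (E := E) (F := M) x0
    have h2 : wv p X = finrank E M * wv p (ϖ : M) := by
      have : ∀ T : Finset H, wv p (∏ s ∈ T, (s : M ≃ₐ[k] M) (ϖ : M)) = T.card * wv p (ϖ : M) := by
        intro T
        induction T using Finset.induction_on with
        | empty => simp [wv_one]
        | insert a T ha ih =>
          have hne : ∀ s : H, (s : M ≃ₐ[k] M) (ϖ : M) ≠ 0 := fun s => by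
            rw [map_ne_zero_iff _ (AlgEquiv.injective _)]; exact hϖ0
          rw [Finset.prod_insert ha, wv_mul p (hne a) (Finset.prod_ne_zero_iff.2 fun s _ => hne s), ih,
            Finset.card_insert_of_notMem ha]
          have := wv_algEquiv p ((a : M ≃ₐ[k] M).restrictScalars ℚ_[p]) (ϖ : M)
          have h3 : wv p ((a : M ≃ₐ[k] M) (ϖ : M)) = wv p (ϖ : M) := this
          rw [h3]; push_cast; ring
      have := this Finset.univ
      rwa [Finset.card_univ, hcardH] at this
    rw [hx0, h2] at h1
    have h3 : (finrank E M : ℤ) ≠ 0 := by exact_mod_cast (finrank_pos (R := E) (M := M)).ne'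
    exact (mul_left_cancel₀ h3 h1).symm
  · apply (algebraMap E M).injective
    rw [← hRg, hR, hx0, hX, map_prod]
    have hgϖ : g (ϖ : M) = ϖ :=
      (IntermediateField.mem_fixedField_iff _ _).1 ϖ.2 g (Subgroup.mem_zpowers g)
    have hHn : H.Normal := MonoidHom.normal_ker R
    refine Fintype.prod_equiv ((MulAut.conjNormal g : MulAut H).toEquiv) _ _ (fun s => ?_)
    change g ((s : M ≃ₐ[k] M) ϖ) = ((MulAut.conjNormal g s : H) : M ≃ₐ[k] M) ϖ
    rw [MulAut.conjNormal_apply, AlgEquiv.mul_apply, AlgEquiv.mul_apply]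
    congr 2
    exact ((AlgEquiv.symm_apply_eq g).2 hgϖ.symm).symm
  · let r : Fin d × Fin n × H → M →ₐ[k] M := fun t =>
      ((φ' ^ (t.1 : ℕ) * σ' ^ (t.2.1 : ℕ) * (t.2.2 : M ≃ₐ[k] M) : M ≃ₐ[k] M) : M →ₐ[k] M)
    have hr := nr r (S := IntermediateField.fixedField (Subgroup.zpowers g)) ?_ ?_ ϖ
    · apply (algebraMap E M).injective
      rw [← IsScalarTower.algebraMap_apply, hr, Fintype.prod_prod_type, Finset.prod_range, map_prod]
      refine Finset.prod_congr rfl fun i _ => ?_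
      rw [Fintype.prod_prod_type, ← hφ', ← map_pow, hR, Finset.prod_range, map_prod, map_prod]
      refine Finset.prod_congr rfl fun j _ => ?_
      rw [← hσ', ← map_pow, hR, hx0, hX, map_prod, map_prod]
      rfl
    · rw [Fintype.card_prod, Fintype.card_prod, Fintype.card_fin, Fintype.card_fin, hcardH]
      have h1 := finrank_mul_finrank k (IntermediateField.fixedField (Subgroup.zpowers g)) M
      rw [fix_finrank, ← finrank_mul_finrank k E M, hE, ← ho] at h1
      refine (Nat.eq_of_mul_eq_mul_right (orderOf_pos g) (h1.trans ?_)).symm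
      ring
    · rintro ⟨i, j, s⟩ ⟨i', j', s'⟩ h
      set A := φ' ^ (i : ℕ) * σ' ^ (j : ℕ) * (s : M ≃ₐ[k] M) with hA
      set B := φ' ^ (i' : ℕ) * σ' ^ (j' : ℕ) * (s' : M ≃ₐ[k] M) with hB
      have hAB : ∀ x : IntermediateField.fixedField (Subgroup.zpowers g), A (x : M) = B (x : M) := h
      have hmem : B⁻¹ * A ∈ Subgroup.zpowers g := by
        rw [← IntermediateField.fixingSubgroup_fixedField (Subgroup.zpowers g),
          IntermediateField.mem_fixingSubgroup_iff]
        intro x hx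
        change B.symm (A x) = x
        rw [AlgEquiv.symm_apply_eq]; exact hAB ⟨x, hx⟩
      rw [← mem_powers_iff_mem_zpowers] at hmem
      obtain ⟨t, ht⟩ := hmem
      have hA2 : A = B * g ^ t := by
        have h2 : g ^ t = B⁻¹ * A := ht
        rw [h2]; group
      have h3 := congrArg R hA2
      rw [hA, hB] at h3
      simp only [map_mul, map_pow, hφ', hσ', MonoidHom.mem_ker.1 s.2, MonoidHom.mem_ker.1 s'.2,
        mul_one, hRg] at h3
      obtain ⟨e1, e2, e3⟩ := hdist i i' j j' t i.2 i'.2 j.2 j'.2 h3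
      have e1' := Fin.ext e1
      have e2' := Fin.ext e2
      subst e1' e2'
      rw [e3, mul_one, hA, hB] at hA2
      have e4 : s = s' := Subtype.ext (mul_left_cancel hA2)
      rw [e4]

theorem core (p : ℕ) [Fact p.Prime] {k L E M : Type}
    [Field k] [Algebra ℚ_[p] k] [FiniteDimensional ℚ_[p] k] [Algebra ℤ_[p] k] [IsScalarTower ℤ_[p] ℚ_[p] k]
    [Field L] [Algebra ℚ_[p] L] [FiniteDimensional ℚ_[p] L] [Algebra ℤ_[p] L] [IsScalarTower ℤ_[p] ℚ_[p] L]
    [Field E] [Algebra ℚ_[p] E] [FiniteDimensional ℚ_[p] E] [Algebra ℤ_[p] E] [IsScalarTower ℤ_[p] ℚ_[p] E]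
    [Field M] [Algebra ℚ_[p] M] [FiniteDimensional ℚ_[p] M] [Algebra ℤ_[p] M] [IsScalarTower ℤ_[p] ℚ_[p] M]
    [Algebra k L] [Algebra k E] [Algebra L E] [IsScalarTower k L E]
    [IsScalarTower ℚ_[p] k L] [IsScalarTower ℚ_[p] k E] [IsScalarTower ℚ_[p] L E]
    [Algebra k M] [Algebra E M] [IsScalarTower k E M] [IsScalarTower ℚ_[p] k M] [IsScalarTower ℚ_[p] E M]
    [FiniteDimensional k L] [FiniteDimensional k E] [FiniteDimensional k M]
    [IsGalois k L] [IsGalois k E] [IsGalois k M]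
    (n m d : ℕ) (hn : finrank k L = n) (s0 : L ≃ₐ[k] L) (hs0 : ∀ g, g ∈ Subgroup.zpowers s0)
    (hfL : fdeg p L = fdeg p k) (hm : 0 < m) (ζ : E) (hζ : IsPrimitiveRoot ζ (resCard p k ^ m - 1))
    (hfM : fdeg p M = m * fdeg p k)
    (hgenE : ∀ τ : E ≃ₐ[k] E, (∀ x : L, τ (algebraMap L E x) = algebraMap L E x) → τ ζ = ζ → τ = 1)
    (g : M ≃ₐ[k] M) (hg : g (algebraMap E M ζ) = (algebraMap E M ζ) ^ (resCard p k ^ d)) (hd : 0 < d)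
    (hdm : d ∣ m) (hfaith : ∀ j : ℕ, (g ^ j) (algebraMap E M ζ) = algebraMap E M ζ → g ^ j = 1) :
    ∃ ϖ : IntermediateField.fixedField (Subgroup.zpowers g), ϖ ≠ 0 ∧
      ∀ (j : ℕ) (y : L), (Algebra.norm k ϖ) ^ j = Algebra.norm k y → ∀ x : L,
        (g ^ j) (algebraMap E M (algebraMap L E x)) = algebraMap E M (algebraMap L E x) := by
  have hfk := fdeg_pos p (E := k)
  have hmf : 0 < m * fdeg p k := Nat.mul_pos hm hfk
  have hq : resCard p k ^ m - 1 = p ^ (m * fdeg p k) - 1 := by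
    rw [resCard_eq_pow, ← pow_mul, mul_comm]
  have hq1 : 1 < resCard p k := by
    rw [resCard_eq_pow]; exact Nat.one_lt_pow hfk.ne' (Fact.out : p.Prime).one_lt
  have hN := not_dvd_pow_sub p hmf
  rw [← hq] at hN
  have hζM : IsPrimitiveRoot (algebraMap E M ζ) (resCard p k ^ m - 1) :=
    hζ.map_of_injective (algebraMap E M).injective
  obtain ⟨φ, σ, hφL, hφζ, hσζ, hσL, hcomm, hoσ, hfr, hfix⟩ := core1 p n m hn s0 hs0 hfL hm ζ hζ
    (hfM ▸ fdeg_dvd_fdeg p E M) hgenE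
  set G := g.restrictNormal E with hG
  have hGc : ∀ x, algebraMap E M (G x) = g (algebraMap E M x) :=
    fun x => AlgEquiv.restrictNormal_commutes g E x
  have hGζ : G ζ = ζ ^ (resCard p k ^ d) := by
    apply (algebraMap E M).injective
    rw [hGc, hg, map_pow]
  have hGcp : ∀ (j : ℕ) x, algebraMap E M ((G ^ j) x) = (g ^ j) (algebraMap E M x) := by
    intro j
    induction j with
    | zero => intro x; rfl
    | succ j ih => intro x; rw [pow_succ, AlgEquiv.mul_apply, ih, hGc, pow_succ, AlgEquiv.mul_apply]
  have hgpow : ∀ t : ℕ, (G ^ t) ζ = ζ ^ (resCard p k ^ (d * t)) := fun t => by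
    rw [frob_pow G ζ _ hGζ, ← pow_mul]
  -- g^t = 1 iff m ∣ d t
  have hg1 : ∀ t : ℕ, g ^ t = 1 ↔ m ∣ d * t := by
    intro t
    constructor
    · intro h
      have h1 : (G ^ t) ζ = ζ := by
        apply (algebraMap E M).injective
        rw [hGcp, h]; rfl
      rw [hgpow] at h1
      have h2 := qpow_inj hq1 hm hζ (d * t) 0 (by simpa using h1)
      exact (Nat.modEq_zero_iff_dvd).1 h2
    · intro h
      refine hfaith t ?_
      rw [← hGcp, hgpow, qpow_per hq1 hm hζ.pow_eq_one _ h]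
  have ho : orderOf g * d = m := by
    obtain ⟨c, rfl⟩ := hdm
    have hc : 0 < c := Nat.pos_of_mul_pos_left hm
    have : orderOf g = c := by
      refine dvd_antisymm (orderOf_dvd_of_pow_eq_one ((hg1 c).2 dvd_rfl)) ?_
      have := (hg1 (orderOf g)).1 (pow_orderOf_eq_one g)
      exact Nat.dvd_of_mul_dvd_mul_left hd this
    rw [this, mul_comm]
  have hσpL : ∀ (j : ℕ) (x : L), (σ ^ j) (algebraMap L E x) = algebraMap L E ((s0 ^ j) x) := by
    intro j
    induction j with
    | zero => intro x; rfl
    | succ j ih => intro x; rw [pow_succ, AlgEquiv.mul_apply, hσL, ih, pow_succ, AlgEquiv.mul_apply]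
  have hσpζ : ∀ j : ℕ, (σ ^ j) ζ = ζ := by
    intro j
    have := frob_pow σ ζ 1 (by rw [hσζ, pow_one]) j
    simpa using this
  have hφi : ∀ (i : ℕ) (x : L), (φ ^ i) (algebraMap L E x) = algebraMap L E x := by
    intro i x
    induction i with
    | zero => rfl
    | succ i ih => rw [pow_succ, AlgEquiv.mul_apply, hφL, ih]
  have hdist : ∀ i i' j j' t : ℕ, i < d → i' < d → j < n → j' < n →
      φ ^ i * σ ^ j = φ ^ i' * σ ^ j' * G ^ t → i = i' ∧ j = j' ∧ g ^ t = 1 := by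
    intro i i' j j' t hi hi' hj hj' h
    have h1 := DFunLike.congr_fun h ζ
    simp only [AlgEquiv.mul_apply] at h1
    rw [hgpow, map_pow, map_pow, hσpζ, hσpζ, frob_pow φ ζ _ hφζ, frob_pow φ ζ _ hφζ, ← pow_mul,
      ← pow_add] at h1
    have h2 := qpow_inj hq1 hm hζ _ _ h1
    have h3 : i ≡ i' [MOD d] := by
      have h4 := h2.of_dvd hdm
      refine h4.trans ?_
      simp [Nat.ModEq]
    have h5 : i = i' := by
      rw [Nat.ModEq, Nat.mod_eq_of_lt hi, Nat.mod_eq_of_lt hi'] at h3; exact h3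
    subst h5
    have h6 : m ∣ d * t := by
      have h7 : 0 ≡ d * t [MOD m] := Nat.ModEq.add_left_cancel' i (by simpa using h2)
      exact (Nat.modEq_zero_iff_dvd).1 h7.symm
    have h8 := (hg1 t).2 h6
    have h9 : G ^ t = 1 := by
      ext x
      apply (algebraMap E M).injective
      rw [hGcp, h8]; rfl
    rw [h9, mul_one] at h
    have h10 := mul_left_cancel h
    refine ⟨rfl, ?_, h8⟩
    exact pow_injOn_Iio_orderOf (by rw [hoσ]; exact hj) (by rw [hoσ]; exact hj') h10
  have : IsScalarTower ℤ_[p] k M := tower_zp p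
  let S := IntermediateField.fixedField (Subgroup.zpowers g)
  have := if_tower1 p S
  have := if_tower2 p S
  have : FiniteDimensional ℚ_[p] S := FiniteDimensional.left ℚ_[p] S M
  have : FiniteDimensional S M := FiniteDimensional.right k S M
  obtain ⟨ϖ, hϖ, hw⟩ := exists_unif p (E := S)
  refine ⟨ϖ, hϖ, ?_⟩
  have hwM : wv p (ϖ : M) = m * fdeg p k := by
    have h1 := wv_algebraMap p (E := S) (F := M) ϖ
    have h2 := U2 p (E := S) (M := M) hN hζM.pow_eq_one (fun τ hτ => by
      have h3 : τ.restrictScalars k ∈ Subgroup.zpowers g := by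
        rw [← IntermediateField.fixingSubgroup_fixedField (Subgroup.zpowers g),
          IntermediateField.mem_fixingSubgroup_iff]
        exact fun x hx => τ.commutes (⟨x, hx⟩ : S)
      rw [← mem_powers_iff_mem_zpowers] at h3
      obtain ⟨t, ht⟩ := h3
      have ht' : g ^ t = τ.restrictScalars k := ht
      have h4 := hfaith t (by rw [ht']; exact hτ)
      ext x
      rw [ht'] at h4
      exact DFunLike.congr_fun h4 x)
    have h3 : wv p (ϖ : M) = finrank S M * wv p ϖ := h1
    rw [h3, hw]
    rw [hfM] at h2
    exact_mod_cast h2.symm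
  obtain ⟨x0, hx0, hwx, hgx, hprod⟩ := core2 p n m d hfr g ho φ σ hdist ϖ hϖ
  intro j y hy x
  -- exponent a
  obtain ⟨a, ha⟩ : ∃ a : ℕ, s0 ^ a = G.restrictNormal L := by
    have := hs0 (G.restrictNormal L)
    rw [← mem_powers_iff_mem_zpowers] at this
    obtain ⟨a, ha⟩ := this
    exact ⟨a, ha⟩
  have hGL : ∀ x : L, G (algebraMap L E x) = algebraMap L E ((s0 ^ a) x) := fun x => by
    rw [ha]; exact (AlgEquiv.restrictNormal_commutes G L x).symm
  have hGeq : σ ^ a * φ ^ d = G := by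
    have := hgenE (G⁻¹ * (σ ^ a * φ ^ d)) (fun x => by
      change G.symm ((σ ^ a) ((φ ^ d) _)) = _
      rw [AlgEquiv.symm_apply_eq, hφi, hσpL, hGL]) (by
      change G.symm ((σ ^ a) ((φ ^ d) _)) = _
      rw [AlgEquiv.symm_apply_eq, frob_pow φ ζ _ hφζ, map_pow, hσpζ, hGζ])
    rw [inv_mul_eq_one] at this
    exact this.symm
  have hy0 : y ≠ 0 := by
    rintro rfl
    rw [Algebra.norm_zero] at hy
    rcases Nat.eq_zero_or_pos j with h | h
    · rw [h, pow_zero] at hy; exact absurd hy one_ne_zero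
    · exact hϖ (Algebra.norm_eq_zero_iff.1 ((pow_eq_zero_iff h.ne').1 hy))
  have hcl := claim_E p σ φ hcomm _ hfix n a d hoσ (x0 ^ j) (algebraMap L E y) (pow_ne_zero _ hx0)
    (by simpa using hy0) (by rw [hGeq, map_pow, hgx]) (hφL y) (by
      have h1 : ∏ j ∈ Finset.range n, (σ ^ j) (algebraMap L E y) =
          algebraMap k E (Algebra.norm k y) := by
        rw [IsScalarTower.algebraMap_apply k L E, prod_gen s0 hs0, hn, map_prod]
        exact Finset.prod_congr rfl fun i _ => hσpL i y
      rw [h1, ← hy, map_pow, hprod, ← Finset.prod_pow]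
      refine Finset.prod_congr rfl fun i _ => ?_
      rw [← map_pow, ← Finset.prod_pow]
      congr 1
      exact Finset.prod_congr rfl fun i _ => map_pow _ _ _)
  rw [wv_pow, hwx, hwM] at hcl
  have h2 : n * (m * fdeg p k) ∣ (a * j) * (m * fdeg p k) := by
    rw [mul_assoc]; exact_mod_cast hcl
  have h3 : n ∣ a * j := Nat.dvd_of_mul_dvd_mul_right hmf h2
  rw [← hGcp]
  congr 1
  have h4 : ∀ (j : ℕ) (x : L), (G ^ j) (algebraMap L E x) = algebraMap L E ((s0 ^ (a * j)) x) := by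
    intro j
    induction j with
    | zero => intro x; rfl
    | succ j ih =>
      intro x
      rw [pow_succ, AlgEquiv.mul_apply, hGL, ih, mul_add, mul_one, pow_add, AlgEquiv.mul_apply]
  rw [h4]
  have ho0 : orderOf s0 = n := by
    rw [← hn, ← IsGalois.card_aut_eq_finrank, orderOf_eq_card_of_forall_mem_zpowers hs0]
  have : s0 ^ (a * j) = 1 := orderOf_dvd_iff_pow_eq_one.1 (by rw [ho0]; exact h3)
  rw [this]; rfl
end Part10

section Part11
open Module
set_option linter.unusedSectionVars false
set_option linter.unusedVariables false

lemma adj_normal (p : ℕ) [Fact p.Prime] {k L M : Type}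
    [Field k] [Field L] [Field M] [Algebra k L] [Algebra k M] [Algebra L M] [IsScalarTower k L M]
    [IsGalois k L] [IsGalois k M] (ζ : M)
    (h : ∀ σ : M ≃ₐ[k] M, ∃ i : ℕ, σ ζ = ζ ^ i) : IsGalois k (IntermediateField.adjoin L {ζ}) := by
  have h1 : Normal k ((IntermediateField.adjoin L {ζ}).restrictScalars k) := by
    rw [IntermediateField.normal_iff_forall_map_le']
    rintro σ _ ⟨x, hx, rfl⟩
    have hx' : x ∈ IntermediateField.adjoin L {ζ} := hx
    change σ x ∈ IntermediateField.adjoin L {ζ}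
    clear hx
    induction hx' using IntermediateField.adjoin_induction with
    | mem x hx =>
      rw [Set.mem_singleton_iff.1 hx]
      obtain ⟨i, hi⟩ := h σ
      rw [hi]
      exact pow_mem (IntermediateField.mem_adjoin_simple_self L ζ) i
    | algebraMap x =>
      rw [← AlgEquiv.restrictNormal_commutes σ L x]
      exact IntermediateField.algebraMap_mem _ _
    | add x y hx hy h1 h2 => rw [map_add]; exact add_mem h1 h2
    | inv x hx h1 => rw [map_inv₀]; exact inv_mem h1
    | mul x y hx hy h1 h2 => rw [map_mul]; exact mul_mem h1 h2
  have h2 : Normal k (IntermediateField.adjoin L {ζ}) := h1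
  have h3 : Algebra.IsSeparable k ((IntermediateField.adjoin L {ζ}).restrictScalars k) := inferInstance
  have h4 : Algebra.IsSeparable k (IntermediateField.adjoin L {ζ}) := h3
  exact ⟨⟩

/-- the extension generated by a root of unity of order prime to `p` -/
lemma unr_ext (p : ℕ) [Fact p.Prime] {L M : Type}
    [Field L] [Algebra ℚ_[p] L] [FiniteDimensional ℚ_[p] L] [Algebra ℤ_[p] L] [IsScalarTower ℤ_[p] ℚ_[p] L]
    [Field M] [Algebra ℚ_[p] M] [FiniteDimensional ℚ_[p] M] [Algebra ℤ_[p] M] [IsScalarTower ℤ_[p] ℚ_[p] M]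
    [Algebra L M] [IsScalarTower ℚ_[p] L M] [FiniteDimensional L M] [IsGalois L M]
    (s : ℕ) (hs : 0 < s) (ζ : M) (hζ : IsPrimitiveRoot ζ (resCard p L ^ s - 1))
    (hM : ∀ τ : M ≃ₐ[L] M, τ ζ = ζ → τ = 1) :
    fdeg p M = s * fdeg p L ∧ finrank L M = s ∧ ∃ h : M ≃ₐ[L] M, h ζ = ζ ^ resCard p L ∧
      ∀ g, g ∈ Subgroup.zpowers h := by
  have hfk := fdeg_pos p (E := L)
  have hmf : 0 < s * fdeg p L := Nat.mul_pos hs hfk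
  have hq : resCard p L ^ s - 1 = p ^ (s * fdeg p L) - 1 := by
    rw [resCard_eq_pow, ← pow_mul, mul_comm]
  have hq1 : 1 < resCard p L := by
    rw [resCard_eq_pow]; exact Nat.one_lt_pow hfk.ne' (Fact.out : p.Prime).one_lt
  have hN := not_dvd_pow_sub p hmf
  have h1 := fdeg_ge p _ hmf (hq ▸ hζ)
  rw [← hq] at hN
  have h2 := U2 p (E := L) (M := M) hN hζ.pow_eq_one hM
  obtain ⟨h, hh⟩ := U3 p (E := L) (M := M)
  have hh := hh _ hN ζ hζ.pow_eq_one
  have hgen : ∀ g, g ∈ Subgroup.zpowers h := by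
    intro g
    obtain ⟨i, -, hi⟩ := U1 p (E := L) g
    have hi := hi _ hN ζ hζ.pow_eq_one
    have : g = h ^ i := by
      have := hM ((h ^ i)⁻¹ * g) (by
        change (h ^ i).symm (g ζ) = ζ
        rw [hi, AlgEquiv.symm_apply_eq, frob_pow h ζ _ hh])
      rwa [inv_mul_eq_one, eq_comm] at this
    rw [this]
    exact Subgroup.npow_mem_zpowers h i
  have h3 : h ^ s = 1 := hM _ (by
    rw [frob_pow h ζ _ hh, qpow_per hq1 hs hζ.pow_eq_one s dvd_rfl])
  have h4 : finrank L M ≤ s := by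
    rw [← IsGalois.card_aut_eq_finrank, ← orderOf_eq_card_of_forall_mem_zpowers hgen]
    exact orderOf_le_of_pow_eq_one hs h3
  have h5 : finrank L M = s := by
    refine le_antisymm h4 ?_
    rw [h2] at h1
    exact Nat.le_of_mul_le_mul_right h1 hfk
  exact ⟨by rw [h2, h5], h5, h, hh, hgen⟩
end Part11

section Part12
open Module
set_option linter.unusedSectionVars false
set_option linter.unusedVariables false

theorem core3 (p : ℕ) [Fact p.Prime] {k L k' L' M : Type}
    [Field k] [Algebra ℚ_[p] k] [FiniteDimensional ℚ_[p] k] [Algebra ℤ_[p] k] [IsScalarTower ℤ_[p] ℚ_[p] k]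
    [Field L] [Algebra ℚ_[p] L] [FiniteDimensional ℚ_[p] L] [Algebra ℤ_[p] L] [IsScalarTower ℤ_[p] ℚ_[p] L]
    [Field k'] [Algebra ℚ_[p] k'] [FiniteDimensional ℚ_[p] k'] [Algebra ℤ_[p] k'] [IsScalarTower ℤ_[p] ℚ_[p] k']
    [Field L'] [Algebra ℚ_[p] L'] [FiniteDimensional ℚ_[p] L'] [Algebra ℤ_[p] L'] [IsScalarTower ℤ_[p] ℚ_[p] L']
    [Field M] [Algebra ℚ_[p] M] [FiniteDimensional ℚ_[p] M] [Algebra ℤ_[p] M] [IsScalarTower ℤ_[p] ℚ_[p] M]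
    [Algebra k L] [Algebra k k'] [Algebra k L'] [Algebra L L'] [Algebra k' L']
    [Algebra k M] [Algebra L M] [Algebra k' M] [Algebra L' M]
    [IsScalarTower k L L'] [IsScalarTower k k' L'] [IsScalarTower k L' M] [IsScalarTower L L' M]
    [IsScalarTower k' L' M] [IsScalarTower k L M] [IsScalarTower k k' M]
    [IsScalarTower ℚ_[p] k L] [IsScalarTower ℚ_[p] k k'] [IsScalarTower ℚ_[p] k L']
    [IsScalarTower ℚ_[p] L L'] [IsScalarTower ℚ_[p] k' L']
    [IsScalarTower ℚ_[p] k M] [IsScalarTower ℚ_[p] L M] [IsScalarTower ℚ_[p] k' M] [IsScalarTower ℚ_[p] L' M]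
    [IsGalois k L] [IsGalois k L'] [IsGalois k' L'] [IsGalois k M]
    (n m F : ℕ) (hn : finrank k L = n) (s0 : L ≃ₐ[k] L) (hs0 : ∀ g, g ∈ Subgroup.zpowers s0)
    (hfL : fdeg p L = fdeg p k) (hm : 0 < m) (hF : fdeg p L' = fdeg p k * F)
    (hmd : ∀ d, 0 < d → d ≤ F → d * n ∣ m)
    (t : L' ≃ₐ[k'] L')
    (hgen : ∀ τ : L' ≃ₐ[k'] L', (∀ x : L, τ (algebraMap L L' x) = algebraMap L L' x) → τ = 1)
    (ζ : M) (hζ : IsPrimitiveRoot ζ (resCard p k ^ m - 1))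
    (hM : ∀ τ : M ≃ₐ[L'] M, τ ζ = ζ → τ = 1) :
    ∃ γ : k', γ ≠ 0 ∧ ∀ (j : ℕ) (y : L), (Algebra.norm k γ) ^ j = Algebra.norm k y → t ^ j = 1 := by
  have hfk := fdeg_pos p (E := k)
  have hmf : 0 < m * fdeg p k := Nat.mul_pos hm hfk
  have hq : resCard p k ^ m - 1 = p ^ (m * fdeg p k) - 1 := by
    rw [resCard_eq_pow, ← pow_mul, mul_comm]
  have hq1 : 1 < resCard p k := by
    rw [resCard_eq_pow]; exact Nat.one_lt_pow hfk.ne' (Fact.out : p.Prime).one_lt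
  have hN := not_dvd_pow_sub p hmf
  rw [← hq] at hN
  have hF0 : 0 < F := by
    have := fdeg_pos p (E := L'); rw [hF] at this; exact Nat.pos_of_mul_pos_left this
  have hFm : F ∣ m := (Dvd.intro _ rfl).trans (hmd F hF0 le_rfl)
  have hqF : resCard p L' = resCard p k ^ F := (resCard_pow_iff p F).2 hF
  have : FiniteDimensional k L := FiniteDimensional.right ℚ_[p] k L
  have : FiniteDimensional k k' := FiniteDimensional.right ℚ_[p] k k'
  have : FiniteDimensional k L' := FiniteDimensional.right ℚ_[p] k L'
  have : FiniteDimensional k M := FiniteDimensional.right ℚ_[p] k M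
  have : FiniteDimensional k' M := FiniteDimensional.right ℚ_[p] k' M
  have : FiniteDimensional L M := FiniteDimensional.right ℚ_[p] L M
  have : FiniteDimensional L' M := FiniteDimensional.right ℚ_[p] L' M
  have : IsGalois L' M := IsGalois.tower_top_of_isGalois k L' M
  have : IsGalois k' M := IsGalois.tower_top_of_isGalois k k' M
  obtain ⟨hfM, h, hh⟩ : fdeg p M = m * fdeg p k ∧ ∃ h : M ≃ₐ[L'] M, h ζ = ζ ^ (resCard p k ^ F) := by
    obtain ⟨c, hc⟩ := hFm
    have hc0 : 0 < c := by rw [hc] at hm; exact Nat.pos_of_mul_pos_left hm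
    obtain ⟨h1, -, h, hh, -⟩ := unr_ext p (L := L') (M := M) c hc0 ζ
      (by rw [hqF, ← pow_mul, ← hc]; exact hζ) hM
    refine ⟨?_, h, by rw [hh, hqF]⟩
    rw [h1, hF, hc]; ring
  obtain ⟨g0, hg0⟩ := AlgEquiv.restrictNormalHom_surjective (F := k') (K₁ := L') M t
  have hg0L : ∀ x : L', g0 (algebraMap L' M x) = algebraMap L' M (t x) := by
    intro x; rw [← hg0]; exact (AlgEquiv.restrictNormal_commutes g0 L' x).symm
  obtain ⟨i, -, hi⟩ := U1 p (E := k) (g0.restrictScalars k)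
  have hi : g0 ζ = _ := hi _ hN ζ hζ.pow_eq_one
  -- choose d
  obtain ⟨d, c, hd, hdF, hdc⟩ : ∃ d c, 0 < d ∧ d ≤ F ∧ i + m = F * c + d := by
    refine ⟨(i + m - 1) % F + 1, (i + m - 1) / F, Nat.succ_pos _, Nat.mod_lt _ hF0, ?_⟩
    have := Nat.div_add_mod (i + m - 1) F
    omega
  have hi2 : g0 ζ = ζ ^ (resCard p k ^ (F * c + d)) := by
    rw [hi, ← hdc, pow_add, mul_comm, pow_mul, qpow_per hq1 hm hζ.pow_eq_one m dvd_rfl]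
  let g' : M ≃ₐ[k'] M := ((h ^ c).restrictScalars k')⁻¹ * g0
  have hg'ζ : g' ζ = ζ ^ (resCard p k ^ d) := by
    change (h ^ c).symm (g0 ζ) = _
    rw [hi2, AlgEquiv.symm_apply_eq, map_pow, frob_pow h ζ _ hh, ← pow_mul, ← pow_mul, ← pow_add]
  have hg'L : ∀ x : L', g' (algebraMap L' M x) = algebraMap L' M (t x) := by
    intro x
    change (h ^ c).symm (g0 _) = _
    rw [hg0L, AlgEquiv.symm_apply_eq, AlgEquiv.commutes]
  clear_value g'
  have hg'pL : ∀ (j : ℕ) (x : L'), (g' ^ j) (algebraMap L' M x) = algebraMap L' M ((t ^ j) x) := by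
    intro j
    induction j with
    | zero => intro x; rfl
    | succ j ih => intro x; rw [pow_succ, AlgEquiv.mul_apply, hg'L, ih, pow_succ, AlgEquiv.mul_apply]
  let g : M ≃ₐ[k] M := g'.restrictScalars k
  have hgg : ∀ (j : ℕ) (x : M), (g ^ j) x = (g' ^ j) x := by
    intro j
    induction j with
    | zero => intro x; rfl
    | succ j ih => intro x; rw [pow_succ, AlgEquiv.mul_apply, ih, pow_succ, AlgEquiv.mul_apply]; rfl
  have hgg1 : ∀ x, g x = g' x := fun x => rfl
  have hfix : ∀ j : ℕ, (∀ x : L, (g ^ j) (algebraMap L M x) = algebraMap L M x) → t ^ j = 1 := by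
    intro j hj
    refine hgen _ fun x => ?_
    apply (algebraMap L' M).injective
    rw [← hg'pL, ← hgg, ← IsScalarTower.algebraMap_apply L L' M, hj]
  clear_value g
  have hdn := hmd d hd hdF
  have hdm : d ∣ m := (Dvd.intro _ rfl).trans hdn
  have hfaith : ∀ j : ℕ, (g ^ j) ζ = ζ → g ^ j = 1 := by
    intro j hj
    rw [frob_pow g ζ _ (by rw [hgg1, hg'ζ]), ← pow_mul] at hj
    have h1 := qpow_inj hq1 hm hζ (d * j) 0 (by rw [hj]; simp)
    have h2 : d * n ∣ d * j := hdn.trans ((Nat.modEq_zero_iff_dvd).1 h1)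
    have h3 : n ∣ j := Nat.dvd_of_mul_dvd_mul_left hd h2
    have h4 : (g.restrictNormal L) ^ j = 1 := by
      apply orderOf_dvd_iff_pow_eq_one.1
      refine dvd_trans ?_ h3
      rw [← hn, ← IsGalois.card_aut_eq_finrank k L]
      exact orderOf_dvd_natCard _
    have h5 : ∀ x : L, (g ^ j) (algebraMap L M x) = algebraMap L M x := by
      intro x
      have h6 : (AlgEquiv.restrictNormalHom L (g ^ j)) = 1 := by rw [map_pow]; exact h4
      have h7 := AlgEquiv.restrictNormal_commutes (g ^ j) L x
      rw [← h7]
      exact congrArg _ (DFunLike.congr_fun h6 x)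
    have h8 := hfix j h5
    have h9 := hM (AlgEquiv.ofRingEquiv (f := ((g' ^ j : M ≃ₐ[k'] M) : M ≃+* M)) (fun x => by
      change (g' ^ j) _ = _
      rw [hg'pL, h8]; rfl)) (by
      change (g' ^ j) ζ = ζ
      rw [frob_pow g' ζ _ hg'ζ, ← pow_mul]; exact hj)
    ext x
    rw [hgg]
    exact DFunLike.congr_fun h9 x
  -- the field E
  have hGalE : IsGalois k (IntermediateField.adjoin L {ζ}) := adj_normal p ζ (fun σ => by
    obtain ⟨i, -, hi⟩ := U1 p (E := k) σ
    exact ⟨_, hi _ hN ζ hζ.pow_eq_one⟩)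
  have : IsScalarTower ℤ_[p] L M := tower_zp p
  have : IsScalarTower ℤ_[p] k M := tower_zp p
  have : IsScalarTower ℤ_[p] k' M := tower_zp p
  let E := IntermediateField.adjoin L {ζ}
  have := if_tower1 p E
  have := if_tower2 p E
  have := if_tower3 p E
  have : IsScalarTower ℚ_[p] k E := IsScalarTower.of_algebraMap_eq fun x =>
    Subtype.ext (IsScalarTower.algebraMap_apply ℚ_[p] k M x)
  have : IsScalarTower k E M := IsScalarTower.of_algebraMap_eq fun x => rfl
  have : FiniteDimensional ℚ_[p] E := FiniteDimensional.left ℚ_[p] E M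
  have : FiniteDimensional k E := FiniteDimensional.left k E M
  let ζE : E := ⟨ζ, IntermediateField.mem_adjoin_simple_self L ζ⟩
  have hζE : IsPrimitiveRoot ζE (resCard p k ^ m - 1) :=
    IsPrimitiveRoot.of_map_of_injective (f := algebraMap E M) hζ (algebraMap E M).injective
  obtain ⟨ϖ, hϖ, hfin⟩ := core p (k := k) (L := L) (E := E) (M := M) n m d hn s0 hs0 hfL hm ζE hζE hfM
    (fun τ h1 h2 => by
      have h3 : (AlgEquiv.ofRingEquiv (f := (τ : E ≃+* E)) h1 : E ≃ₐ[L] E).toAlgHom = AlgHom.id L E := by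
        refine IntermediateField.algHom_ext_of_eq_adjoin L (S := E) rfl fun x hx => ?_
        have : x = ζ := hx
        subst this
        exact h2
      ext x
      exact congrArg _ (DFunLike.congr_fun h3 x))
    g (by change g ζ = ζ ^ _; rw [hgg1, hg'ζ]) hd hdm hfaith
  let S' := IntermediateField.fixedField (Subgroup.zpowers g')
  let S := IntermediateField.fixedField (Subgroup.zpowers g)
  have hmem : ∀ y : M, y ∈ S ↔ g y = y := by
    intro y
    rw [IntermediateField.mem_fixedField_iff]
    refine ⟨fun h => h g (Subgroup.mem_zpowers g), fun hy τ hτ => ?_⟩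
    have : Subgroup.zpowers g ≤ MulAction.stabilizer (M ≃ₐ[k] M) y := by
      rw [Subgroup.zpowers_le]; exact hy
    exact this hτ
  have hmem' : ∀ y : M, y ∈ S' ↔ g' y = y := by
    intro y
    rw [IntermediateField.mem_fixedField_iff]
    refine ⟨fun h => h g' (Subgroup.mem_zpowers g'), fun hy τ hτ => ?_⟩
    have : Subgroup.zpowers g' ≤ MulAction.stabilizer (M ≃ₐ[k'] M) y := by
      rw [Subgroup.zpowers_le]; exact hy
    exact this hτ
  let e : S ≃ₐ[k] S' :=
    { toFun := fun x => ⟨x.1, (hmem' _).2 ((hgg1 x.1).symm.trans ((hmem _).1 x.2))⟩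
      invFun := fun x => ⟨x.1, (hmem _).2 ((hgg1 x.1).trans ((hmem' _).1 x.2))⟩
      left_inv := fun x => rfl
      right_inv := fun x => rfl
      map_mul' := fun x y => rfl
      map_add' := fun x y => rfl
      commutes' := fun x => Subtype.ext (by rfl) }
  have : FiniteDimensional k' S' := FiniteDimensional.left k' S' M
  have hnn : Algebra.norm k (Algebra.norm k' (e ϖ)) = Algebra.norm k ϖ := by
    rw [Algebra.norm_norm, Algebra.norm_eq_of_algEquiv]
  refine ⟨Algebra.norm k' (e ϖ), ?_, ?_⟩
  · rw [Ne, Algebra.norm_eq_zero_iff]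
    simpa using hϖ
  · intro j y hy
    rw [hnn] at hy
    exact hfix j (fun x => hfin j y hy x)
end Part12

section Part13
open Module
set_option linter.unusedSectionVars false
set_option linter.unusedVariables false

lemma exists_gamma (p : ℕ) [Fact p.Prime] {k L k' L' : Type}
    [Field k] [Algebra ℚ_[p] k] [FiniteDimensional ℚ_[p] k] [Algebra ℤ_[p] k] [IsScalarTower ℤ_[p] ℚ_[p] k]
    [Field L] [Algebra ℚ_[p] L] [FiniteDimensional ℚ_[p] L] [Algebra ℤ_[p] L] [IsScalarTower ℤ_[p] ℚ_[p] L]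
    [Field k'] [Algebra ℚ_[p] k'] [FiniteDimensional ℚ_[p] k'] [Algebra ℤ_[p] k'] [IsScalarTower ℤ_[p] ℚ_[p] k']
    [Field L'] [Algebra ℚ_[p] L'] [FiniteDimensional ℚ_[p] L'] [Algebra ℤ_[p] L'] [IsScalarTower ℤ_[p] ℚ_[p] L']
    [Algebra k L] [Algebra k k'] [Algebra k L'] [Algebra L L'] [Algebra k' L']
    [IsScalarTower k L L'] [IsScalarTower k k' L']
    [IsScalarTower ℚ_[p] k L] [IsScalarTower ℚ_[p] k k'] [IsScalarTower ℚ_[p] k L']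
    [IsScalarTower ℚ_[p] L L'] [IsScalarTower ℚ_[p] k' L']
    [IsGalois k L] [IsGalois k L'] [IsGalois k' L']
    (s0 : L ≃ₐ[k] L) (hs0 : ∀ g, g ∈ Subgroup.zpowers s0)
    (hfL : fdeg p L = fdeg p k)
    (t : L' ≃ₐ[k'] L')
    (hgen : ∀ τ : L' ≃ₐ[k'] L', (∀ x : L, τ (algebraMap L L' x) = algebraMap L L' x) → τ = 1) :
    ∃ γ : k', γ ≠ 0 ∧ ∀ (j : ℕ) (y : L), (Algebra.norm k γ) ^ j = Algebra.norm k y → t ^ j = 1 := by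
  have hfk := fdeg_pos p (E := k)
  have : FiniteDimensional k L := FiniteDimensional.right ℚ_[p] k L
  have : FiniteDimensional k L' := FiniteDimensional.right ℚ_[p] k L'
  have hn : 0 < finrank k L := finrank_pos
  have : IsScalarTower ℚ_[p] k L' := inferInstance
  obtain ⟨F, hF⟩ := fdeg_dvd_fdeg p k L'
  let m := F.factorial * finrank k L
  have hm : 0 < m := Nat.mul_pos (Nat.factorial_pos _) hn
  have hmd : ∀ d, 0 < d → d ≤ F → d * finrank k L ∣ m := fun d h1 h2 =>
    Nat.mul_dvd_mul_right (Nat.dvd_factorial h1 h2) _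
  clear_value m
  have hq1 : 1 < resCard p k := by
    rw [resCard_eq_pow]; exact Nat.one_lt_pow hfk.ne' (Fact.out : p.Prime).one_lt
  have hN0 : 0 < resCard p k ^ m - 1 := by
    have := Nat.one_lt_pow hm.ne' hq1
    omega
  have : CharZero L' := charZero_of_injective_algebraMap (algebraMap ℚ_[p] L').injective
  have : CharZero k := charZero_of_injective_algebraMap (algebraMap ℚ_[p] k).injective
  have : CharZero (AlgebraicClosure L') :=
    charZero_of_injective_algebraMap (algebraMap L' (AlgebraicClosure L')).injective
  let N := resCard p k ^ m - 1
  have : NeZero N := ⟨hN0.ne'⟩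
  obtain ⟨ζ, hζ⟩ : ∃ ζ : AlgebraicClosure L', IsPrimitiveRoot ζ N :=
    HasEnoughRootsOfUnity.exists_primitiveRoot _ _
  have : Algebra.IsAlgebraic k (AlgebraicClosure L') := Algebra.IsAlgebraic.trans k L' _
  have : IsAlgClosure k (AlgebraicClosure L') := ⟨inferInstance, inferInstance⟩
  have : Normal k (AlgebraicClosure L') := IsAlgClosure.normal _ _
  have : IsGalois k (AlgebraicClosure L') := ⟨⟩
  have hgal := adj_normal p (k := k) (L := L') ζ (fun σ => by
    have : (σ ζ) ^ N = 1 := by rw [← map_pow, hζ.pow_eq_one, map_one]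
    obtain ⟨i, -, hi⟩ := hζ.eq_pow_of_pow_eq_one this
    exact ⟨i, hi.symm⟩)
  let M := IntermediateField.adjoin L' {ζ}
  have : FiniteDimensional L' M := IntermediateField.adjoin.finiteDimensional
    (Algebra.IsIntegral.isIntegral ζ)
  have : IsScalarTower ℤ_[p] L' (AlgebraicClosure L') := inferInstance
  have : IsScalarTower k L' M := IsScalarTower.of_algebraMap_eq fun x => rfl
  have : IsScalarTower k' L' M := IsScalarTower.of_algebraMap_eq fun x => rfl
  have : IsScalarTower L L' M := IsScalarTower.of_algebraMap_eq fun x => rfl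
  have : IsScalarTower ℚ_[p] L' M := IsScalarTower.of_algebraMap_eq fun x => rfl
  have : IsScalarTower ℤ_[p] L' M := IsScalarTower.of_algebraMap_eq fun x => rfl
  have : FiniteDimensional ℚ_[p] M := FiniteDimensional.trans ℚ_[p] L' M
  have : IsScalarTower k L M := IsScalarTower.of_algebraMap_eq fun x => by
    rw [IsScalarTower.algebraMap_apply k L' M, IsScalarTower.algebraMap_apply L L' M,
      IsScalarTower.algebraMap_apply k L L']
  have : IsScalarTower k k' M := IsScalarTower.of_algebraMap_eq fun x => by
    rw [IsScalarTower.algebraMap_apply k L' M, IsScalarTower.algebraMap_apply k' L' M,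
      IsScalarTower.algebraMap_apply k k' L']
  have : IsScalarTower ℚ_[p] k M := IsScalarTower.of_algebraMap_eq fun x => by
    rw [IsScalarTower.algebraMap_apply k L' M, IsScalarTower.algebraMap_apply ℚ_[p] L' M,
      IsScalarTower.algebraMap_apply ℚ_[p] k L']
  have : IsScalarTower ℚ_[p] k' M := IsScalarTower.of_algebraMap_eq fun x => by
    rw [IsScalarTower.algebraMap_apply k' L' M, IsScalarTower.algebraMap_apply ℚ_[p] L' M,
      IsScalarTower.algebraMap_apply ℚ_[p] k' L']
  have : IsScalarTower ℚ_[p] L M := IsScalarTower.of_algebraMap_eq fun x => by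
    rw [IsScalarTower.algebraMap_apply L L' M, IsScalarTower.algebraMap_apply ℚ_[p] L' M,
      IsScalarTower.algebraMap_apply ℚ_[p] L L']
  have : IsScalarTower ℤ_[p] ℚ_[p] M := IsScalarTower.of_algebraMap_eq fun x => by
    rw [IsScalarTower.algebraMap_apply ℤ_[p] L' M, IsScalarTower.algebraMap_apply ℚ_[p] L' M,
      IsScalarTower.algebraMap_apply ℤ_[p] ℚ_[p] L']
  let ζM : M := ⟨ζ, IntermediateField.mem_adjoin_simple_self L' ζ⟩
  have hζM : IsPrimitiveRoot ζM N :=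
    IsPrimitiveRoot.of_map_of_injective (f := algebraMap M (AlgebraicClosure L')) hζ
      (algebraMap M (AlgebraicClosure L')).injective
  exact core3 p (M := M) (finrank k L) m F rfl s0 hs0 hfL hm hF hmd t hgen ζM hζM (fun τ h2 => by
      have h3 : τ.toAlgHom = AlgHom.id L' M := by
        refine IntermediateField.algHom_ext_of_eq_adjoin L' (S := M) rfl fun x hx => ?_
        have : x = ζ := hx
        subst this
        exact h2
      ext x
      exact congrArg _ (DFunLike.congr_fun h3 x))

theorem normLift (p : ℕ) [Fact p.Prime] {k L k' L' : Type}
    [Field k] [Algebra ℚ_[p] k] [FiniteDimensional ℚ_[p] k] [Algebra ℤ_[p] k] [IsScalarTower ℤ_[p] ℚ_[p] k]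
    [Field L] [Algebra ℚ_[p] L] [FiniteDimensional ℚ_[p] L] [Algebra ℤ_[p] L] [IsScalarTower ℤ_[p] ℚ_[p] L]
    [Field k'] [Algebra ℚ_[p] k'] [FiniteDimensional ℚ_[p] k'] [Algebra ℤ_[p] k'] [IsScalarTower ℤ_[p] ℚ_[p] k']
    [Field L'] [Algebra ℚ_[p] L'] [FiniteDimensional ℚ_[p] L'] [Algebra ℤ_[p] L'] [IsScalarTower ℤ_[p] ℚ_[p] L']
    [Algebra k L] [Algebra k k'] [Algebra k L'] [Algebra L L'] [Algebra k' L']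
    [IsScalarTower k L L'] [IsScalarTower k k' L']
    [IsScalarTower ℚ_[p] k L] [IsScalarTower ℚ_[p] k k'] [IsScalarTower ℚ_[p] k L']
    [IsScalarTower ℚ_[p] L L'] [IsScalarTower ℚ_[p] k' L']
    [IsGalois k L] [IsGalois k L'] [IsGalois k' L']
    (s0 : L ≃ₐ[k] L) (hs0 : ∀ g, g ∈ Subgroup.zpowers s0)
    (hfL : fdeg p L = fdeg p k)
    (t : L' ≃ₐ[k'] L') (ht : ∀ g, g ∈ Subgroup.zpowers t)
    (hgen : ∀ τ : L' ≃ₐ[k'] L', (∀ x : L, τ (algebraMap L L' x) = algebraMap L L' x) → τ = 1)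
    (x : k') (hx : x ≠ 0) (y : L) (hxy : Algebra.norm k x = Algebra.norm k y) :
    ∃ z : L', Algebra.norm k' z = x := by
  obtain ⟨γ, hγ, hj⟩ := exists_gamma p s0 hs0 hfL t hgen
  have : FiniteDimensional k' L' := FiniteDimensional.right ℚ_[p] k' L'
  have : FiniteDimensional k L := FiniteDimensional.right ℚ_[p] k L
  have : FiniteDimensional k k' := FiniteDimensional.right ℚ_[p] k k'
  have : FiniteDimensional k L' := FiniteDimensional.right ℚ_[p] k L'
  have : FiniteDimensional L L' := FiniteDimensional.right ℚ_[p] L L'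
  have : CharZero k := charZero_of_injective_algebraMap (algebraMap ℚ_[p] k).injective
  obtain ⟨h0, h1⟩ := norm_index p t ht
  have hsub := sub_crit (nmU k' L').range ((nmU k L).range.comap (nmU k k')) _ h0 h1 ?_
    (Units.mk0 γ hγ) ?_
  · have hxW : Units.mk0 x hx ∈ (nmU k L).range.comap (nmU k k') := by
      have hy : y ≠ 0 := by
        rintro rfl
        rw [Algebra.norm_zero, Algebra.norm_eq_zero_iff] at hxy
        exact hx hxy
      exact ⟨Units.mk0 y hy, Units.ext hxy.symm⟩
    obtain ⟨z, hz⟩ := hsub hxW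
    exact ⟨z, congrArg Units.val hz⟩
  · rintro _ ⟨z, rfl⟩
    refine ⟨nmU L L' z, Units.ext ?_⟩
    change Algebra.norm k (Algebra.norm L (z : L')) = Algebra.norm k (Algebra.norm k' (z : L'))
    rw [Algebra.norm_norm, Algebra.norm_norm]
  · rintro j ⟨y, hy⟩
    have hy' : Algebra.norm k (y : L) = (Algebra.norm k γ) ^ j := by
      have := congrArg Units.val hy
      rw [← map_pow]
      exact this
    have := hj j y hy'.symm
    rw [← IsGalois.card_aut_eq_finrank, ← orderOf_eq_card_of_forall_mem_zpowers ht]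
    exact orderOf_dvd_of_pow_eq_one this
end Part13

section Part14
open Module
set_option linter.unusedSectionVars false
set_option linter.unusedVariables false

lemma adj_normal2 {k L M : Type}
    [Field k] [Field L] [Field M] [Algebra k L] [Algebra k M] [Algebra L M] [IsScalarTower k L M]
    [IsGalois k L] [IsGalois k M] (ζ : M)
    (h : ∀ σ : M ≃ₐ[k] M, σ ζ ∈ IntermediateField.adjoin L {ζ}) :
    IsGalois k (IntermediateField.adjoin L {ζ}) := by
  have h1 : Normal k ((IntermediateField.adjoin L {ζ}).restrictScalars k) := by
    rw [IntermediateField.normal_iff_forall_map_le']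
    rintro σ _ ⟨x, hx, rfl⟩
    have hx' : x ∈ IntermediateField.adjoin L {ζ} := hx
    change σ x ∈ IntermediateField.adjoin L {ζ}
    clear hx
    induction hx' using IntermediateField.adjoin_induction with
    | mem x hx =>
      rw [Set.mem_singleton_iff.1 hx]
      exact h σ
    | algebraMap x =>
      rw [← AlgEquiv.restrictNormal_commutes σ L x]
      exact IntermediateField.algebraMap_mem _ _
    | add x y hx hy h1 h2 => rw [map_add]; exact add_mem h1 h2
    | inv x hx h1 => rw [map_inv₀]; exact inv_mem h1
    | mul x y hx hy h1 h2 => rw [map_mul]; exact mul_mem h1 h2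
  have h2 : Normal k (IntermediateField.adjoin L {ζ}) := h1
  have h3 : Algebra.IsSeparable k ((IntermediateField.adjoin L {ζ}).restrictScalars k) := inferInstance
  have h4 : Algebra.IsSeparable k (IntermediateField.adjoin L {ζ}) := h3
  exact ⟨⟩

theorem lift_cyc (p : ℕ) [Fact p.Prime] {k k' Ω : Type}
    [Field k] [Algebra ℚ_[p] k] [FiniteDimensional ℚ_[p] k] [Algebra ℤ_[p] k] [IsScalarTower ℤ_[p] ℚ_[p] k]
    [Field k'] [Algebra ℚ_[p] k'] [FiniteDimensional ℚ_[p] k'] [Algebra ℤ_[p] k'] [IsScalarTower ℤ_[p] ℚ_[p] k']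
    [Field Ω] [Algebra ℚ_[p] Ω] [Algebra ℤ_[p] Ω] [IsScalarTower ℤ_[p] ℚ_[p] Ω]
    [Algebra k k'] [Algebra k Ω] [Algebra k' Ω] [IsScalarTower k k' Ω]
    [IsScalarTower ℚ_[p] k k'] [IsScalarTower ℚ_[p] k Ω] [IsScalarTower ℚ_[p] k' Ω]
    [IsScalarTower ℤ_[p] k Ω] [IsScalarTower ℤ_[p] k' Ω]
    [IsGalois k Ω] [IsGalois k k']
    (L : IntermediateField k Ω) [FiniteDimensional k L] [IsGalois k L] [IsCyclic (L ≃ₐ[k] L)]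
    [FiniteDimensional ℚ_[p] L] [IsScalarTower ℤ_[p] ℚ_[p] L]
    (hfL : fdeg p L = fdeg p k)
    (x : k') (hx : x ≠ 0) (y : L) (hxy : Algebra.norm k x = Algebra.norm k y) :
    (L : Set Ω) ⊆ (lubinTateExt k' Ω x : Set Ω) := by
  have : CharZero k := charZero_of_injective_algebraMap (algebraMap ℚ_[p] k).injective
  have : FiniteDimensional k k' := FiniteDimensional.right ℚ_[p] k k'
  obtain ⟨a, ha⟩ := Field.exists_primitive_element k L
  let L' := IntermediateField.adjoin k' {(a : Ω)}
  have hLa : L = IntermediateField.adjoin k {(a : Ω)} := by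
    have := congrArg IntermediateField.lift ha
    rw [IntermediateField.lift_top, IntermediateField.lift_adjoin_simple] at this
    exact this.symm
  have haL' : (a : Ω) ∈ L' := IntermediateField.mem_adjoin_simple_self k' _
  have hLL' : L ≤ L'.restrictScalars k := by
    rw [hLa, IntermediateField.adjoin_le_iff]
    rintro _ rfl
    exact haL'
  have haint : IsIntegral k (a : Ω) := Algebra.IsIntegral.isIntegral _
  have : FiniteDimensional k' L' := IntermediateField.adjoin.finiteDimensional
    (haint.tower_top)
  have hGalL' : IsGalois k L' := adj_normal2 (k := k) (L := k') (a : Ω) (fun σ => by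
    rw [← show algebraMap L Ω a = (a : Ω) from rfl, ← AlgEquiv.restrictNormal_commutes σ L a]
    exact hLL' (σ.restrictNormal L a).2)
  have : IsScalarTower k k' L' := IsScalarTower.of_algebraMap_eq fun x =>
    Subtype.ext (IsScalarTower.algebraMap_apply k k' Ω x)
  have : IsGalois k' L' := IsGalois.tower_top_of_isGalois k k' L'
  let f : L →+* L' := (IntermediateField.inclusion hLL').toRingHom
  let _ : Algebra L L' := f.toAlgebra
  have hf : ∀ x : L, ((algebraMap L L' x : L') : Ω) = x := fun x => rfl
  have : IsScalarTower k L L' := IsScalarTower.of_algebraMap_eq fun x => rfl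
  have := if_tower1 p L
  have := if_tower2 p L
  have := if_tower3 p L
  have := if_tower1 p L'
  have := if_tower2 p L'
  have := if_tower3 p L'
  have : IsScalarTower ℚ_[p] k L' := IsScalarTower.of_algebraMap_eq fun x =>
    Subtype.ext (IsScalarTower.algebraMap_apply ℚ_[p] k Ω x)
  have : IsScalarTower ℚ_[p] L L' := IsScalarTower.of_algebraMap_eq fun x => rfl
  have : FiniteDimensional ℚ_[p] L := FiniteDimensional.trans ℚ_[p] k L
  have : FiniteDimensional ℚ_[p] L' := FiniteDimensional.trans ℚ_[p] k' L'
  have hgen : ∀ τ : L' ≃ₐ[k'] L', (∀ x : L, τ (algebraMap L L' x) = algebraMap L L' x) → τ = 1 := by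
    intro τ hτ
    have h3 : τ.toAlgHom = AlgHom.id k' L' := by
      refine IntermediateField.algHom_ext_of_eq_adjoin k' (S := L') rfl fun x hx => ?_
      have : x = (a : Ω) := hx
      subst this
      exact hτ a
    ext x
    exact congrArg _ (DFunLike.congr_fun h3 x)
  let R : (L' ≃ₐ[k'] L') →* (L ≃ₐ[k] L) :=
    (AlgEquiv.restrictNormalHom L).comp
      { toFun := fun σ => (σ.restrictScalars k : L' ≃ₐ[k] L')
        map_one' := rfl
        map_mul' := fun _ _ => rfl }
  have hR : Function.Injective R := by
    rw [injective_iff_map_eq_one]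
    intro τ hτ
    refine hgen τ fun x => ?_
    have h1 := AlgEquiv.restrictNormal_commutes (τ.restrictScalars k) L x
    have h2 : R τ x = x := by rw [hτ]; rfl
    change algebraMap L L' (R τ x) = τ _ at h1
    rw [← h1, h2]
  have hcyc : IsCyclic (L' ≃ₐ[k'] L') := isCyclic_of_injective R hR
  obtain ⟨s0, hs0⟩ := IsCyclic.exists_generator (α := L ≃ₐ[k] L)
  obtain ⟨t, ht⟩ := IsCyclic.exists_generator (α := L' ≃ₐ[k'] L')
  obtain ⟨z, hz⟩ := normLift p (L' := L') s0 hs0 hfL t ht hgen x hx y hxy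
  have hle : L' ≤ lubinTateExt k' Ω x := by
    refine le_iSup₂_of_le (f := fun (K : IntermediateField k' Ω) _ => K) L' ⟨inferInstance, inferInstance, ?_, z, hz⟩ le_rfl
    intro σ τ
    have hc : IsMulCommutative (L' ≃ₐ[k'] L') := inferInstance
    exact hc.is_comm.comm σ τ
  exact fun w hw => hle (hLL' hw)
end Part14

section Part15
open Module
set_option linter.unusedSectionVars false
set_option linter.unusedVariables false

theorem lift_ab (p : ℕ) [Fact p.Prime] {k k' Ω : Type}
    [Field k] [Algebra ℚ_[p] k] [FiniteDimensional ℚ_[p] k] [Algebra ℤ_[p] k] [IsScalarTower ℤ_[p] ℚ_[p] k]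
    [Field k'] [Algebra ℚ_[p] k'] [FiniteDimensional ℚ_[p] k'] [Algebra ℤ_[p] k'] [IsScalarTower ℤ_[p] ℚ_[p] k']
    [Field Ω] [Algebra ℚ_[p] Ω] [Algebra ℤ_[p] Ω] [IsScalarTower ℤ_[p] ℚ_[p] Ω]
    [Algebra k k'] [Algebra k Ω] [Algebra k' Ω] [IsScalarTower k k' Ω]
    [IsScalarTower ℚ_[p] k k'] [IsScalarTower ℚ_[p] k Ω] [IsScalarTower ℚ_[p] k' Ω]
    [IsScalarTower ℤ_[p] k Ω] [IsScalarTower ℤ_[p] k' Ω]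
    [IsGalois k Ω] [IsGalois k k']
    (π : k) (hπ : IsUniformizer p k π) (x : k') (hx : x ≠ 0) (c : ℕ) (hxc : Algebra.norm k x = π ^ c)
    (L : IntermediateField k Ω) [FiniteDimensional k L] [IsGalois k L]
    (hab : ∀ σ τ : L ≃ₐ[k] L, σ * τ = τ * σ) (y : L) (hy : Algebra.norm k y = π) :
    (L : Set Ω) ⊆ (lubinTateExt k' Ω x : Set Ω) := by
  rw [isUniformizer_iff] at hπ
  have : CharZero k := charZero_of_injective_algebraMap (algebraMap ℚ_[p] k).injective
  let T : IntermediateField k Ω := (lubinTateExt k' Ω x).restrictScalars k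
  let T0 : IntermediateField k L := T.comap L.val
  have hT0 : T0 = ⊤ := by
    rw [← IsGalois.fixedField_fixingSubgroup T0]
    suffices h : T0.fixingSubgroup = ⊥ by rw [h, IntermediateField.fixedField_bot]
    rw [eq_bot_iff]
    intro σ hσ
    rw [Subgroup.mem_bot]
    by_contra hσ1
    let _ : CommGroup (L ≃ₐ[k] L) := { (inferInstance : Group (L ≃ₐ[k] L)) with mul_comm := hab }
    have : NeZero (Monoid.exponent (L ≃ₐ[k] L)) := ⟨Monoid.exponent_ne_zero_of_finite⟩
    obtain ⟨φ, hφ⟩ := CommGroup.exists_apply_ne_one_of_hasEnoughRootsOfUnity (L ≃ₐ[k] L) ℂ hσ1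
    let H := φ.ker
    let K := IntermediateField.fixedField H
    have hcyc : IsCyclic (K ≃ₐ[k] K) := by
      have h1 : IsCyclic φ.range := inferInstance
      have h2 : IsCyclic ((L ≃ₐ[k] L) ⧸ φ.ker) :=
        isCyclic_of_injective (QuotientGroup.quotientKerEquivRange φ).toMonoidHom
          (QuotientGroup.quotientKerEquivRange φ).injective
      exact isCyclic_of_injective (IsGalois.normalAutEquivQuotient H).symm.toMonoidHom
        (IsGalois.normalAutEquivQuotient H).symm.injective
    have hgal : IsGalois k K := inferInstance
    let e : K ≃ₐ[k] IntermediateField.lift K := IntermediateField.liftAlgEquiv K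
    have he : ∀ w : K, ((e w : IntermediateField.lift K) : Ω) = ((w : L) : Ω) := fun w => rfl
    let K1 := IntermediateField.lift K
    have : FiniteDimensional k K1 := e.toLinearEquiv.finiteDimensional
    have : IsGalois k K1 := IsGalois.of_algEquiv e
    have : IsCyclic (K1 ≃ₐ[k] K1) := isCyclic_of_injective (AlgEquiv.autCongr e).symm.toMonoidHom
        (AlgEquiv.autCongr e).symm.injective
    have := if_tower1 p K1
    have := if_tower2 p K1
    have := if_tower3 p K1
    have : FiniteDimensional ℚ_[p] K1 := FiniteDimensional.trans ℚ_[p] k K1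
    let z : K1 := e (Algebra.norm K y)
    have hz : Algebra.norm k z = π := by
      rw [Algebra.norm_eq_of_algEquiv, Algebra.norm_norm, hy]
    have hz0 : z ≠ 0 := by
      rintro h
      rw [h, Algebra.norm_zero] at hz
      exact hπ.1 hz.symm
    have hf : fdeg p K1 = fdeg p k := by
      refine dvd_antisymm ?_ (fdeg_dvd_fdeg p k K1)
      have h1 := fdeg_dvd p hz0
      rw [← wv_norm p (E := k) z, hz, hπ.2] at h1
      exact_mod_cast h1
    have hK := lift_cyc p K1 hf x hx (z ^ c) (by rw [hxc, map_pow, hz])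
    have hKT : K ≤ T0 := fun w hw => hK (e ⟨w, hw⟩).2
    have hσH : σ ∈ H := by
      rw [← IntermediateField.fixingSubgroup_fixedField H]
      rw [IntermediateField.mem_fixingSubgroup_iff] at hσ ⊢
      exact fun w hw => hσ w (hKT hw)
    exact hφ hσH
  intro w hw
  have h1 : (⟨w, hw⟩ : L) ∈ T0 := by rw [hT0]; trivial
  exact h1
end Part15

open Module
set_option linter.unusedSectionVars false
set_option linter.unusedVariables false

/-- Let `k` be a `p`-adic field with Galois closure `k_G/ℚ_p`,
`d_G = [k_G : ℚ_p]`, and `e_G` the ramification index of `k_G/k`.  For every uniformizer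
`π` of `k` there are a finite unramified extension `k'/k_G` (inside `\bar{ℚ}_p`) and a
uniformizer `π'` of `k'` with: (i) `Nr_{k'/k}(π') = π^{f_{k'/k}}`; (ii) `k_π ⊆ k'_{π'}`;
(iii) `k'/ℚ_p` Galois; (iv) `[k' : ℚ_p] = s·d_G` for some `1 ≤ s ≤ e_G`. -/
theorem stmt_9 (p : ℕ) [Fact p.Prime] (k kG : Type) [Field k] [Field kG]
    [Algebra ℚ_[p] k] [Algebra ℚ_[p] kG] [Algebra k kG] [IsScalarTower ℚ_[p] k kG]
    [FiniteDimensional ℚ_[p] kG]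
    [Algebra ℤ_[p] k] [IsScalarTower ℤ_[p] ℚ_[p] k]
    [Algebra ℤ_[p] kG] [IsScalarTower ℤ_[p] ℚ_[p] kG]
    [Algebra k (AlgebraicClosure ℚ_[p])] [Algebra kG (AlgebraicClosure ℚ_[p])]
    [IsScalarTower k kG (AlgebraicClosure ℚ_[p])]
    [IsScalarTower ℚ_[p] kG (AlgebraicClosure ℚ_[p])]
    [IsScalarTower ℤ_[p] kG (AlgebraicClosure ℚ_[p])]
    -- `k_G` is the Galois closure of `k/ℚ_p`:
    [IsGalois ℚ_[p] kG]
    (hmin : ∀ M : IntermediateField k kG, Normal ℚ_[p] M → M = ⊤)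
    -- `e_G` is the ramification index (and `f_G` the residual degree) of `k_G/k`:
    (eG fG : ℕ) (heG : Module.finrank k kG = eG * fG)
    (hfG : resCard p kG = (resCard p k) ^ fG)
    (π : k) (hπ : IsUniformizer p k π) :
    ∃ (k' : IntermediateField kG (AlgebraicClosure ℚ_[p])) (π' : k'),
      FiniteDimensional kG k' ∧
      -- `k'/k_G` is unramified:
      resCard p k' = (resCard p kG) ^ (Module.finrank kG k') ∧
      IsUniformizer p k' π' ∧
      -- (i) `Nr_{k'/k}(π') = π ^ f_{k'/k}`:
      (∃ fkk : ℕ, resCard p k' = (resCard p k) ^ fkk ∧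
        Algebra.norm k π' = π ^ fkk) ∧
      -- (ii) `k_π ⊆ k'_{π'}`:
      ((lubinTateExt k (AlgebraicClosure ℚ_[p]) π : Set (AlgebraicClosure ℚ_[p])) ⊆
        (lubinTateExt k' (AlgebraicClosure ℚ_[p]) π' : Set (AlgebraicClosure ℚ_[p]))) ∧
      -- (iii) `k'/ℚ_p` is Galois:
      IsGalois ℚ_[p] k' ∧
      -- (iv) `[k' : ℚ_p] = s·d_G` with `1 ≤ s ≤ e_G`:
      (∃ s : ℕ, 1 ≤ s ∧ s ≤ eG ∧
        Module.finrank ℚ_[p] k' = s * Module.finrank ℚ_[p] kG) := by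
  have : FiniteDimensional ℚ_[p] k := FiniteDimensional.left ℚ_[p] k kG
  have : FiniteDimensional k kG := FiniteDimensional.right ℚ_[p] k kG
  have hpos : 0 < finrank k kG := finrank_pos
  have hs : 0 < eG := by rw [heG] at hpos; exact Nat.pos_of_mul_pos_right hpos
  have hfG0 : 0 < fG := by rw [heG] at hpos; exact Nat.pos_of_mul_pos_left hpos
  have hfkG : fdeg p kG = fdeg p k * fG := (resCard_pow_iff p fG).1 hfG
  have hfk := fdeg_pos p (E := k)
  have hfkg := fdeg_pos p (E := kG)
  have hQ1 : 1 < resCard p kG := by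
    rw [resCard_eq_pow]; exact Nat.one_lt_pow hfkg.ne' (Fact.out : p.Prime).one_lt
  let N := resCard p kG ^ eG - 1
  have hN0 : 0 < N := by
    have := Nat.one_lt_pow hs.ne' hQ1
    change 0 < resCard p kG ^ eG - 1
    omega
  have : NeZero N := ⟨hN0.ne'⟩
  let Ω := AlgebraicClosure ℚ_[p]
  have : CharZero Ω := charZero_of_injective_algebraMap (algebraMap ℚ_[p] Ω).injective
  have : CharZero k := charZero_of_injective_algebraMap (algebraMap ℚ_[p] k).injective
  obtain ⟨ζ, hζ⟩ : ∃ ζ : Ω, IsPrimitiveRoot ζ N :=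
    HasEnoughRootsOfUnity.exists_primitiveRoot _ _
  have : IsScalarTower ℚ_[p] k Ω := IsScalarTower.of_algebraMap_eq fun x => by
    rw [IsScalarTower.algebraMap_apply k kG Ω, ← IsScalarTower.algebraMap_apply ℚ_[p] k kG,
      ← IsScalarTower.algebraMap_apply ℚ_[p] kG Ω]
  have : Normal ℚ_[p] Ω := IsAlgClosure.normal _ _
  have hGΩ : IsGalois ℚ_[p] Ω := ⟨⟩
  have hGkΩ : IsGalois k Ω := IsGalois.tower_top_of_isGalois ℚ_[p] k Ω
  have hgal : IsGalois ℚ_[p] (IntermediateField.adjoin kG {ζ}) := adj_normal p ζ (fun σ => by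
    have : (σ ζ) ^ N = 1 := by rw [← map_pow, hζ.pow_eq_one, map_one]
    obtain ⟨i, -, hi⟩ := hζ.eq_pow_of_pow_eq_one this
    exact ⟨i, hi.symm⟩)
  let k' := IntermediateField.adjoin kG {ζ}
  have : FiniteDimensional kG k' := IntermediateField.adjoin.finiteDimensional
    ((Algebra.IsIntegral.isIntegral (R := ℚ_[p]) ζ).tower_top)
  have : IsScalarTower ℤ_[p] k kG := tower_zp p
  have : IsScalarTower ℤ_[p] k Ω := IsScalarTower.of_algebraMap_eq fun x => by
    rw [IsScalarTower.algebraMap_apply k kG Ω, ← IsScalarTower.algebraMap_apply ℤ_[p] k kG,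
      ← IsScalarTower.algebraMap_apply ℤ_[p] kG Ω]
  have := if_tower1 p k'
  have := if_tower2 p k'
  have := if_tower3 p k'
  have : IsScalarTower ℤ_[p] k' Ω := IsScalarTower.of_algebraMap_eq fun x => rfl
  have : FiniteDimensional ℚ_[p] k' := FiniteDimensional.trans ℚ_[p] kG k'
  have : IsScalarTower k kG k' := IsScalarTower.of_algebraMap_eq fun x =>
    Subtype.ext (IsScalarTower.algebraMap_apply k kG Ω x)
  have : IsScalarTower k k' Ω := IsScalarTower.of_algebraMap_eq fun x => rfl
  have : IsScalarTower ℚ_[p] k k' := IsScalarTower.of_algebraMap_eq fun x =>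
    Subtype.ext (IsScalarTower.algebraMap_apply ℚ_[p] k Ω x)
  have : FiniteDimensional k k' := FiniteDimensional.right ℚ_[p] k k'
  have hgalk : IsGalois k k' := IsGalois.tower_top_of_isGalois ℚ_[p] k k'
  have hgalkG : IsGalois kG k' := IsGalois.tower_top_of_isGalois ℚ_[p] kG k'
  let ζ' : k' := ⟨ζ, IntermediateField.mem_adjoin_simple_self kG ζ⟩
  have hζ' : IsPrimitiveRoot ζ' N :=
    IsPrimitiveRoot.of_map_of_injective (f := algebraMap k' Ω) hζ (algebraMap k' Ω).injective
  obtain ⟨hfk', hrk', -⟩ := unr_ext p (L := kG) (M := k') eG hs ζ' hζ' (fun τ h2 => by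
      have h3 : τ.toAlgHom = AlgHom.id kG k' := by
        refine IntermediateField.algHom_ext_of_eq_adjoin kG (S := k') rfl fun x hx => ?_
        have : x = ζ := hx
        subst this
        exact h2
      ext x
      exact congrArg _ (DFunLike.congr_fun h3 x))
  -- the unramified subextension
  have hNq : N = resCard p k ^ (eG * fG) - 1 := by
    change resCard p kG ^ eG - 1 = _
    rw [hfG, ← pow_mul, mul_comm]
  have hgalK : IsGalois k (IntermediateField.adjoin k {ζ'}) := adj_normal p ζ' (fun σ => by
    have : (σ ζ') ^ N = 1 := by rw [← map_pow, hζ'.pow_eq_one, map_one]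
    obtain ⟨i, -, hi⟩ := hζ'.eq_pow_of_pow_eq_one this
    exact ⟨i, hi.symm⟩)
  let K := IntermediateField.adjoin k {ζ'}
  have : IsScalarTower ℤ_[p] k k' := tower_zp p
  have := if_tower1 p K
  have := if_tower2 p K
  have := if_tower3 p K
  have : FiniteDimensional ℚ_[p] K := FiniteDimensional.left ℚ_[p] K k'
  let ζK : K := ⟨ζ', IntermediateField.mem_adjoin_simple_self k ζ'⟩
  have hζK : IsPrimitiveRoot ζK N :=
    IsPrimitiveRoot.of_map_of_injective (f := algebraMap K k') hζ' (algebraMap K k').injective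
  obtain ⟨hfK, hrK, h, -, hh⟩ := unr_ext p (L := k) (M := K) (eG * fG) (Nat.mul_pos hs hfG0) ζK
    (hNq ▸ hζK) (fun τ h2 => by
      have h3 : τ.toAlgHom = AlgHom.id k K := by
        refine IntermediateField.algHom_ext_of_eq_adjoin k (S := K) rfl fun x hx => ?_
        have : x = ζ' := hx
        subst this
        exact h2
      ext x
      exact congrArg _ (congrArg _ (DFunLike.congr_fun h3 x)))
  have hrKk' : finrank K k' = eG := by
    have h1 := finrank_mul_finrank k K k'
    rw [← finrank_mul_finrank k kG k', hrk', hrK, heG] at h1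
    exact Nat.eq_of_mul_eq_mul_left (Nat.mul_pos hs hfG0) h1
  obtain ⟨ϖ, hϖ, hwϖ⟩ := exists_unif p (E := kG)
  obtain ⟨hπ0, hwπ⟩ := (isUniformizer_iff p π).1 hπ
  have hη0 : Algebra.norm k ϖ ≠ 0 := by rwa [Ne, Algebra.norm_eq_zero_iff]
  have hπf : π ^ fG ≠ 0 := pow_ne_zero _ hπ0
  let u : k := Algebra.norm k ϖ * (π ^ fG)⁻¹
  have hu : u ≠ 0 := mul_ne_zero hη0 (inv_ne_zero hπf)
  have hwu : wv p u = 0 := by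
    change wv p (Algebra.norm k ϖ * (π ^ fG)⁻¹) = 0
    rw [wv_mul p hη0 (inv_ne_zero hπf), wv_inv, wv_pow, wv_norm, hwϖ, hwπ, hfkG]
    push_cast; ring
  obtain ⟨v, hv⟩ := unram_norm p h hh (by rw [hfK, hrK]) u hu hwu
  have hv0 : v ≠ 0 := by
    rintro rfl
    rw [Algebra.norm_zero] at hv
    exact hu hv.symm
  have hwv : wv p v = 0 := by rw [← wv_norm p (E := k) v, hv, hwu]
  have hV0 : algebraMap K k' v ≠ 0 := by simpa using hv0
  have hW0 : algebraMap kG k' ϖ ≠ 0 := by simpa using hϖ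
  let π' : k' := algebraMap kG k' ϖ * (algebraMap K k' v)⁻¹
  have hπ'0 : π' ≠ 0 := mul_ne_zero hW0 (inv_ne_zero hV0)
  have hπ'u : IsUniformizer p k' π' := by
    rw [isUniformizer_iff]
    refine ⟨hπ'0, ?_⟩
    change wv p (algebraMap kG k' ϖ * (algebraMap K k' v)⁻¹) = _
    rw [wv_mul p hW0 (inv_ne_zero hV0), wv_inv, wv_algebraMap, wv_algebraMap, hwv, hwϖ, hrk', hfk']
    push_cast; ring
  have hnorm : Algebra.norm k π' = π ^ (eG * fG) := by
    change Algebra.norm k (algebraMap kG k' ϖ * (algebraMap K k' v)⁻¹) = _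
    have e1 : Algebra.norm k (algebraMap kG k' ϖ) = (Algebra.norm k ϖ) ^ eG := by
      have h1 : Algebra.norm k (Algebra.norm kG (algebraMap kG k' ϖ)) =
        Algebra.norm k (algebraMap kG k' ϖ) := Algebra.norm_norm
      rw [← h1, Algebra.norm_algebraMap, hrk', map_pow]
    have e2 : Algebra.norm k (algebraMap K k' v) = u ^ eG := by
      have h1 : Algebra.norm k (Algebra.norm K (algebraMap K k' v)) =
        Algebra.norm k (algebraMap K k' v) := Algebra.norm_norm
      rw [← h1, Algebra.norm_algebraMap, hrKk', map_pow, hv]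
    have e3 : Algebra.norm k ((algebraMap K k' v)⁻¹) = (u ^ eG)⁻¹ := by
      refine eq_inv_of_mul_eq_one_left ?_
      rw [← e2, ← map_mul, inv_mul_cancel₀ hV0, map_one]
    rw [map_mul, e1, e3]
    change _ * ((Algebra.norm k ϖ * (π ^ fG)⁻¹) ^ eG)⁻¹ = _
    rw [mul_comm eG fG, pow_mul, mul_pow, mul_inv, inv_pow, inv_inv, ← mul_assoc,
      mul_inv_cancel₀ (pow_ne_zero _ hη0), one_mul]
  refine ⟨k', π', inferInstance, ?_, hπ'u, ⟨eG * fG, ?_, hnorm⟩, ?_, hgal, eG, hs, le_rfl, ?_⟩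
  · rw [resCard_pow_iff, hrk', hfk', mul_comm]
  · rw [resCard_pow_iff, hfk', hfkG]; ring
  · have hle : lubinTateExt k Ω π ≤ (lubinTateExt k' Ω π').restrictScalars k := by
      refine iSup₂_le fun L hL => ?_
      obtain ⟨h1, h2, h3, y, hy⟩ := hL
      exact lift_ab p π hπ π' hπ'0 (eG * fG) hnorm L h3 y hy
    exact hle
  · rw [← finrank_mul_finrank ℚ_[p] kG k', hrk', mul_comm]
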